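/- arXiv:2210.11325 — 9 statements merged into one kernel-verified Lean document; each statement's English description precedes it below -/
import Mathlib

section
/- First-derivative estimate for axis averages: In the averaging setup, for every f ∈ C¹([u,u_Γ]) and every x ∈ [u,u_Γ), one has the identity (I[f])′(x) = r(x)⁻² ν(x) ∫_x^{u_Γ} r(u′)·(f/ν)′(u′) du′, and consequently |(I[f])′(x)| ≤ (sup_{[x,u_Γ]}|ν| / inf_{[x,u_Γ]}|ν|) · sup_{[x,u_Γ]} |(f/ν)′|. -/
open Set

/-- **First-derivative estimate for axis averages** (Lemma 2.7).  In the averaging setup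
(`u < u_Γ`, `r ∈ C²([u,u_Γ])` with `r(u_Γ) = 0`, `r > 0` on `[u,u_Γ)`, `ν := r′ < 0`),
for every `f ∈ C¹([u,u_Γ])` and every `x ∈ [u,u_Γ)` one has the identity
`(I[f])′(x) = r(x)⁻² ν(x) ∫_x^{u_Γ} r·(f/ν)′`, where `I[f](x) = r(x)⁻¹ ∫_x^{u_Γ} f`;
consequently `|(I[f])′(x)| ≤ (sup |ν| / inf |ν|) · sup |(f/ν)′|`, the sup and inf being
taken over `[x,u_Γ]`. -/
theorem axis_average_first_derivative
    (u uΓ : ℝ) (hu : u < uΓ) (r ν f g : ℝ → ℝ)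
    (hr : ContDiffOn ℝ 2 r (Icc u uΓ))
    (hrΓ : r uΓ = 0)
    (hrpos : ∀ x ∈ Ico u uΓ, 0 < r x)
    (hν : ∀ x ∈ Icc u uΓ, HasDerivWithinAt r (ν x) (Icc u uΓ) x)
    (hνneg : ∀ x ∈ Icc u uΓ, ν x < 0)
    (hf : ContDiffOn ℝ 1 f (Icc u uΓ))
    (hg : ∀ x ∈ Icc u uΓ, HasDerivWithinAt (fun t => f t / ν t) (g x) (Icc u uΓ) x) :
    ∀ x ∈ Ico u uΓ,
      HasDerivWithinAt (fun y => (r y)⁻¹ * ∫ t in y..uΓ, f t)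
        ((r x)⁻¹ ^ 2 * ν x * ∫ t in x..uΓ, r t * g t) (Ico u uΓ) x ∧
      ∀ Mν mν Mg : ℝ,
        (∀ t ∈ Icc x uΓ, |ν t| ≤ Mν) →
        (∀ t ∈ Icc x uΓ, mν ≤ |ν t|) → 0 < mν →
        (∀ t ∈ Icc x uΓ, |g t| ≤ Mg) →
        |(r x)⁻¹ ^ 2 * ν x * ∫ t in x..uΓ, r t * g t| ≤ Mν / mν * Mg := by
  have hud : UniqueDiffOn ℝ (Icc u uΓ) := uniqueDiffOn_Icc hu
  have hνC : ContDiffOn ℝ 1 ν (Icc u uΓ) :=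
    (hr.derivWithin hud (m := 1) (by norm_num)).congr fun t ht =>
      ((hν t ht).derivWithin (hud t ht)).symm
  have hgC : ContinuousOn g (Icc u uΓ) :=
    ((hf.div hνC fun t ht => (hνneg t ht).ne).continuousOn_derivWithin hud le_rfl).congr
      fun t ht => ((hg t ht).derivWithin (hud t ht)).symm
  intro x hx
  have hxI : x ∈ Icc u uΓ := ⟨hx.1, hx.2.le⟩
  have hsub : uIcc x uΓ ⊆ Icc u uΓ := by
    rw [uIcc_of_le hx.2.le]
    exact Icc_subset_Icc_left hx.1
  have hνi : IntervalIntegrable ν MeasureTheory.volume x uΓ := (hνC.continuousOn.mono hsub).intervalIntegrable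
  have hgi : IntervalIntegrable g MeasureTheory.volume x uΓ := (hgC.mono hsub).intervalIntegrable
  have hr' : ∀ t ∈ uIcc x uΓ, HasDerivWithinAt r (ν t) (uIcc x uΓ) t :=
    fun t ht => (hν t (hsub ht)).mono hsub
  have hrx : 0 < r x := hrpos x hx
  refine ⟨?_, ?_⟩
  · have hparts : ∫ t in x..uΓ, r t * g t = -(r x * (f x / ν x)) - ∫ t in x..uΓ, f t := by
      rw [intervalIntegral.integral_mul_deriv_eq_deriv_mul_of_hasDerivWithinAt hr'
        (fun t ht => (hg t (hsub ht)).mono hsub) hνi hgi, hrΓ]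
      have : ∫ t in x..uΓ, ν t * (f t / ν t) = ∫ t in x..uΓ, f t :=
        intervalIntegral.integral_congr fun t ht =>
          mul_div_cancel₀ (f t) (hνneg t (hsub ht)).ne
      rw [this]
      ring
    have hInt : HasDerivWithinAt (fun y => ∫ t in y..uΓ, f t) (-f x) (Icc u uΓ) x := by
      have : Fact (x ∈ Icc u uΓ) := ⟨hxI⟩
      exact intervalIntegral.integral_hasDerivWithinAt_left
        (hf.continuousOn.mono hsub).intervalIntegrable
        (hf.continuousOn.stronglyMeasurableAtFilter_nhdsWithin measurableSet_Icc x)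
        (hf.continuousOn x hxI)
    refine ((((hν x hxI).inv hrx.ne').mul hInt).mono Ico_subset_Icc_self).congr_deriv ?_
    have hνx := (hνneg x hxI).ne
    rw [hparts]
    simp only [Pi.inv_apply]
    field_simp
    ring
  · intro Mν mν Mg hM hm hm0 hMg
    have hxx : x ∈ Icc x uΓ := left_mem_Icc.2 hx.2.le
    have hMg0 : 0 ≤ Mg := (abs_nonneg _).trans (hMg x hxx)
    have hsq : ∫ t in x..uΓ, (ν t * r t + r t * ν t) = -(r x) ^ 2 := by
      rw [intervalIntegral.integral_deriv_mul_eq_sub_of_hasDerivWithinAt hr' hr' hνi hνi, hrΓ]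
      ring
    have hrν : IntervalIntegrable (fun t => ν t * r t + r t * ν t) MeasureTheory.volume x uΓ :=
      (((hνC.continuousOn.mul hr.continuousOn).add
        (hr.continuousOn.mul hνC.continuousOn)).mono hsub).intervalIntegrable
    have hbound : |∫ t in x..uΓ, r t * g t| ≤ Mg / mν * (r x) ^ 2 := by
      calc |∫ t in x..uΓ, r t * g t|
          ≤ ∫ t in x..uΓ, -(Mg / mν) * (ν t * r t + r t * ν t) := by
            rw [← Real.norm_eq_abs]
            refine intervalIntegral.norm_integral_le_of_norm_le hx.2.le
              (Filter.Eventually.of_forall fun t ht => ?_) (hrν.const_mul _)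
            have htI : t ∈ Icc x uΓ := Ioc_subset_Icc_self ht
            have htU : t ∈ Icc u uΓ := ⟨hx.1.trans htI.1, htI.2⟩
            have hrt : 0 ≤ r t := by
              rcases htI.2.eq_or_lt with h | h
              · rw [h, hrΓ]
              · exact (hrpos t ⟨htU.1, h⟩).le
            have hνt : mν ≤ -ν t := abs_of_neg (hνneg t htU) ▸ hm t htI
            have hq : 0 ≤ Mg / mν := div_nonneg hMg0 hm0.le
            rw [Real.norm_eq_abs, abs_mul, abs_of_nonneg hrt]
            calc r t * |g t| ≤ r t * (Mg / mν * mν) := by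
                  rw [div_mul_cancel₀ _ hm0.ne']
                  exact mul_le_mul_of_nonneg_left (hMg t htI) hrt
              _ ≤ r t * (Mg / mν * (2 * -ν t)) := by
                  gcongr
                  linarith
              _ = -(Mg / mν) * (ν t * r t + r t * ν t) := by ring
        _ = Mg / mν * (r x) ^ 2 := by
            rw [intervalIntegral.integral_const_mul, hsq]
            ring
    rw [abs_mul, abs_mul, abs_of_nonneg (by positivity : 0 ≤ (r x)⁻¹ ^ 2)]
    calc (r x)⁻¹ ^ 2 * |ν x| * |∫ t in x..uΓ, r t * g t|
        ≤ (r x)⁻¹ ^ 2 * Mν * (Mg / mν * (r x) ^ 2) := by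
          have hMν : 0 ≤ Mν := (abs_nonneg _).trans (hM x hxx)
          have := hM x hxx
          gcongr
      _ = Mν / mν * Mg := by
          field_simp
end

section
/- Second-derivative estimate for axis averages: In the averaging setup with r ∈ C³([u,u_Γ]), there is an absolute constant C such that for every f ∈ C²([u,u_Γ]) and every x ∈ [u,u_Γ): |(I[f])″(x)| ≤ C·[ (sup_{[x,u_Γ]}|ν′| / inf_{[x,u_Γ]}|ν|) · sup_{[x,u_Γ]}|(f/ν)′| + (sup_{[x,u_Γ]}|ν|² / inf_{[x,u_Γ]}|ν|) · sup_{[x,u_Γ]} |(ν⁻¹·(f/ν)′)′| ]. -/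
open Set

/-- The integral of a continuous function over `[y, b]`, as a function of `y ∈ [a, b]`,
has derivative `-f`. -/
theorem hasDerivWithinAt_integral_left_of_continuousOn {a b : ℝ} (hab : a ≤ b) {f : ℝ → ℝ}
    (hf : ContinuousOn f (Icc a b)) {x : ℝ} (hx : x ∈ Icc a b) :
    HasDerivWithinAt (fun y => ∫ t in y..b, f t) (-f x) (Icc a b) x := by
  have hc : Continuous (IccExtend hab ((Icc a b).domRestrict f)) :=
    (continuousOn_iff_continuous_domRestrict.1 hf).Icc_extend'
  have heq : ∀ t ∈ Icc a b, IccExtend hab ((Icc a b).domRestrict f) t = f t := fun t ht => by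
    rw [IccExtend_of_mem hab _ ht]; rfl
  have hd := intervalIntegral.integral_hasDerivAt_left (hc.intervalIntegrable x b)
    (hc.stronglyMeasurableAtFilter _ _) hc.continuousAt
  rw [heq x hx] at hd
  have hcongr : ∀ y ∈ Icc a b,
      ∫ t in y..b, f t = ∫ t in y..b, IccExtend hab ((Icc a b).domRestrict f) t := by
    intro y hy
    refine intervalIntegral.integral_congr fun t ht => ?_
    rw [uIcc_of_le hy.2] at ht
    exact (heq t ⟨hy.1.trans ht.1, ht.2⟩).symm
  exact hd.hasDerivWithinAt.congr hcongr (hcongr x hx)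

/-- If `Q` and `S` vanish at `b` and `|Q'| ≤ -S'` on `[a, b]`, then `|Q a| ≤ S a`. -/
theorem abs_le_of_abs_hasDerivWithinAt_le_neg {a b : ℝ} (hab : a ≤ b) {Q S Q' S' : ℝ → ℝ}
    (hQ : ∀ t ∈ Icc a b, HasDerivWithinAt Q (Q' t) (Icc a b) t)
    (hS : ∀ t ∈ Icc a b, HasDerivWithinAt S (S' t) (Icc a b) t)
    (hQb : Q b = 0) (hSb : S b = 0) (hle : ∀ t ∈ Icc a b, |Q' t| ≤ -S' t) :
    |Q a| ≤ S a := by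
  have key : ∀ ε : ℝ, |ε| = 1 → 0 ≤ S a + ε * Q a := by
    intro ε hε
    have hd : ∀ t ∈ Icc a b,
        HasDerivWithinAt (fun y => S y + ε * Q y) (S' t + ε * Q' t) (Icc a b) t :=
      fun t ht => (hS t ht).add ((hQ t ht).const_mul ε)
    have hanti : AntitoneOn (fun y => S y + ε * Q y) (Icc a b) := by
      refine antitoneOn_of_hasDerivWithinAt_nonpos (convex_Icc a b)
        (fun t ht => (hd t ht).continuousWithinAt)
        (fun t ht => (hd t (interior_subset ht)).mono interior_subset) fun t ht => ?_
      have h1 := hle t (interior_subset ht)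
      have h2 := le_abs_self (ε * Q' t)
      rw [abs_mul, hε, one_mul] at h2
      linarith
    have := hanti (left_mem_Icc.2 hab) (right_mem_Icc.2 hab) hab
    simpa [hQb, hSb] using this
  have h1 := key 1 (by simp)
  have h2 := key (-1) (by simp)
  exact abs_le.2 ⟨by linarith, by linarith⟩

/-- **Second-derivative estimate for axis averages** (Lemma 2.9).  In the averaging setup
with `r ∈ C³([u,u_Γ])`, there is an absolute constant `C` such that for every
`f ∈ C²([u,u_Γ])` and every `x ∈ [u,u_Γ)`:
`|(I[f])″(x)| ≤ C·[ (sup|ν′|/inf|ν|)·sup|(f/ν)′| + (sup|ν|²/inf|ν|)·sup|(ν⁻¹·(f/ν)′)′| ]`,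
sup and inf over `[x,u_Γ]`.  Here `ν = r′`, `g = (f/ν)′` and `h = (ν⁻¹·g)′`. -/
theorem axis_average_second_derivative :
    ∃ C : ℝ, 0 < C ∧
      ∀ (u uΓ : ℝ), u < uΓ →
      ∀ (r ν ν' f g h : ℝ → ℝ),
        ContDiffOn ℝ 3 r (Icc u uΓ) →
        r uΓ = 0 →
        (∀ x ∈ Ico u uΓ, 0 < r x) →
        (∀ x ∈ Icc u uΓ, HasDerivWithinAt r (ν x) (Icc u uΓ) x) →
        (∀ x ∈ Icc u uΓ, ν x < 0) →
        (∀ x ∈ Icc u uΓ, HasDerivWithinAt ν (ν' x) (Icc u uΓ) x) →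
        ContDiffOn ℝ 2 f (Icc u uΓ) →
        (∀ x ∈ Icc u uΓ, HasDerivWithinAt (fun t => f t / ν t) (g x) (Icc u uΓ) x) →
        (∀ x ∈ Icc u uΓ, HasDerivWithinAt (fun t => (ν t)⁻¹ * g t) (h x) (Icc u uΓ) x) →
        ∀ x ∈ Ico u uΓ,
        ∀ Mν Mν' mν Mg Mh : ℝ,
          (∀ t ∈ Icc x uΓ, |ν t| ≤ Mν) →
          (∀ t ∈ Icc x uΓ, |ν' t| ≤ Mν') →
          (∀ t ∈ Icc x uΓ, mν ≤ |ν t|) → 0 < mν →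
          (∀ t ∈ Icc x uΓ, |g t| ≤ Mg) →
          (∀ t ∈ Icc x uΓ, |h t| ≤ Mh) →
          |iteratedDerivWithin 2 (fun y => (r y)⁻¹ * ∫ t in y..uΓ, f t) (Ico u uΓ) x|
            ≤ C * (Mν' / mν * Mg + Mν ^ 2 / mν * Mh) := by
  refine ⟨1, one_pos, ?_⟩
  intro u uΓ huΓ r ν ν' f g h _ hrΓ hrpos hr hνneg hν hf hF hG x hx Mν Mν' mν Mg Mh
    hMν hMν' hmν hmpos hMg hMh
  set Φ : ℝ → ℝ := fun y => ∫ t in y..uΓ, f t with hΦdef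
  set P : ℝ → ℝ := fun y => -(f y / ν y * r y) - Φ y with hPdef
  set K : ℝ → ℝ := fun y => -2 * P y - (ν y)⁻¹ * g y * r y ^ 2 with hKdef
  have hΦ : ∀ y ∈ Icc u uΓ, HasDerivWithinAt Φ (-f y) (Icc u uΓ) y := fun y hy =>
    hasDerivWithinAt_integral_left_of_continuousOn huΓ.le hf.continuousOn hy
  have hP : ∀ y ∈ Icc u uΓ, HasDerivWithinAt P (-(g y * r y)) (Icc u uΓ) y := by
    intro y hy
    have hν0 := (hνneg y hy).ne
    refine ((((hF y hy).mul (hr y hy)).neg).sub (hΦ y hy)).congr_deriv ?_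
    field_simp
    ring
  have hK : ∀ y ∈ Icc u uΓ, HasDerivWithinAt K (-(h y * r y ^ 2)) (Icc u uΓ) y := by
    intro y hy
    have hν0 := (hνneg y hy).ne
    refine (((hP y hy).const_mul (-2)).sub ((hG y hy).mul ((hr y hy).pow 2))).congr_deriv ?_
    simp only [Pi.pow_apply]
    field_simp
    ring
  have hsub : Ico u uΓ ⊆ Icc u uΓ := Ico_subset_Icc_self
  have hA : ∀ y ∈ Ico u uΓ,
      HasDerivWithinAt (fun y => (r y)⁻¹ * Φ y) (ν y * P y / r y ^ 2) (Ico u uΓ) y := by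
    intro y hy
    have hν0 := (hνneg y (hsub hy)).ne
    have hr0 := (hrpos y hy).ne'
    refine ((((hr y (hsub hy)).mono hsub).inv hr0).mul
      ((hΦ y (hsub hy)).mono hsub)).congr_deriv ?_
    simp only [hPdef, Pi.inv_apply]
    field_simp
    ring
  have hA' : HasDerivWithinAt (fun y => ν y * P y / r y ^ 2)
      (ν' x * P x / r x ^ 2 + ν x ^ 2 * K x / r x ^ 3) (Ico u uΓ) x := by
    have hν0 := (hνneg x (hsub hx)).ne
    have hr0 := (hrpos x hx).ne'
    refine ((((hν x (hsub hx)).mono hsub).mul ((hP x (hsub hx)).mono hsub)).div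
      (((hr x (hsub hx)).mono hsub).pow 2) (pow_ne_zero 2 hr0)).congr_deriv ?_
    simp only [hKdef, Pi.mul_apply, Pi.pow_apply]
    field_simp
    ring
  have hud := uniqueDiffOn_Ico u uΓ
  have hval : iteratedDerivWithin 2 (fun y => (r y)⁻¹ * Φ y) (Ico u uΓ) x
      = ν' x * P x / r x ^ 2 + ν x ^ 2 * K x / r x ^ 3 := by
    rw [iteratedDerivWithin_succ, iteratedDerivWithin_one]
    exact (hA'.congr (fun y hy => (hA y hy).derivWithin (hud y hy))
      ((hA x hx).derivWithin (hud x hx))).derivWithin (hud x hx)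
  have hsubx : Icc x uΓ ⊆ Icc u uΓ := Icc_subset_Icc_left hx.1
  have hrnn : ∀ t ∈ Icc x uΓ, 0 ≤ r t := by
    intro t ht
    rcases ht.2.eq_or_lt with rfl | hlt
    · exact hrΓ.ge
    · exact (hrpos t ⟨hx.1.trans ht.1, hlt⟩).le
  have hνm : ∀ t ∈ Icc x uΓ, 1 ≤ -ν t / mν := by
    intro t ht
    rw [le_div_iff₀ hmpos, one_mul, ← abs_of_neg (hνneg t (hsubx ht))]
    exact hmν t ht
  have hxx : x ∈ Icc x uΓ := left_mem_Icc.2 hx.2.le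
  have hxpos := hrpos x hx
  have hΦΓ : Φ uΓ = 0 := intervalIntegral.integral_same
  have hPΓ : P uΓ = 0 := by simp [hPdef, hrΓ, hΦΓ]
  have hKΓ : K uΓ = 0 := by simp [hKdef, hrΓ, hPΓ]
  have hPx : |P x| ≤ Mg / (2 * mν) * r x ^ 2 := by
    refine abs_le_of_abs_hasDerivWithinAt_le_neg (S := fun y => Mg / (2 * mν) * r y ^ 2) hx.2.le
      (fun t ht => (hP t (hsubx ht)).mono hsubx)
      (fun t ht => (((hr t (hsubx ht)).mono hsubx).pow 2).const_mul _)
      hPΓ (by simp [hrΓ]) fun t ht => ?_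
    have hg0 : 0 ≤ Mg := (abs_nonneg _).trans (hMg t ht)
    rw [abs_neg, abs_mul, abs_of_nonneg (hrnn t ht)]
    calc |g t| * r t ≤ Mg * r t := mul_le_mul_of_nonneg_right (hMg t ht) (hrnn t ht)
      _ ≤ Mg * r t * (-ν t / mν) :=
        le_mul_of_one_le_right (mul_nonneg hg0 (hrnn t ht)) (hνm t ht)
      _ = _ := by push_cast; field_simp
  have hKx : |K x| ≤ Mh / (3 * mν) * r x ^ 3 := by
    refine abs_le_of_abs_hasDerivWithinAt_le_neg (S := fun y => Mh / (3 * mν) * r y ^ 3) hx.2.le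
      (fun t ht => (hK t (hsubx ht)).mono hsubx)
      (fun t ht => (((hr t (hsubx ht)).mono hsubx).pow 3).const_mul _)
      hKΓ (by simp [hrΓ]) fun t ht => ?_
    have hh0 : 0 ≤ Mh := (abs_nonneg _).trans (hMh t ht)
    rw [abs_neg, abs_mul, abs_of_nonneg (sq_nonneg (r t))]
    calc |h t| * r t ^ 2 ≤ Mh * r t ^ 2 := mul_le_mul_of_nonneg_right (hMh t ht) (sq_nonneg _)
      _ ≤ Mh * r t ^ 2 * (-ν t / mν) :=
        le_mul_of_one_le_right (mul_nonneg hh0 (sq_nonneg _)) (hνm t ht)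
      _ = _ := by push_cast; field_simp
  have hg0 : 0 ≤ Mg := (abs_nonneg _).trans (hMg x hxx)
  have hh0 : 0 ≤ Mh := (abs_nonneg _).trans (hMh x hxx)
  have hν'0 : 0 ≤ Mν' := (abs_nonneg _).trans (hMν' x hxx)
  have h1 : |ν' x * P x / r x ^ 2| ≤ Mν' / mν * Mg := by
    rw [abs_div, abs_mul, abs_of_pos (pow_pos hxpos 2), div_le_iff₀ (pow_pos hxpos 2)]
    calc |ν' x| * |P x| ≤ Mν' * (Mg / (2 * mν) * r x ^ 2) :=
          mul_le_mul (hMν' x hxx) hPx (abs_nonneg _) hν'0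
      _ = (Mν' / mν * Mg * r x ^ 2) / 2 := by field_simp
      _ ≤ _ := half_le_self (by positivity)
  have h2 : |ν x ^ 2 * K x / r x ^ 3| ≤ Mν ^ 2 / mν * Mh := by
    rw [abs_div, abs_mul, abs_of_pos (pow_pos hxpos 3), div_le_iff₀ (pow_pos hxpos 3), abs_pow]
    calc |ν x| ^ 2 * |K x| ≤ Mν ^ 2 * (Mh / (3 * mν) * r x ^ 3) :=
          mul_le_mul (pow_le_pow_left₀ (abs_nonneg _) (hMν x hxx) 2) hKx (abs_nonneg _)
            (sq_nonneg _)
      _ = (Mν ^ 2 / mν * Mh * r x ^ 3) / 3 := by field_simp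
      _ ≤ _ := div_le_self (by positivity) (by norm_num)
  rw [hval, one_mul]
  exact (abs_add_le _ _).trans (add_le_add h1 h2)
end

section
/- Scalar-field derivative bound near a regular center: In the averaging setup with r ∈ C²([u,u_Γ]), let h ∈ C²([u,u_Γ]) satisfy h(u_Γ) = 0 and define φ := h/r on [u,u_Γ). Then there is an absolute constant C such that for every x ∈ [u,u_Γ): |φ′(x)| ≤ C·[ (sup_{[x,u_Γ]}|ν| / inf_{[x,u_Γ]}|ν|³) · sup_{[x,u_Γ]}|ν′| · sup_{[x,u_Γ]}|h′| + (sup_{[x,u_Γ]}|ν| / inf_{[x,u_Γ]}|ν|²) · sup_{[x,u_Γ]}|h″| ]. -/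
open Set

/-- A function vanishing at the right endpoint of an interval, with derivative bounded by `M`, is
bounded by `M` times the distance to that endpoint. -/
lemma abs_le_mul_sub_of_hasDerivWithinAt {f f' : ℝ → ℝ} {a b M : ℝ}
    (hf : ∀ t ∈ Icc a b, HasDerivWithinAt f (f' t) (Icc a b) t) (hb : f b = 0)
    (hM : ∀ t ∈ Icc a b, |f' t| ≤ M) {t : ℝ} (ht : t ∈ Icc a b) : |f t| ≤ M * (b - t) := by
  have h := (convex_Icc a b).norm_image_sub_le_of_norm_hasDerivWithin_le hf hM
    (right_mem_Icc.2 (ht.1.trans ht.2)) ht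
  rwa [hb, sub_zero, Real.norm_eq_abs, Real.norm_eq_abs, abs_sub_comm,
    abs_of_nonneg (sub_nonneg.2 ht.2)] at h

/-- A function vanishing at the right endpoint of an interval, with derivative at most `-m`, is at
least `m` times the length of the interval at the left endpoint. -/
lemma mul_sub_le_of_hasDerivWithinAt {f f' : ℝ → ℝ} {a b m : ℝ} (hab : a < b)
    (hf : ∀ t ∈ Icc a b, HasDerivWithinAt f (f' t) (Icc a b) t) (hb : f b = 0)
    (hm : ∀ t ∈ Icc a b, f' t ≤ -m) : m * (b - a) ≤ f a := by
  obtain ⟨c, hc, hslope⟩ := exists_hasDerivAt_eq_slope f f' hab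
    (fun t ht => (hf t ht).continuousWithinAt)
    (fun t ht => (hf t (Ioo_subset_Icc_self ht)).hasDerivAt (Icc_mem_nhds ht.1 ht.2))
  have hle := hm c (Ioo_subset_Icc_self hc)
  rw [hslope, div_le_iff₀ (sub_pos.2 hab), hb] at hle
  linarith

/-- **Scalar-field derivative bound near a regular center** (Corollary 2.8).  In the
averaging setup with `r ∈ C²([u,u_Γ])`, if `h ∈ C²([u,u_Γ])` with `h(u_Γ) = 0` and
`φ := h/r` on `[u,u_Γ)`, then there is an absolute constant `C` such that for every
`x ∈ [u,u_Γ)`: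
`|φ′(x)| ≤ C·[ (sup|ν|/inf|ν|³)·sup|ν′|·sup|h′| + (sup|ν|/inf|ν|²)·sup|h″| ]`,
sup and inf over `[x,u_Γ]`, where `ν = r′`. -/
theorem scalar_field_derivative_bound_near_center :
    ∃ C : ℝ, 0 < C ∧
      ∀ (u uΓ : ℝ), u < uΓ →
      ∀ (r ν ν' h h' h'' : ℝ → ℝ),
        ContDiffOn ℝ 2 r (Icc u uΓ) →
        r uΓ = 0 →
        (∀ x ∈ Ico u uΓ, 0 < r x) →
        (∀ x ∈ Icc u uΓ, HasDerivWithinAt r (ν x) (Icc u uΓ) x) →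
        (∀ x ∈ Icc u uΓ, ν x < 0) →
        (∀ x ∈ Icc u uΓ, HasDerivWithinAt ν (ν' x) (Icc u uΓ) x) →
        ContDiffOn ℝ 2 h (Icc u uΓ) →
        h uΓ = 0 →
        (∀ x ∈ Icc u uΓ, HasDerivWithinAt h (h' x) (Icc u uΓ) x) →
        (∀ x ∈ Icc u uΓ, HasDerivWithinAt h' (h'' x) (Icc u uΓ) x) →
        ∀ x ∈ Ico u uΓ,
        ∀ Mν Mν' mν Mh' Mh'' : ℝ,
          (∀ t ∈ Icc x uΓ, |ν t| ≤ Mν) →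
          (∀ t ∈ Icc x uΓ, |ν' t| ≤ Mν') →
          (∀ t ∈ Icc x uΓ, mν ≤ |ν t|) → 0 < mν →
          (∀ t ∈ Icc x uΓ, |h' t| ≤ Mh') →
          (∀ t ∈ Icc x uΓ, |h'' t| ≤ Mh'') →
          |derivWithin (fun t => h t / r t) (Ico u uΓ) x|
            ≤ C * (Mν / mν ^ 3 * Mν' * Mh' + Mν / mν ^ 2 * Mh'') := by
  refine ⟨1, one_pos, ?_⟩
  intro u uΓ _ r ν ν' h h' h'' _ hr0 hrpos hr hν hν' _ hh0 hh hh' x hx Mν Mν' mν Mh' Mh''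
    hMν hMν' hmν hmpos hMh' hMh''
  have hsub : Icc x uΓ ⊆ Icc u uΓ := Icc_subset_Icc_left hx.1
  have hxx : x ∈ Icc x uΓ := left_mem_Icc.2 hx.2.le
  have hd : 0 < uΓ - x := sub_pos.2 hx.2
  have hMν0 : 0 ≤ Mν := (abs_nonneg _).trans (hMν x hxx)
  have hMν'0 : 0 ≤ Mν' := (abs_nonneg _).trans (hMν' x hxx)
  have hMh'0 : 0 ≤ Mh' := (abs_nonneg _).trans (hMh' x hxx)
  have hMh''0 : 0 ≤ Mh'' := (abs_nonneg _).trans (hMh'' x hxx)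
  have hmM : mν ≤ Mν := (hmν x hxx).trans (hMν x hxx)
  have hr' : ∀ t ∈ Icc x uΓ, HasDerivWithinAt r (ν t) (Icc x uΓ) t :=
    fun t ht => (hr t (hsub ht)).mono hsub
  have hhx : ∀ t ∈ Icc x uΓ, HasDerivWithinAt h (h' t) (Icc x uΓ) t :=
    fun t ht => (hh t (hsub ht)).mono hsub
  have hrlow : mν * (uΓ - x) ≤ r x := mul_sub_le_of_hasDerivWithinAt hx.2 hr' hr0 fun t ht => by
    have := hmν t ht
    rw [abs_of_neg (hν t (hsub ht))] at this
    linarith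
  have hnum : ∀ t ∈ Icc x uΓ, HasDerivWithinAt (fun s => h' s * r s - h s * ν s)
      (h'' t * r t - h t * ν' t) (Icc x uΓ) t := fun t ht => by
    have := (((hh' t (hsub ht)).mono hsub).mul (hr' t ht)).sub
      ((hhx t ht).mul ((hν' t (hsub ht)).mono hsub))
    exact this.congr_deriv (by ring)
  have hbound : ∀ t ∈ Icc x uΓ, |h'' t * r t - h t * ν' t| ≤
      (Mh'' * Mν + Mh' * Mν') * (uΓ - x) := fun t ht => by
    have h1 : |r t| ≤ Mν * (uΓ - x) :=
      (abs_le_mul_sub_of_hasDerivWithinAt hr' hr0 hMν ht).trans (by gcongr; exact ht.1)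
    have h2 : |h t| ≤ Mh' * (uΓ - x) :=
      (abs_le_mul_sub_of_hasDerivWithinAt hhx hh0 hMh' ht).trans (by gcongr; exact ht.1)
    calc |h'' t * r t - h t * ν' t| ≤ |h'' t| * |r t| + |h t| * |ν' t| := by
          rw [← abs_mul, ← abs_mul]
          exact abs_sub _ _
      _ ≤ Mh'' * (Mν * (uΓ - x)) + Mh' * (uΓ - x) * Mν' := by
          gcongr
          exacts [hMh'' t ht, hMν' t ht]
      _ = (Mh'' * Mν + Mh' * Mν') * (uΓ - x) := by ring
  have hN := abs_le_mul_sub_of_hasDerivWithinAt hnum (by simp [hr0, hh0]) hbound hxx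
  have hrx := hrpos x hx
  have hxu : x ∈ Icc u uΓ := Ico_subset_Icc_self hx
  have hquot := (((hh x hxu).div (hr x hxu) hrx.ne').mono Ico_subset_Icc_self).derivWithin
    (uniqueDiffOn_Ico u uΓ x hx)
  have hderiv : derivWithin (fun t => h t / r t) (Ico u uΓ) x =
      (h' x * r x - h x * ν x) / r x ^ 2 := hquot
  rw [hderiv, abs_div, abs_of_pos (pow_pos hrx 2), one_mul]
  calc |h' x * r x - h x * ν x| / r x ^ 2
      ≤ (Mh'' * Mν + Mh' * Mν') * (uΓ - x) * (uΓ - x) / (mν * (uΓ - x)) ^ 2 := by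
        gcongr
    _ = 1 / mν ^ 2 * Mν' * Mh' + Mν / mν ^ 2 * Mh'' := by
        field_simp
        ring
    _ ≤ Mν / mν ^ 3 * Mν' * Mh' + Mν / mν ^ 2 * Mh'' := by
        gcongr ?_ * _ * _ + _
        rw [div_le_div_iff₀ (by positivity) (by positivity)]
        nlinarith [mul_le_mul_of_nonneg_right hmM (sq_nonneg mν)]
end

section
/- Self-similar reduction (Proposition A.1): Let k ∈ ℝ and let r̊, Ω̊, φ̊ ∈ C²(I) on an interval I ⊆ ℝ∖{0} with Ω̊ > 0 and r̊ > 0. On D = {(û,v̂) : û < 0, −v̂/û ∈ I} define z = −v̂/û, r(û,v̂) = −û·r̊(z), Ω(û,v̂) = Ω̊(z), φ(û,v̂) = φ̊(z) − k·log(−û). If (r,Ω,φ) satisfies on D the double-null Einstein–scalar field equations r ∂_û∂_v̂ r = −∂_û r ∂_v̂ r − (1/4)Ω², r ∂_û∂_v̂ φ = −∂_û r ∂_v̂ φ − ∂_v̂ r ∂_û φ, 2Ω⁻¹ ∂_û r ∂_û Ω = ∂_û² r + r(∂_û φ)², and 2Ω⁻¹ ∂_v̂ r ∂_v̂ Ω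 = ∂_v̂² r + r(∂_v̂ φ)², then (r̊,Ω̊,φ̊) satisfies the k-self-similar ODE system on I. -/
noncomputable section

/-- partial derivative in the first (ingoing `û`) null coordinate -/
def pu (f : ℝ × ℝ → ℝ) (p : ℝ × ℝ) : ℝ := deriv (fun x => f (x, p.2)) p.1

/-- partial derivative in the second (outgoing `v̂`) null coordinate -/
def pv (f : ℝ × ℝ → ℝ) (p : ℝ × ℝ) : ℝ := deriv (fun y => f (p.1, y)) p.2

/-- the self-similar profile `ν̊ = −rP + z·rP′` -/
def ringNu (r : ℝ → ℝ) : ℝ → ℝ := fun z => -r z + z * deriv r z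

/-- The `k`-self-similar ODE system for profiles `rP, ΩP, φP` of `z` on `I`, with
`λ̊ := rP′` and `ν̊ := −rP + z·rP′` (so `ν̊ + rP = zλ̊`). -/
def kSSODE (k : ℝ) (I : Set ℝ) (r Ω φ : ℝ → ℝ) : Prop :=
  ∀ z ∈ I,
    r z * z * deriv (deriv r) z = -(ringNu r z) * deriv r z - 1/4 * Ω z ^ 2 ∧
    r z * deriv (ringNu r) z = -(ringNu r z) * deriv r z - 1/4 * Ω z ^ 2 ∧
    2 * (Ω z)⁻¹ * ringNu r z * z * deriv Ω z
      = z * deriv (ringNu r) z + r z * (z * deriv φ z + k) ^ 2 ∧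
    2 * (Ω z)⁻¹ * deriv r z * deriv Ω z = deriv (deriv r) z + r z * (deriv φ z) ^ 2 ∧
    r z * z * deriv (deriv φ) z = -2 * deriv r z * z * deriv φ z - k * deriv r z

theorem ContDiffOn.hasDerivAt_deriv_of_isOpen {f : ℝ → ℝ} {I : Set ℝ} (hI : IsOpen I)
    (hf : ContDiffOn ℝ 2 f I) {z : ℝ} (hz : z ∈ I) : HasDerivAt f (deriv f z) z :=
  ((hf.differentiableOn (by norm_num)).differentiableAt (hI.mem_nhds hz)).hasDerivAt

theorem ContDiffOn.hasDerivAt_deriv_deriv_of_isOpen {f : ℝ → ℝ} {I : Set ℝ} (hI : IsOpen I)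
    (hf : ContDiffOn ℝ 2 f I) {z : ℝ} (hz : z ∈ I) :
    HasDerivAt (deriv f) (deriv (deriv f) z) z :=
  (((hf.deriv_of_isOpen (m := 1) hI (by norm_num)).differentiableOn
    (by norm_num)).differentiableAt (hI.mem_nhds hz)).hasDerivAt

theorem hasDerivAt_neg_div_fst (v : ℝ) {u : ℝ} (hu : u ≠ 0) :
    HasDerivAt (fun x => -v / x) (v / u ^ 2) u := by
  simpa using (hasDerivAt_const u (-v)).fun_div (hasDerivAt_id' u) hu

theorem hasDerivAt_neg_div_snd (u v : ℝ) : HasDerivAt (fun y => -y / u) (-1 / u) v := by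
  simpa using (hasDerivAt_id' v).neg.div_const u

theorem pu_comp_neg_div {f : ℝ → ℝ} {f' u v : ℝ} (hu : u ≠ 0)
    (hf : HasDerivAt f f' (-v / u)) :
    pu (fun p => f (-p.2 / p.1)) (u, v) = f' * (v / u ^ 2) :=
  (hf.comp u (hasDerivAt_neg_div_fst v hu)).deriv

theorem pv_comp_neg_div {f : ℝ → ℝ} {f' u v : ℝ} (hf : HasDerivAt f f' (-v / u)) :
    pv (fun p => f (-p.2 / p.1)) (u, v) = f' * (-1 / u) :=
  (hf.comp v (hasDerivAt_neg_div_snd u v)).deriv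

theorem pu_congr_of_eventuallyEq {f g : ℝ × ℝ → ℝ} {p : ℝ × ℝ}
    (h : f =ᶠ[nhds p] g) : pu f p = pu g p :=
  Filter.EventuallyEq.deriv_eq
    ((Continuous.prodMk_left p.2).continuousAt.tendsto.eventually h)

theorem pv_congr_of_eventuallyEq {f g : ℝ × ℝ → ℝ} {p : ℝ × ℝ}
    (h : f =ᶠ[nhds p] g) : pv f p = pv g p :=
  Filter.EventuallyEq.deriv_eq
    ((Continuous.prodMk_right p.1).continuousAt.tendsto.eventually h)

theorem eventually_neg_and_neg_div_mem {I : Set ℝ} (hI : IsOpen I) {p : ℝ × ℝ}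
    (hp : p.1 < 0) (hz : -p.2 / p.1 ∈ I) :
    ∀ᶠ q : ℝ × ℝ in nhds p, q.1 < 0 ∧ -q.2 / q.1 ∈ I := by
  have hc : ContinuousAt (fun q : ℝ × ℝ => -q.2 / q.1) p :=
    continuousAt_snd.neg.div continuousAt_fst hp.ne
  exact (continuousAt_fst.eventually_lt_const hp).and (hc.eventually (hI.mem_nhds hz))

theorem pu_radius {r : ℝ → ℝ} {r' u v : ℝ} (hu : u ≠ 0) (hr : HasDerivAt r r' (-v / u)) :
    pu (fun p => -p.1 * r (-p.2 / p.1)) (u, v) = -r (-v / u) + -v / u * r' := by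
  have h := (hasDerivAt_id' u).fun_neg.fun_mul (hr.comp u (hasDerivAt_neg_div_fst v hu))
  refine h.deriv.trans ?_
  simp only [Function.comp_apply]
  field_simp

theorem pv_radius {r : ℝ → ℝ} {r' u v : ℝ} (hu : u ≠ 0) (hr : HasDerivAt r r' (-v / u)) :
    pv (fun p => -p.1 * r (-p.2 / p.1)) (u, v) = r' := by
  have h := (hr.comp v (hasDerivAt_neg_div_snd u v)).const_mul (-u)
  refine h.deriv.trans ?_
  field_simp

theorem pu_scalar {φ : ℝ → ℝ} {φ' u v : ℝ} (k : ℝ) (hu : u ≠ 0)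
    (hφ : HasDerivAt φ φ' (-v / u)) :
    pu (fun p => φ (-p.2 / p.1) - k * Real.log (-p.1)) (u, v) = φ' * (v / u ^ 2) - k / u := by
  have h := (hφ.comp u (hasDerivAt_neg_div_fst v hu)).sub
    (((hasDerivAt_id' u).fun_neg.log (neg_ne_zero.mpr hu)).const_mul k)
  refine h.deriv.trans ?_
  field_simp

theorem pv_scalar {φ : ℝ → ℝ} {φ' u v : ℝ} (k : ℝ) (hφ : HasDerivAt φ φ' (-v / u)) :
    pv (fun p => φ (-p.2 / p.1) - k * Real.log (-p.1)) (u, v) = φ' * (-1 / u) :=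
  ((hφ.comp v (hasDerivAt_neg_div_snd u v)).sub_const (k * Real.log (-u))).deriv

/-- **Self-similar reduction** (Proposition A.1).  Let `k ∈ ℝ` and `rP, ΩP, φP ∈ C²(I)` on
an open interval `I ⊆ ℝ∖{0}` with `ΩP > 0` and `rP > 0`.  On
`D = {(û,v̂) : û < 0, −v̂/û ∈ I}` define `z = −v̂/û`, `r = −û·rP(z)`, `Ω = ΩP(z)`,
`φ = φP(z) − k·log(−û)`.  If `(r,Ω,φ)` satisfies the double-null Einstein–scalar field
equations on `D`, then `(rP,ΩP,φP)` satisfies the `k`-self-similar ODE system on `I`. -/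
theorem self_similar_reduction
    (k : ℝ) (I : Set ℝ) (hIopen : IsOpen I) (hIconn : I.OrdConnected) (hI0 : (0:ℝ) ∉ I)
    (rP ΩP φP : ℝ → ℝ)
    (hr : ContDiffOn ℝ 2 rP I) (hΩ : ContDiffOn ℝ 2 ΩP I) (hφ : ContDiffOn ℝ 2 φP I)
    (hΩpos : ∀ z ∈ I, 0 < ΩP z) (hrpos : ∀ z ∈ I, 0 < rP z)
    (D : Set (ℝ × ℝ)) (hD : D = {p : ℝ × ℝ | p.1 < 0 ∧ -p.2 / p.1 ∈ I})
    (R Om Φ : ℝ × ℝ → ℝ)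
    (hR : R = fun p => -p.1 * rP (-p.2 / p.1))
    (hOm : Om = fun p => ΩP (-p.2 / p.1))
    (hΦ : Φ = fun p => φP (-p.2 / p.1) - k * Real.log (-p.1))
    (eq1 : ∀ p ∈ D, R p * pu (pv R) p = -(pu R p) * pv R p - 1/4 * Om p ^ 2)
    (eq2 : ∀ p ∈ D, R p * pu (pv Φ) p = -(pu R p) * pv Φ p - pv R p * pu Φ p)
    (eq3 : ∀ p ∈ D, 2 * (Om p)⁻¹ * pu R p * pu Om p = pu (pu R) p + R p * (pu Φ p) ^ 2)
    (eq4 : ∀ p ∈ D, 2 * (Om p)⁻¹ * pv R p * pv Om p = pv (pv R) p + R p * (pv Φ p) ^ 2) :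
    kSSODE k I rP ΩP φP := by
  intro z hz
  have hR1 {x : ℝ} (hx : x ∈ I) := hr.hasDerivAt_deriv_of_isOpen hIopen hx
  have hφ1 {x : ℝ} (hx : x ∈ I) := hφ.hasDerivAt_deriv_of_isOpen hIopen hx
  have hR2 := hr.hasDerivAt_deriv_deriv_of_isOpen hIopen hz
  have hφ2 := hφ.hasDerivAt_deriv_deriv_of_isOpen hIopen hz
  have hν : HasDerivAt (ringNu rP) (z * deriv (deriv rP) z) z := by
    have h := (hR1 hz).fun_neg.fun_add ((hasDerivAt_id' z).fun_mul hR2)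
    exact h.congr_deriv (by ring)
  have hzq : -z / (-1) = z := by ring
  have hp : ((-1, z) : ℝ × ℝ) ∈ D := by
    rw [hD]; exact ⟨by norm_num, by simpa only [hzq] using hz⟩
  have hev := eventually_neg_and_neg_div_mem hIopen (p := (-1, z)) (by norm_num)
    (by simpa only [hzq] using hz)
  have hpuR : pu R =ᶠ[nhds (-1, z)] fun p => ringNu rP (-p.2 / p.1) := by
    filter_upwards [hev] with p hp
    rw [hR]; exact pu_radius hp.1.ne (hR1 hp.2)
  have hpvR : pv R =ᶠ[nhds (-1, z)] fun p => deriv rP (-p.2 / p.1) := by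
    filter_upwards [hev] with p hp
    rw [hR]; exact pv_radius hp.1.ne (hR1 hp.2)
  have hpvΦ : pv Φ =ᶠ[nhds (-1, z)] fun p => deriv φP (-p.2 / p.1) * (-1 / p.1) := by
    filter_upwards [hev] with p hp
    rw [hΦ]; exact pv_scalar k (hφ1 hp.2)
  have hm : (-1 : ℝ) ≠ 0 := by norm_num
  have hOm1 := hΩ.hasDerivAt_deriv_of_isOpen hIopen hz
  have hφz := hφ1 hz
  have hpuvR := pu_congr_of_eventuallyEq hpvR
  have hpuuR := pu_congr_of_eventuallyEq hpuR
  have hpvvR := pv_congr_of_eventuallyEq hpvR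
  have hpuvΦ := pu_congr_of_eventuallyEq hpvΦ
  rw [← hzq] at hR2 hφ2 hν hOm1 hφz
  rw [pu_comp_neg_div hm hR2] at hpuvR
  rw [pu_comp_neg_div hm hν] at hpuuR
  rw [pv_comp_neg_div hR2] at hpvvR
  have hpuvΦ' : pu (fun p => deriv φP (-p.2 / p.1) * (-1 / p.1)) (-1, z)
      = z * deriv (deriv φP) z + deriv φP z := by
    have h := (hφ2.comp (-1) (hasDerivAt_neg_div_fst z hm)).fun_mul
      (hasDerivAt_neg_div_fst 1 hm)
    refine h.deriv.trans ?_
    simp only [Function.comp_apply, hzq]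
    ring
  have hpuΦ := pu_scalar k hm hφz
  have hpuOm := pu_comp_neg_div hm hOm1
  have hpvOm := pv_comp_neg_div hOm1
  rw [← hΦ] at hpuΦ
  rw [← hOm] at hpuOm hpvOm
  have hRz : R (-1, z) = rP z := by simp [hR]
  have hOmz : Om (-1, z) = ΩP z := by simp [hOm]
  have e1 := eq1 _ hp
  have e2 := eq2 _ hp
  have e3 := eq3 _ hp
  have e4 := eq4 _ hp
  simp only [hpuvR, hpuuR, hpvvR, hpuvΦ, hpuvΦ', hpuΦ, hpuOm, hpvOm, hRz, hOmz,
    hpuR.eq_of_nhds, hpvR.eq_of_nhds, hpvΦ.eq_of_nhds, hzq] at e1 e2 e3 e4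
  rw [hzq] at hν
  rw [hν.deriv]
  refine ⟨by linear_combination e1, by linear_combination e1, by linear_combination e3,
    by linear_combination e4, ?_⟩
  simp only [ringNu] at e2
  linear_combination e2

end
end

section
/- Algebraic identity for the self-similar lapse: Let k ∈ ℝ and suppose r̊, Ω̊, φ̊ ∈ C²(I) satisfy the k-self-similar ODE system on an interval I ⊆ ℝ∖{0}, with r̊ ≠ 0, λ̊ ≠ 0 and Ω̊ ≠ 0 on I. Then the identity (1/4)Ω̊² = −ν̊λ̊ + r̊² z (φ̊′)² + 2k z λ̊ r̊ φ̊′ + r̊ λ̊ k² holds on I. -/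
noncomputable section

/-- **Algebraic identity for the self-similar lapse** (Lemma A.2, identity (A.22)).
If `rP, ΩP, φP ∈ C²(I)` satisfy the `k`-self-similar ODE system on an open interval
`I ⊆ ℝ∖{0}` with `rP ≠ 0`, `λ̊ = rP′ ≠ 0` and `ΩP ≠ 0` on `I`, then
`(1/4)ΩP² = −ν̊λ̊ + rP²z(φP′)² + 2kzλ̊rPφP′ + rPλ̊k²` on `I`. -/
theorem lapse_algebraic_identity
    (k : ℝ) (I : Set ℝ) (hIopen : IsOpen I) (hIconn : I.OrdConnected) (hI0 : (0:ℝ) ∉ I)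
    (rP ΩP φP : ℝ → ℝ)
    (hr : ContDiffOn ℝ 2 rP I) (hΩ : ContDiffOn ℝ 2 ΩP I) (hφ : ContDiffOn ℝ 2 φP I)
    (hsys : kSSODE k I rP ΩP φP)
    (hr0 : ∀ z ∈ I, rP z ≠ 0) (hlam0 : ∀ z ∈ I, deriv rP z ≠ 0)
    (hΩ0 : ∀ z ∈ I, ΩP z ≠ 0) :
    ∀ z ∈ I, 1/4 * ΩP z ^ 2 =
      -(ringNu rP z) * deriv rP z + rP z ^ 2 * z * (deriv φP z) ^ 2
        + 2 * k * z * deriv rP z * rP z * deriv φP z + rP z * deriv rP z * k ^ 2 := by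
  intro z hz
  obtain ⟨h₁, h₂, h₃, h₄, -⟩ := hsys z hz
  have hν' : deriv (ringNu rP) z = z * deriv (deriv rP) z :=
    mul_left_cancel₀ (hr0 z hz) (by linear_combination h₂ - h₁)
  have hν : ringNu rP z = -rP z + z * deriv rP z := rfl
  rw [hν] at h₂ h₃ ⊢
  linear_combination deriv rP z * h₃ - (-rP z + z * deriv rP z) * z * h₄
    + (-rP z + z * deriv rP z) * hν' + h₂

end
end

section
/- Reduction to the autonomous phase-plane system: Suppose r̊, Ω̊, φ̊ ∈ C²(I) solve the k-self-similar ODE system on an interval I ⊆ ℝ∖{0} with r̊ ≠ 0, r̊ + ν̊ ≠ 0, λ̊ ≠ 0 and Ω̊ ≠ 0 on I. Define ψ := r̊/(r̊ + ν̊) and θ := zψφ̊′. Then on I: z·ψ′ = (θ+k)² + (1−k²)(1−ψ) and zψ·θ′ = kψ(kθ−1) + θ·((θ+k)² − (1+k²)); in particular, under any reparametrization s(z) with ds/dz = 1/(zψ), the pair (ψ,θ) solves the Christodoulou phase-plane system with parameter k. -/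
noncomputable section

/-- A `C²` function on an open set has a differentiable derivative there. -/
theorem ContDiffOn.hasDerivAt_and_deriv {f : ℝ → ℝ} {I : Set ℝ} (hf : ContDiffOn ℝ 2 f I)
    (hI : IsOpen I) {z : ℝ} (hz : z ∈ I) :
    HasDerivAt f (deriv f z) z ∧ HasDerivAt (deriv f) (deriv (deriv f) z) z := by
  have hnhds : I ∈ nhds z := hI.mem_nhds hz
  have hd : ContDiffOn ℝ 1 (deriv f) I := hf.deriv_of_isOpen hI (by norm_num)
  exact ⟨((hf.differentiableOn (by norm_num)).differentiableAt hnhds).hasDerivAt,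
    ((hd.differentiableOn (by norm_num)).differentiableAt hnhds).hasDerivAt⟩

theorem ringNu_hasDerivAt {r : ℝ → ℝ} {z : ℝ} (h₁ : HasDerivAt r (deriv r z) z)
    (h₂ : HasDerivAt (deriv r) (deriv (deriv r) z) z) :
    HasDerivAt (ringNu r) (z * deriv (deriv r) z) z :=
  (h₁.neg.add ((hasDerivAt_id' z).mul h₂)).congr_deriv (by ring)

/-- Eliminating `Ω̊` from the two transport equations for `Ω̊` gives a second-order equation for
`r̊` in terms of `φ̊′`. -/
theorem kSSODE.deriv_deriv_eq {k : ℝ} {I : Set ℝ} {r Ω φ : ℝ → ℝ} (h : kSSODE k I r Ω φ)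
    (hI : IsOpen I) (hr : ContDiffOn ℝ 2 r I) {z : ℝ} (hz : z ∈ I) (hr0 : r z ≠ 0) :
    z * deriv (deriv r) z
      = -deriv r z * (2 * k * z * deriv φ z + k ^ 2) - r z * z * deriv φ z ^ 2 := by
  obtain ⟨-, -, h₃, h₄, -⟩ := h z hz
  obtain ⟨hd₁, hd₂⟩ := hr.hasDerivAt_and_deriv hI hz
  rw [(ringNu_hasDerivAt hd₁ hd₂).deriv] at h₃
  simp only [ringNu] at h₃
  apply mul_left_cancel₀ hr0
  linear_combination (-deriv r z) * h₃ + (-r z + z * deriv r z) * z * h₄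

/-- The phase-plane variables `ψ` and `θ` are differentiable, with the derivatives prescribed by
the phase-plane system. -/
theorem kSSODE.hasDerivAt_phase {k : ℝ} {I : Set ℝ} {r Ω φ : ℝ → ℝ} (h : kSSODE k I r Ω φ)
    (hI : IsOpen I) (hr : ContDiffOn ℝ 2 r I) (hφ : ContDiffOn ℝ 2 φ I) {z : ℝ} (hz : z ∈ I)
    (hz0 : z ≠ 0) (hr0 : r z ≠ 0) (hlam : deriv r z ≠ 0) {ψ θ : ℝ → ℝ}
    (hψ : ψ = fun z => r z / (r z + ringNu r z)) (hθ : θ = fun z => z * ψ z * deriv φ z) :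
    ψ z ≠ 0 ∧
    HasDerivAt ψ (((θ z + k) ^ 2 + (1 - k ^ 2) * (1 - ψ z)) / z) z ∧
    HasDerivAt θ ((k * ψ z * (k * θ z - 1) + θ z * ((θ z + k) ^ 2 - (1 + k ^ 2)))
      / (z * ψ z)) z := by
  obtain ⟨hd₁, hd₂⟩ := hr.hasDerivAt_and_deriv hI hz
  obtain ⟨-, hf₂⟩ := hφ.hasDerivAt_and_deriv hI hz
  have hq := h.deriv_deriv_eq hI hr hz hr0
  obtain ⟨-, -, -, -, h₅⟩ := h z hz
  have hden : r z + ringNu r z = z * deriv r z := by simp [ringNu]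
  have hψz : ψ z = r z / (z * deriv r z) := by rw [hψ]; simp only [hden]
  have hθz : θ z = r z * deriv φ z / deriv r z := by
    rw [hθ]; simp only [hψz]; field_simp
  have hψ0 : ψ z ≠ 0 := by rw [hψz]; positivity
  have hψ' : HasDerivAt ψ (((θ z + k) ^ 2 + (1 - k ^ 2) * (1 - ψ z)) / z) z := by
    have hdiv := hd₁.div (hd₁.add (ringNu_hasDerivAt hd₁ hd₂))
      (by simp only [Pi.add_apply, hden]; positivity)
    rw [hψ]
    refine HasDerivAt.congr_deriv hdiv ?_
    rw [← hψ, hθz, hψz]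
    simp only [Pi.add_apply, hden, hq]
    field_simp
    ring
  refine ⟨hψ0, hψ', ?_⟩
  have hmul := ((hasDerivAt_id' z).mul hψ').mul hf₂
  have hf : deriv (deriv φ) z = (-2 * deriv r z * z * deriv φ z - k * deriv r z) / (r z * z) := by
    rw [eq_div_iff (by positivity)]
    linear_combination h₅
  nth_rewrite 1 [hθ]
  refine HasDerivAt.congr_deriv hmul ?_
  simp only [Pi.mul_apply]
  rw [hθz, hψz, hf]
  field_simp
  ring

/-- **Reduction to the autonomous phase-plane system** (Section A.2).  If
`rP, ΩP, φP ∈ C²(I)` solve the `k`-self-similar ODE system on an open interval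
`I ⊆ ℝ∖{0}` with `rP ≠ 0`, `rP + ν̊ ≠ 0`, `λ̊ ≠ 0`, `ΩP ≠ 0`, and
`ψ := rP/(rP+ν̊)`, `θ := zψφP′`, then on `I`:
`z·ψ′ = (θ+k)² + (1−k²)(1−ψ)` and `zψ·θ′ = kψ(kθ−1) + θ((θ+k)² − (1+k²))`;
in particular, under any reparametrization `s(z)` with `ds/dz = 1/(zψ)` (that is, with
inverse satisfying `dz/ds = zψ`), the pair `(ψ,θ)` solves the Christodoulou phase-plane
system with parameter `k`. -/
theorem phase_plane_reduction
    (k : ℝ) (I : Set ℝ) (hIopen : IsOpen I) (hIconn : I.OrdConnected) (hI0 : (0:ℝ) ∉ I)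
    (rP ΩP φP : ℝ → ℝ)
    (hr : ContDiffOn ℝ 2 rP I) (hΩ : ContDiffOn ℝ 2 ΩP I) (hφ : ContDiffOn ℝ 2 φP I)
    (hsys : kSSODE k I rP ΩP φP)
    (hr0 : ∀ z ∈ I, rP z ≠ 0) (hrν : ∀ z ∈ I, rP z + ringNu rP z ≠ 0)
    (hlam0 : ∀ z ∈ I, deriv rP z ≠ 0) (hΩ0 : ∀ z ∈ I, ΩP z ≠ 0)
    (ψ θ : ℝ → ℝ)
    (hψ : ψ = fun z => rP z / (rP z + ringNu rP z))
    (hθ : θ = fun z => z * ψ z * deriv φP z) :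
    (∀ z ∈ I,
      z * deriv ψ z = (θ z + k) ^ 2 + (1 - k ^ 2) * (1 - ψ z) ∧
      z * ψ z * deriv θ z =
        k * ψ z * (k * θ z - 1) + θ z * ((θ z + k) ^ 2 - (1 + k ^ 2))) ∧
    ∀ (J : Set ℝ) (zOf : ℝ → ℝ),
      (∀ s ∈ J, zOf s ∈ I) →
      (∀ s ∈ J, HasDerivAt zOf (zOf s * ψ (zOf s)) s) →
      ∀ s ∈ J,
        HasDerivAt (fun t => ψ (zOf t))
          (ψ (zOf s) * ((θ (zOf s) + k) ^ 2 + (1 - k ^ 2) * (1 - ψ (zOf s)))) s ∧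
        HasDerivAt (fun t => θ (zOf t))
          (k * ψ (zOf s) * (k * θ (zOf s) - 1)
            + θ (zOf s) * ((θ (zOf s) + k) ^ 2 - (1 + k ^ 2))) s := by
  have key := fun z hz => hsys.hasDerivAt_phase hIopen hr hφ hz (fun h => hI0 (h ▸ hz))
    (hr0 z hz) (hlam0 z hz) hψ hθ
  have hz0 : ∀ z ∈ I, z ≠ 0 := fun z hz h => hI0 (h ▸ hz)
  refine ⟨fun z hz => ?_, fun J zOf hJ hzOf s hs => ?_⟩
  · obtain ⟨hψ0, hψ', hθ'⟩ := key z hz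
    rw [hψ'.deriv, hθ'.deriv]
    exact ⟨mul_div_cancel₀ _ (hz0 z hz), mul_div_cancel₀ _ (mul_ne_zero (hz0 z hz) hψ0)⟩
  · obtain ⟨hψ0, hψ', hθ'⟩ := key _ (hJ s hs)
    have h0 := hz0 _ (hJ s hs)
    refine ⟨(hψ'.comp s (hzOf s hs)).congr_deriv ?_, (hθ'.comp s (hzOf s hs)).congr_deriv ?_⟩
    · field_simp
    · field_simp

end
end

section
/- Interior phase-plane solution (Proposition A.3): Let k > 0 with k² ∈ (0,1/3). There exist s* ∈ ℝ and a solution (ψ,θ) : (−∞,s*) → ℝ² of the Christodoulou phase-plane system such that: (1) ψ(s) < 0 and θ(s) > 0 on (−∞,s*); (2) ψ(s) → −∞ and θ(s) → 1/k as s → s*⁻; (3) ψ and θ are smooth and bounded on (−∞,s₀] for every s₀ < s*; (4) as s → −∞, ψ(s) = −e^s + O(e^{2s}) and θ(s) = (k/2)e^s + O(e^{2s}); (5) there exist a constant c(k) and a nonzero constant a₁ such that, as s → s*⁻, 1/ψ(s) = (1−k²)(s−s*) + O((s−s*)²) and θ(s) = 1/k + c(k)/ψ(s) + a₁·(−(1−k²)(s−s*))^{k²/(1−k²)}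 + O((s−s*)^{2k²/(1−k²)}). Moreover the solution is unique: any solution of the system with (ψ,θ)(s) → (0,0) and ψ(s)e^{−s} → −1 as s → −∞ coincides with it on the common domain. -/
open Filter Topology Asymptotics

/-- Christodoulou phase-plane system with parameter `k`:
`dψ/ds = ψ((θ+k)² + (1−k²)(1−ψ))`, `dθ/ds = kψ(kθ−1) + θ((θ+k)² − (1+k²))`. -/
def phasePlane (k : ℝ) (S : Set ℝ) (ψ θ : ℝ → ℝ) : Prop :=
  ∀ s ∈ S,
    HasDerivAt ψ (ψ s * ((θ s + k) ^ 2 + (1 - k ^ 2) * (1 - ψ s))) s ∧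
    HasDerivAt θ (k * ψ s * (k * θ s - 1) + θ s * ((θ s + k) ^ 2 - (1 + k ^ 2))) s

section Calculus

variable {f f' g : ℝ → ℝ} {D : Set ℝ} {a b : ℝ}

lemma monotoneOn_of_forall_hasDerivAt_nonneg (hD : Convex ℝ D)
    (hd : ∀ s ∈ D, HasDerivAt f (f' s) s) (h : ∀ s ∈ D, 0 ≤ f' s) : MonotoneOn f D :=
  monotoneOn_of_hasDerivWithinAt_nonneg hD
    (fun s hs => (hd s hs).continuousAt.continuousWithinAt)
    (fun s hs => (hd s (interior_subset hs)).hasDerivWithinAt)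
    (fun s hs => h s (interior_subset hs))

lemma antitoneOn_of_forall_hasDerivAt_nonpos (hD : Convex ℝ D)
    (hd : ∀ s ∈ D, HasDerivAt f (f' s) s) (h : ∀ s ∈ D, f' s ≤ 0) : AntitoneOn f D :=
  antitoneOn_of_hasDerivWithinAt_nonpos hD
    (fun s hs => (hd s hs).continuousAt.continuousWithinAt)
    (fun s hs => (hd s (interior_subset hs)).hasDerivWithinAt)
    (fun s hs => h s (interior_subset hs))

lemma AntitoneOn.nonpos_of_tendsto_atBot (hf : AntitoneOn f (Set.Iio b))
    (h0 : Tendsto f atBot (𝓝 0)) {s : ℝ} (hs : s < b) : f s ≤ 0 := by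
  refine ge_of_tendsto h0 ?_
  filter_upwards [eventually_le_atBot s] with t ht
  exact hf (lt_of_le_of_lt ht hs) hs ht

lemma MonotoneOn.nonpos_of_tendsto_nhdsLT (hf : MonotoneOn f (Set.Ioo a b))
    (h0 : Tendsto f (𝓝[<] b) (𝓝 0)) {s : ℝ} (hs : s ∈ Set.Ioo a b) : f s ≤ 0 := by
  refine ge_of_tendsto h0 ?_
  filter_upwards [Ioo_mem_nhdsLT hs.2] with t ht
  exact hf hs ⟨hs.1.trans ht.1, ht.2⟩ ht.1.le

lemma AntitoneOn.nonneg_of_tendsto_nhdsLT (hf : AntitoneOn f (Set.Ioo a b))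
    (h0 : Tendsto f (𝓝[<] b) (𝓝 0)) {s : ℝ} (hs : s ∈ Set.Ioo a b) : 0 ≤ f s := by
  refine le_of_tendsto h0 ?_
  filter_upwards [Ioo_mem_nhdsLT hs.2] with t ht
  exact hf hs ⟨hs.1.trans ht.1, ht.2⟩ ht.1.le

lemma HasDerivAt.exists_lt_left {d s : ℝ} (hd : HasDerivAt f d s) (hpos : 0 < d) (ha : a < s) :
    ∃ t, a < t ∧ t < s ∧ f t < f s := by
  have h1 : ∀ᶠ t in 𝓝[<] s, 0 < slope f s t :=
    (hd.tendsto_slope.mono_left (nhdsWithin_mono _ fun t ht => ne_of_lt ht)).eventually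
      (lt_mem_nhds hpos)
  obtain ⟨t, h2, h3⟩ := (h1.and (Ioo_mem_nhdsLT ha)).exists
  refine ⟨t, h3.1, h3.2, ?_⟩
  rw [slope_def_field] at h2
  have h4 : t - s < 0 := sub_neg.2 h3.2
  by_contra! h5
  exact absurd h2 (not_lt.2 (div_nonpos_of_nonneg_of_nonpos (sub_nonneg.2 h5) h4.le))

/-- A function that vanishes at `-∞` and increases strictly wherever it is nonpositive near `-∞`,
or zero anywhere, is positive. -/
lemma pos_of_barrier (hd : ∀ s < b, HasDerivAt f (f' s) s) (h0 : Tendsto f atBot (𝓝 0))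
    (hneg : ∀ᶠ s in atBot, f s ≤ 0 → 0 < f' s) (hz : ∀ s < b, f s = 0 → 0 < f' s) :
    ∀ s < b, 0 < f s := by
  obtain ⟨c, hc⟩ := eventually_atBot.1 hneg
  have near : ∀ s, s ≤ c → s < b → 0 < f s := by
    intro s hsc hsb
    by_contra! hs
    obtain ⟨r, -, hrs, hr⟩ := (hd s hsb).exists_lt_left (hc s hsc hs) (sub_one_lt s)
    have hr0 : f r < 0 := hr.trans_le hs
    obtain ⟨q, hq⟩ := eventually_atBot.1 (h0.eventually (lt_mem_nhds hr0))
    set q' := min q (r - 1)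
    have hq'r : q' < r := lt_of_le_of_lt (min_le_right _ _) (sub_one_lt r)
    have hcont : ContinuousOn f (Set.Icc q' r) := fun t ht =>
      (hd t (ht.2.trans_lt (hrs.trans hsb))).continuousAt.continuousWithinAt
    obtain ⟨m, hm, hmin⟩ := isCompact_Icc.exists_isMinOn ⟨r, hq'r.le, le_rfl⟩ hcont
    have hmr : f m ≤ f r := hmin (Set.right_mem_Icc.2 hq'r.le)
    have hqm : q' < m := by
      rcases hm.1.eq_or_lt with h | h
      · have := hq q' (min_le_left _ _)
        rw [h] at this
        exact absurd this (not_lt.2 hmr)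
      · exact h
    have hmb : m < b := hm.2.trans_lt (hrs.trans hsb)
    obtain ⟨t, ht1, ht2, ht3⟩ := (hd m hmb).exists_lt_left
      (hc m (hm.2.trans (hrs.le.trans hsc)) (hmr.trans hr0.le)) hqm
    exact absurd (hmin ⟨ht1.le, ht2.le.trans hm.2⟩) (not_le.2 ht3)
  intro s hs
  set q := min c (s - 1)
  have hqs : q < s := lt_of_le_of_lt (min_le_right _ _) (sub_one_lt s)
  have hnn : ∀ t ∈ Set.Icc q s, 0 ≤ f t := by
    intro t ht
    refine image_le_of_deriv_right_lt_deriv_boundary' (f := fun _ => 0) (f' := fun _ => 0)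
      (a := q) (b := s) (B := f) (B' := f') continuousOn_const
      (fun x _ => hasDerivWithinAt_const _ _ _)
      (near q (min_le_left _ _) (hqs.trans hs)).le
      (fun x hx => (hd x (hx.2.trans_lt hs)).continuousAt.continuousWithinAt)
      (fun x hx => (hd x (hx.2.trans hs)).hasDerivWithinAt)
      (fun x hx h => hz x (hx.2.trans hs) h.symm) ht
  rcases (hnn s ⟨hqs.le, le_rfl⟩).eq_or_lt with h | h
  · obtain ⟨t, ht1, ht2, ht3⟩ := (hd s hs).exists_lt_left (hz s hs h.symm) hqs
    exact absurd (hnn t ⟨ht1.le, ht2.le⟩) (not_le.2 (h ▸ ht3))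
  · exact h

lemma exists_antideriv_Iio (hg : ContinuousOn g (Set.Iio b)) :
    ∃ G : ℝ → ℝ, ∀ s < b, HasDerivAt G (g s) s := by
  refine ⟨fun s => ∫ t in (b - 1)..s, g t, fun s hs => ?_⟩
  have hsub : Set.uIcc (b - 1) s ⊆ Set.Iio b := by
    intro t ht
    exact lt_of_le_of_lt ht.2 (max_lt (sub_one_lt b) hs)
  exact intervalIntegral.integral_hasDerivAt_right (hg.mono hsub).intervalIntegrable
    (hg.stronglyMeasurableAtFilter isOpen_Iio s hs) (hg.continuousAt (Iio_mem_nhds hs))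

lemma neg_of_hasDerivAt_mul_self (hd : ∀ s < b, HasDerivAt f (f s * g s) s)
    (hg : ContinuousOn g (Set.Iio b)) {s₁ : ℝ} (hs₁ : s₁ < b) (h₁ : f s₁ < 0) :
    ∀ s < b, f s < 0 := by
  obtain ⟨G, hG⟩ := exists_antideriv_Iio hg
  have hE : ∀ s < b, HasDerivAt (fun s => f s * Real.exp (-G s)) 0 s := by
    intro s hs
    have := (hd s hs).mul (hG s hs).neg.exp
    refine this.congr_deriv ?_
    ring
  have hmono := monotoneOn_of_forall_hasDerivAt_nonneg (convex_Iio b) hE fun _ _ => le_rfl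
  have hanti := antitoneOn_of_forall_hasDerivAt_nonpos (convex_Iio b) hE fun _ _ => le_rfl
  intro s hs
  have key : f s * Real.exp (-G s) ≤ f s₁ * Real.exp (-G s₁) := by
    rcases le_total s s₁ with h | h
    · exact hmono hs hs₁ h
    · exact hanti hs₁ hs h
  have h2 : f s * Real.exp (-G s) < 0 :=
    key.trans_lt (mul_neg_of_neg_of_pos h₁ (Real.exp_pos _))
  exact neg_of_mul_neg_left h2 (Real.exp_pos _).le

end Calculus

section SingularODE

open BoundedContinuousFunction

/-- The integral operator whose fixed points solve `z y' = -n y + z H(z, y)`; the variable is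
clamped to `[0, δ]`. -/
noncomputable def singularIntegral (n : ℕ) (δ : ℝ) (H : ℝ → ℝ × ℝ → ℝ) (y : ℝ → ℝ × ℝ)
    (x : ℝ) : ℝ :=
  max 0 (min x δ) * ∫ u in (0 : ℝ)..1, u ^ n * H (u * max 0 (min x δ)) (y (u * max 0 (min x δ)))

variable {n : ℕ} {δ M L : ℝ} {H : ℝ → ℝ × ℝ → ℝ} {y y' : ℝ → ℝ × ℝ}

lemma continuous_singularIntegral (hH : Continuous (Function.uncurry H)) (hy : Continuous y) :
    Continuous (singularIntegral n δ H y) := by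
  unfold singularIntegral
  refine (by fun_prop : Continuous fun x : ℝ => max 0 (min x δ)).mul ?_
  refine intervalIntegral.continuous_parametric_intervalIntegral_of_continuous' ?_ 0 1
  have h1 : Continuous fun q : ℝ × ℝ => (q.2 * max 0 (min q.1 δ), y (q.2 * max 0 (min q.1 δ))) := by
    fun_prop
  exact (continuous_snd.pow n).mul (hH.comp h1)

lemma abs_singularIntegral_le (hM : ∀ z w, |H z w| ≤ M) (x : ℝ) :
    |singularIntegral n δ H y x| ≤ M * max 0 (min x δ) := by
  unfold singularIntegral
  have hM0 : 0 ≤ M := (abs_nonneg _).trans (hM 0 0)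
  rw [abs_mul, abs_of_nonneg (le_max_left 0 _), mul_comm]
  refine mul_le_mul_of_nonneg_right ?_ (le_max_left 0 _)
  rw [← Real.norm_eq_abs]
  refine le_trans (b := M * |(1 : ℝ) - 0|)
    (intervalIntegral.norm_integral_le_of_norm_le_const fun u hu => ?_) (by simp)
  rw [Set.uIoc_of_le zero_le_one] at hu
  rw [Real.norm_eq_abs, abs_mul, abs_pow, abs_of_pos hu.1]
  exact (mul_le_mul (pow_le_one₀ hu.1.le hu.2) (hM _ _) (abs_nonneg _) zero_le_one).trans
    (one_mul M).le

lemma abs_singularIntegral_sub_le (hH : Continuous (Function.uncurry H))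
    (hL : ∀ z w w', |H z w - H z w'| ≤ L * dist w w') (hL0 : 0 ≤ L) (hδ : 0 ≤ δ)
    (hy : Continuous y) (hy' : Continuous y') {d : ℝ} (hd : ∀ x, dist (y x) (y' x) ≤ d) (x : ℝ) :
    |singularIntegral n δ H y x - singularIntegral n δ H y' x| ≤ δ * L * d := by
  unfold singularIntegral
  set c := max 0 (min x δ)
  have hd0 : 0 ≤ d := dist_nonneg.trans (hd 0)
  have hc0 : 0 ≤ c := le_max_left _ _
  have hcδ : c ≤ δ := max_le hδ (min_le_right _ _)
  have hint : ∀ w : ℝ → ℝ × ℝ, Continuous w →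
      IntervalIntegrable (fun u => u ^ n * H (u * c) (w (u * c))) MeasureTheory.volume 0 1 := by
    intro w hw
    refine Continuous.intervalIntegrable ?_ _ _
    exact (continuous_id.pow n).mul
      (hH.comp (by fun_prop : Continuous fun u : ℝ => (u * c, w (u * c))))
  rw [← mul_sub, ← intervalIntegral.integral_sub (hint y hy) (hint y' hy'), abs_mul,
    abs_of_nonneg hc0, mul_assoc]
  refine mul_le_mul hcδ ?_ (abs_nonneg _) hδ
  rw [← Real.norm_eq_abs]
  refine le_trans (b := L * d * |(1 : ℝ) - 0|)
    (intervalIntegral.norm_integral_le_of_norm_le_const fun u hu => ?_) (by simp)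
  rw [Set.uIoc_of_le zero_le_one] at hu
  rw [← mul_sub, Real.norm_eq_abs, abs_mul, abs_pow, abs_of_pos hu.1]
  refine (mul_le_mul (pow_le_one₀ hu.1.le hu.2) (hL _ _ _) (abs_nonneg _) zero_le_one).trans ?_
  rw [one_mul]
  exact mul_le_mul_of_nonneg_left (hd _) hL0

lemma hasDerivAt_singularIntegral (hH : Continuous (Function.uncurry H)) (hy : Continuous y)
    {z : ℝ} (hz : z ∈ Set.Ioo 0 δ) :
    HasDerivAt (singularIntegral n δ H y) (H z (y z) - n * singularIntegral n δ H y z / z) z := by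
  set F : ℝ → ℝ := fun t => t ^ n * H t (y t)
  have hF : Continuous F :=
    (continuous_id.pow n).mul (hH.comp (by fun_prop : Continuous fun t : ℝ => (t, y t)))
  have heq : ∀ x ∈ Set.Ioo 0 δ, singularIntegral n δ H y x =
      (x ^ n)⁻¹ * ∫ t in (0 : ℝ)..x, F t := by
    intro x hx
    have hc : max 0 (min x δ) = x := by rw [min_eq_left hx.2.le, max_eq_right hx.1.le]
    have hx0 : x ≠ 0 := hx.1.ne'
    have hsub := intervalIntegral.integral_comp_mul_left (a := 0) (b := 1) F hx0
    simp only [mul_zero, mul_one, smul_eq_mul] at hsub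
    have h2 : (∫ u in (0 : ℝ)..1, F (x * u))
        = x ^ n * ∫ u in (0 : ℝ)..1, u ^ n * H (u * x) (y (u * x)) := by
      rw [← intervalIntegral.integral_const_mul]
      refine intervalIntegral.integral_congr fun u _ => ?_
      simp only [F, mul_pow, mul_comm x u]
      ring
    have h3 : (∫ t in (0 : ℝ)..x, F t)
        = x * (x ^ n * ∫ u in (0 : ℝ)..1, u ^ n * H (u * x) (y (u * x))) := by
      rw [← h2, hsub]
      field_simp
    unfold singularIntegral
    rw [hc, h3]
    field_simp
  have hz0 : z ≠ 0 := hz.1.ne'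
  have hev : singularIntegral n δ H y =ᶠ[𝓝 z] fun x => (x ^ n)⁻¹ * ∫ t in (0 : ℝ)..x, F t := by
    filter_upwards [Ioo_mem_nhds hz.1 hz.2] with x hx using heq x hx
  have hint : HasDerivAt (fun x => ∫ t in (0 : ℝ)..x, F t) (F z) z :=
    hF.integral_hasStrictDerivAt 0 z |>.hasDerivAt
  have hpow := ((hasDerivAt_pow n z).inv (pow_ne_zero n hz0)).mul hint
  refine (hpow.congr_of_eventuallyEq hev).congr_deriv ?_
  rw [heq z hz]
  simp only [F]
  rcases n with _ | m
  · simp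
  · simp only [Nat.add_sub_cancel, pow_succ, Pi.inv_apply]
    field_simp
    ring

/-- Solutions of the singular system `z p' = z H₁(z, p, r)`, `z r' = -2 r + z H₂(z, p, r)`
that vanish to first order at `z = 0`. -/
lemma exists_solution_singular {H₁ H₂ : ℝ → ℝ × ℝ → ℝ}
    (hH₁ : Continuous (Function.uncurry H₁)) (hH₂ : Continuous (Function.uncurry H₂))
    (hM₁ : ∀ z w, |H₁ z w| ≤ M) (hM₂ : ∀ z w, |H₂ z w| ≤ M)
    (hL₁ : ∀ z w w', |H₁ z w - H₁ z w'| ≤ L * dist w w')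
    (hL₂ : ∀ z w w', |H₂ z w - H₂ z w'| ≤ L * dist w w') (hL0 : 0 ≤ L) :
    ∃ δ > 0, ∃ p r : ℝ → ℝ, ∀ z ∈ Set.Ioo 0 δ, |p z| ≤ M * z ∧ |r z| ≤ M * z ∧
      HasDerivAt p (H₁ z (p z, r z)) z ∧ HasDerivAt r (H₂ z (p z, r z) - 2 * r z / z) z := by
  set δ : ℝ := 1 / (2 * (L + 1))
  have hδ : 0 < δ := by positivity
  have hM0 : 0 ≤ M := (abs_nonneg _).trans (hM₁ 0 0)
  let T : (ℝ →ᵇ ℝ × ℝ) → (ℝ →ᵇ ℝ × ℝ) := fun y =>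
    BoundedContinuousFunction.ofNormedAddCommGroup
      (fun x => (singularIntegral 0 δ H₁ y x, singularIntegral 2 δ H₂ y x))
      ((continuous_singularIntegral hH₁ y.continuous).prodMk
        (continuous_singularIntegral hH₂ y.continuous)) (M * δ) (by
          intro x
          have hc : max 0 (min x δ) ≤ δ := max_le hδ.le (min_le_right _ _)
          have hMc := mul_le_mul_of_nonneg_left hc hM0
          exact max_le ((abs_singularIntegral_le hM₁ x).trans hMc)
            ((abs_singularIntegral_le hM₂ x).trans hMc))
  have hTapp : ∀ y x, T y x = (singularIntegral 0 δ H₁ y x, singularIntegral 2 δ H₂ y x) :=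
    fun _ _ => rfl
  have hδL : δ * L ≤ 1 / 2 := by
    simp only [δ]
    rw [div_mul_eq_mul_div, div_le_div_iff₀ (by positivity) (by norm_num)]
    linarith
  have hT : ContractingWith (1 / 2 : NNReal) T := by
    refine ⟨by rw [← NNReal.coe_lt_coe]; norm_num, LipschitzWith.of_dist_le_mul fun y y' => ?_⟩
    have hnn : 0 ≤ dist y y' := dist_nonneg
    refine (BoundedContinuousFunction.dist_le (by positivity)).2 fun x => ?_
    have hle : δ * L * dist y y' ≤ ((1 / 2 : NNReal) : ℝ) * dist y y' := by
      refine mul_le_mul_of_nonneg_right (hδL.trans (by norm_num)) hnn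
    have hd : ∀ x, dist (y x) (y' x) ≤ dist y y' := fun x =>
      BoundedContinuousFunction.dist_coe_le_dist x
    rw [hTapp, hTapp]
    exact max_le
      ((abs_singularIntegral_sub_le hH₁ hL₁ hL0 hδ.le y.continuous y'.continuous hd x).trans hle)
      ((abs_singularIntegral_sub_le hH₂ hL₂ hL0 hδ.le y.continuous y'.continuous hd x).trans hle)
  set y := ContractingWith.fixedPoint T hT
  have hy : T y = y := ContractingWith.fixedPoint_isFixedPt hT
  have hp : ∀ x, (y x).1 = singularIntegral 0 δ H₁ y x := fun x => by
    conv_lhs => rw [← hy, hTapp]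
  have hr : ∀ x, (y x).2 = singularIntegral 2 δ H₂ y x := fun x => by
    conv_lhs => rw [← hy, hTapp]
  refine ⟨δ, hδ, singularIntegral 0 δ H₁ y, singularIntegral 2 δ H₂ y, fun z hz => ?_⟩
  have hc : max 0 (min z δ) = z := by rw [min_eq_left hz.2.le, max_eq_right hz.1.le]
  have hyz : (singularIntegral 0 δ H₁ y z, singularIntegral 2 δ H₂ y z) = y z := by
    rw [← hp, ← hr]
  rw [hyz]
  refine ⟨?_, ?_, ?_, ?_⟩
  · simpa [hc] using abs_singularIntegral_le (n := 0) (δ := δ) (y := y) hM₁ z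
  · simpa [hc] using abs_singularIntegral_le (n := 2) (δ := δ) (y := y) hM₂ z
  · simpa using hasDerivAt_singularIntegral (n := 0) hH₁ y.continuous hz
  · simpa using hasDerivAt_singularIntegral (n := 2) hH₂ y.continuous hz

/-- Local version of `exists_solution_singular` for continuously differentiable right-hand sides. -/
lemma exists_solution_singular_of_contDiff {H₁ H₂ : ℝ × ℝ × ℝ → ℝ}
    (hH₁ : ContDiff ℝ 1 H₁) (hH₂ : ContDiff ℝ 1 H₂) :
    ∃ δ > 0, ∃ C : ℝ, ∃ p r : ℝ → ℝ, ∀ z ∈ Set.Ioo 0 δ, |p z| ≤ C * z ∧ |r z| ≤ C * z ∧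
      HasDerivAt p (H₁ (z, p z, r z)) z ∧ HasDerivAt r (H₂ (z, p z, r z) - 2 * r z / z) z := by
  let c : ℝ → ℝ := fun x => max (-1) (min x 1)
  have hc : Continuous c := by fun_prop
  have hcmem : ∀ x, c x ∈ Set.Icc (-1 : ℝ) 1 := fun x =>
    ⟨le_max_left _ _, max_le (by norm_num) (min_le_right _ _)⟩
  have hcdist : ∀ x x', |c x - c x'| ≤ |x - x'| := fun x x' => by
    refine (abs_max_sub_max_le_max (-1) (min x 1) (-1) (min x' 1)).trans ?_
    refine max_le (by simp) ?_
    exact (abs_min_sub_min_le_max x 1 x' 1).trans (max_le le_rfl (by simp))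
  have hcid : ∀ x, |x| ≤ 1 → c x = x := fun x hx => by
    simp only [c]
    rw [min_eq_left (abs_le.1 hx).2, max_eq_right (abs_le.1 hx).1]
  set K : Set (ℝ × ℝ × ℝ) := Set.Icc (-1) 1 ×ˢ Set.Icc (-1) 1 ×ˢ Set.Icc (-1) 1
  have hK : IsCompact K := isCompact_Icc.prod (isCompact_Icc.prod isCompact_Icc)
  let e : ℝ → ℝ × ℝ → ℝ × ℝ × ℝ := fun z w => (c z, c w.1, c w.2)
  have heK : ∀ z w, e z w ∈ K := fun z w => ⟨hcmem _, hcmem _, hcmem _⟩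
  have he : Continuous (Function.uncurry e) :=
    (hc.comp continuous_fst).prodMk ((hc.comp (continuous_fst.comp continuous_snd)).prodMk
      (hc.comp (continuous_snd.comp continuous_snd)))
  have hedist : ∀ z w w', dist (e z w) (e z w') ≤ dist w w' := fun z w w' => by
    refine max_le (by simp [e]) (max_le ?_ ?_)
    · exact (hcdist _ _).trans (le_max_left (dist w.1 w'.1) (dist w.2 w'.2))
    · exact (hcdist _ _).trans (le_max_right (dist w.1 w'.1) (dist w.2 w'.2))
  have main : ∀ H : ℝ × ℝ × ℝ → ℝ, ContDiff ℝ 1 H → ∃ M L : ℝ, 0 ≤ L ∧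
      (∀ z w, |H (e z w)| ≤ M) ∧ ∀ z w w', |H (e z w) - H (e z w')| ≤ L * dist w w' := by
    intro H hH
    obtain ⟨M, hM⟩ := hK.exists_bound_of_continuousOn hH.continuous.continuousOn
    obtain ⟨L, hL⟩ := hH.locallyLipschitz.locallyLipschitzOn.exists_lipschitzOnWith_of_compact hK
    refine ⟨M, L, L.2, fun z w => hM _ (heK z w), fun z w w' => ?_⟩
    exact (hL.dist_le_mul _ (heK z w) _ (heK z w')).trans
      (mul_le_mul_of_nonneg_left (hedist z w w') L.2)
  obtain ⟨M₁, L₁, hL₁0, hM₁, hL₁⟩ := main H₁ hH₁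
  obtain ⟨M₂, L₂, -, hM₂, hL₂⟩ := main H₂ hH₂
  obtain ⟨δ, hδ, p, r, hpr⟩ := exists_solution_singular
    (H₁ := fun z w => H₁ (e z w)) (H₂ := fun z w => H₂ (e z w)) (M := max M₁ M₂) (L := max L₁ L₂)
    (hH₁.continuous.comp he) (hH₂.continuous.comp he)
    (fun z w => (hM₁ z w).trans (le_max_left _ _)) (fun z w => (hM₂ z w).trans (le_max_right _ _))
    (fun z w w' => (hL₁ z w w').trans (mul_le_mul_of_nonneg_right (le_max_left _ _) dist_nonneg))
    (fun z w w' => (hL₂ z w w').trans (mul_le_mul_of_nonneg_right (le_max_right _ _) dist_nonneg))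
    (hL₁0.trans (le_max_left _ _))
  set M := max M₁ M₂
  have hM0 : 0 ≤ M := (abs_nonneg _).trans ((hM₁ 0 0).trans (le_max_left _ _))
  refine ⟨min δ (min 1 (1 / (M + 1))), by positivity, M, p, r, fun z hz => ?_⟩
  have hzδ : z < δ := hz.2.trans_le (min_le_left _ _)
  have hz1 : z < 1 := hz.2.trans_le ((min_le_right _ _).trans (min_le_left _ _))
  have hzM : M * z ≤ 1 := by
    have : z < 1 / (M + 1) := hz.2.trans_le ((min_le_right _ _).trans (min_le_right _ _))
    rw [lt_div_iff₀ (by positivity)] at this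
    nlinarith [hz.1]
  obtain ⟨h1, h2, h3, h4⟩ := hpr z ⟨hz.1, hzδ⟩
  have hee : e z (p z, r z) = (z, p z, r z) := by
    simp only [e]
    rw [hcid z (abs_le.2 ⟨by linarith [hz.1], hz1.le⟩),
      hcid _ (h1.trans hzM), hcid _ (h2.trans hzM)]
  rw [hee] at h3 h4
  exact ⟨h1, h2, h3, h4⟩

end SingularODE

section Uniqueness

/-- The vector field of the phase-plane system. -/
def phaseField (k : ℝ) (x : ℝ × ℝ) : ℝ × ℝ :=
  (x.1 * ((x.2 + k) ^ 2 + (1 - k ^ 2) * (1 - x.1)),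
    k * x.1 * (k * x.2 - 1) + x.2 * ((x.2 + k) ^ 2 - (1 + k ^ 2)))

lemma contDiff_phaseField (k : ℝ) : ContDiff ℝ 1 (phaseField k) := by
  unfold phaseField
  fun_prop

variable {k : ℝ} {S S' : Set ℝ} {ψ θ ψ' θ' : ℝ → ℝ} {a b : ℝ}

lemma phasePlane.mono (h : phasePlane k S ψ θ) (hS : S' ⊆ S) : phasePlane k S' ψ θ :=
  fun s hs => h s (hS hs)

lemma phasePlane.hasDerivAt_prodMk (h : phasePlane k S ψ θ) {s : ℝ} (hs : s ∈ S) :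
    HasDerivAt (fun s => (ψ s, θ s)) (phaseField k (ψ s, θ s)) s :=
  (h s hs).1.prodMk (h s hs).2

lemma phasePlane.congr (h : phasePlane k S ψ θ) (hS : IsOpen S)
    (hψ : Set.EqOn ψ' ψ S) (hθ : Set.EqOn θ' θ S) : phasePlane k S ψ' θ' := by
  intro s hs
  rw [hψ hs, hθ hs]
  exact ⟨(h s hs).1.congr_of_eventuallyEq (hψ.eventuallyEq_of_mem (hS.mem_nhds hs)),
    (h s hs).2.congr_of_eventuallyEq (hθ.eventuallyEq_of_mem (hS.mem_nhds hs))⟩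

lemma phasePlane.eqOn_Ioo (h : phasePlane k (Set.Ioo a b) ψ θ)
    (h' : phasePlane k (Set.Ioo a b) ψ' θ') {t : ℝ} (ht : t ∈ Set.Ioo a b)
    (hψ : ψ t = ψ' t) (hθ : θ t = θ' t) {s : ℝ} (hs : s ∈ Set.Ioo a b) :
    ψ s = ψ' s ∧ θ s = θ' s := by
  obtain ⟨a', ha', ha'm⟩ := exists_between (lt_min ht.1 hs.1)
  obtain ⟨b', hb'm, hb'⟩ := exists_between (max_lt ht.2 hs.2)
  have hsub : Set.Icc a' b' ⊆ Set.Ioo a b := fun u hu => ⟨ha'.trans_le hu.1, hu.2.trans_lt hb'⟩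
  set K : Set (ℝ × ℝ) := (fun s => (ψ s, θ s)) '' Set.Icc a' b' ∪
    (fun s => (ψ' s, θ' s)) '' Set.Icc a' b'
  have hK : IsCompact K := by
    refine IsCompact.union ?_ ?_
    · exact isCompact_Icc.image_of_continuousOn fun u hu =>
        (h.hasDerivAt_prodMk (hsub hu)).continuousAt.continuousWithinAt
    · exact isCompact_Icc.image_of_continuousOn fun u hu =>
        (h'.hasDerivAt_prodMk (hsub hu)).continuousAt.continuousWithinAt
  obtain ⟨L, hL⟩ :=
    (contDiff_phaseField k).locallyLipschitz.locallyLipschitzOn.exists_lipschitzOnWith_of_compact hK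
  have key := ODE_solution_unique_of_mem_Ioo (v := fun _ => phaseField k) (s := fun _ => K)
    (f := fun s => (ψ s, θ s)) (g := fun s => (ψ' s, θ' s)) (a := a') (b := b') (t₀ := t)
    (fun _ _ => hL) ⟨ha'm.trans_le (min_le_left _ _), (le_max_left _ _).trans_lt hb'm⟩
    (fun u hu => ⟨h.hasDerivAt_prodMk (hsub (Set.Ioo_subset_Icc_self hu)),
      Or.inl ⟨u, Set.Ioo_subset_Icc_self hu, rfl⟩⟩)
    (fun u hu => ⟨h'.hasDerivAt_prodMk (hsub (Set.Ioo_subset_Icc_self hu)),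
      Or.inr ⟨u, Set.Ioo_subset_Icc_self hu, rfl⟩⟩) (by rw [hψ, hθ])
    ⟨ha'm.trans_le (min_le_right _ _), (le_max_right _ _).trans_lt hb'm⟩
  exact Prod.mk.injEq _ _ _ _ ▸ key

/-- Near a hyperbolic point with eigenvalues `±1`, the unstable direction `D` dominates along
trajectories that converge to the point at `-∞`. -/
lemma abs_le_mul_abs_of_saddle {D E D' E' : ℝ → ℝ} {η : ℝ} (hη0 : 0 ≤ η) (hη1 : η ≤ 1)
    (hD : ∀ s < b, HasDerivAt D (D' s) s) (hE : ∀ s < b, HasDerivAt E (E' s) s)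
    (hD' : ∀ s < b, |D' s - D s| ≤ η ^ 2 / 2 * (|D s| + |E s|))
    (hE' : ∀ s < b, |E' s + E s| ≤ η ^ 2 / 2 * (|D s| + |E s|))
    (hD0 : Tendsto D atBot (𝓝 0)) (hE0 : Tendsto E atBot (𝓝 0)) :
    ∀ s < b, |E s| ≤ η * |D s| := by
  have hV : ∀ s < b, HasDerivAt (fun s => E s ^ 2 - η ^ 2 * D s ^ 2)
      (2 * E s * E' s - η ^ 2 * (2 * D s * D' s)) s := by
    intro s hs
    refine (((hE s hs).pow 2).sub (((hD s hs).pow 2).const_mul (η ^ 2))).congr_deriv ?_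
    simp only [Nat.cast_ofNat, Nat.add_one_sub_one, pow_one]
  have hV' : ∀ s < b, 2 * E s * E' s - η ^ 2 * (2 * D s * D' s) ≤ 0 := by
    intro s hs
    have h1 : E s * (E' s + E s) ≤ |E s| * (η ^ 2 / 2 * (|D s| + |E s|)) :=
      (le_abs_self _).trans (by
        rw [abs_mul]
        exact mul_le_mul_of_nonneg_left (hE' s hs) (abs_nonneg _))
    have h2 : -(D s * (D' s - D s)) ≤ |D s| * (η ^ 2 / 2 * (|D s| + |E s|)) :=
      (neg_le_abs _).trans (by
        rw [abs_mul]
        exact mul_le_mul_of_nonneg_left (hD' s hs) (abs_nonneg _))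
    have hη2 : η ^ 2 ≤ 1 := pow_le_one₀ hη0 hη1
    have h3 : η ^ 2 * (-(D s * (D' s - D s))) ≤ |D s| * (η ^ 2 / 2 * (|D s| + |E s|)) := by
      refine (mul_le_mul_of_nonneg_left h2 (sq_nonneg η)).trans ?_
      exact mul_le_of_le_one_left (by positivity) hη2
    have h4 : (|D s| + |E s|) ^ 2 ≤ 2 * (D s ^ 2 + E s ^ 2) := by
      rw [← sq_abs (D s), ← sq_abs (E s)]
      nlinarith [sq_nonneg (|D s| - |E s|)]
    have h5 := mul_le_mul_of_nonneg_left h4 (sq_nonneg η)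
    have h6 : η ^ 2 * E s ^ 2 ≤ E s ^ 2 := mul_le_of_le_one_left (sq_nonneg _) hη2
    nlinarith
  have hanti : AntitoneOn (fun s => E s ^ 2 - η ^ 2 * D s ^ 2) (Set.Iio b) :=
    antitoneOn_of_forall_hasDerivAt_nonpos (convex_Iio b) hV hV'
  intro s hs
  have h0 : Tendsto (fun s => E s ^ 2 - η ^ 2 * D s ^ 2) atBot (𝓝 0) := by
    simpa using (hE0.pow 2).sub ((hD0.pow 2).const_mul (η ^ 2))
  have := hanti.nonpos_of_tendsto_atBot h0 hs
  refine abs_le_of_sq_le_sq ?_ (by positivity)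
  rw [mul_pow, sq_abs]
  linarith

end Uniqueness

section UnstableManifold

/-- The difference of two phase-plane trajectories, in coordinates diagonalising the linearisation
at the origin, satisfies the linearised system up to an error controlled by the size of the
trajectories. -/
lemma linearization_error {k m ψ₁ θ₁ ψ₂ θ₂ : ℝ} (hk0 : 0 ≤ k) (hk1 : k ≤ 1) (hm1 : m ≤ 1)
    (hψ₁ : |ψ₁| ≤ m) (hθ₁ : |θ₁| ≤ m) (hψ₂ : |ψ₂| ≤ m) (hθ₂ : |θ₂| ≤ m) :
    |(phaseField k (ψ₁, θ₁)).1 - (phaseField k (ψ₂, θ₂)).1 - (ψ₁ - ψ₂)|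
        ≤ 30 * m * (|ψ₁ - ψ₂| + |θ₁ - θ₂ + k / 2 * (ψ₁ - ψ₂)|) ∧
    |(phaseField k (ψ₁, θ₁)).2 - (phaseField k (ψ₂, θ₂)).2
          + k / 2 * ((phaseField k (ψ₁, θ₁)).1 - (phaseField k (ψ₂, θ₂)).1)
          + (θ₁ - θ₂ + k / 2 * (ψ₁ - ψ₂))|
        ≤ 30 * m * (|ψ₁ - ψ₂| + |θ₁ - θ₂ + k / 2 * (ψ₁ - ψ₂)|) := by
  set D := ψ₁ - ψ₂ with hD
  set T := θ₁ - θ₂ with hT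
  set E := T + k / 2 * D with hE
  have hm0 : 0 ≤ m := (abs_nonneg _).trans hψ₁
  have hk2 : k ^ 2 ≤ 1 := pow_le_one₀ hk0 hk1
  have hTE : |T| ≤ |E| + |D| := by
    have : T = E - k / 2 * D := by rw [hE]; ring
    rw [this]
    refine (abs_sub _ _).trans (add_le_add le_rfl ?_)
    rw [abs_mul, abs_of_nonneg (by positivity : (0 : ℝ) ≤ k / 2)]
    exact mul_le_of_le_one_left (abs_nonneg _) (by linarith)
  have hmm : m * m ≤ m := mul_le_of_le_one_left hm0 hm1
  have prod : ∀ {a b c d : ℝ}, |a| ≤ c → |b| ≤ d → |a * b| ≤ c * d := fun ha hb => by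
    rw [abs_mul]
    exact mul_le_mul ha hb (abs_nonneg _) ((abs_nonneg _).trans ha)
  have hkabs : |k| ≤ 1 := by rwa [abs_of_nonneg hk0]
  have h1k : |1 - k ^ 2| ≤ 1 := by
    rw [abs_of_nonneg (by linarith)]; linarith [sq_nonneg k]
  have hk2' : |k ^ 2| ≤ 1 := by rwa [abs_of_nonneg (sq_nonneg k)]
  have hN1 : |D * (θ₁ ^ 2 + 2 * k * θ₁ - (1 - k ^ 2) * ψ₁)
      + ψ₂ * (T * (θ₁ + θ₂ + 2 * k) - (1 - k ^ 2) * D)| ≤ 5 * m * (|D| + |T|) := by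
    have e1 : |θ₁ ^ 2 + 2 * k * θ₁ - (1 - k ^ 2) * ψ₁| ≤ 4 * m := by
      have a1 : |θ₁ ^ 2| ≤ m := by rw [sq]; exact (prod hθ₁ hθ₁).trans hmm
      have a2 : |k * θ₁| ≤ 1 * m := prod hkabs hθ₁
      have a3 := prod h1k hψ₁
      rw [abs_le] at *
      constructor <;> nlinarith
    have e2 : |θ₁ + θ₂ + 2 * k| ≤ 4 := by
      rw [abs_le] at hθ₁ hθ₂ hkabs ⊢
      constructor <;> linarith
    have e3 : |T * (θ₁ + θ₂ + 2 * k) - (1 - k ^ 2) * D| ≤ |T| * 4 + 1 * |D| :=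
      (abs_sub _ _).trans (add_le_add (prod le_rfl e2) (prod h1k le_rfl))
    refine (abs_add_le _ _).trans ((add_le_add (prod le_rfl e1) (prod hψ₂ e3)).trans ?_)
    nlinarith [mul_nonneg hm0 (abs_nonneg D), mul_nonneg hm0 (abs_nonneg T)]
  have hN2 : |k ^ 2 * (D * θ₁ + ψ₂ * T) + T * (θ₁ ^ 2 + θ₁ * θ₂ + θ₂ ^ 2)
      + 2 * k * (T * (θ₁ + θ₂))| ≤ 8 * m * (|D| + |T|) := by
    have e1 : |k ^ 2 * (D * θ₁ + ψ₂ * T)| ≤ 1 * (|D| * m + m * |T|) :=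
      prod hk2' ((abs_add_le _ _).trans (add_le_add (prod le_rfl hθ₁) (prod hψ₂ le_rfl)))
    have e2 : |θ₁ ^ 2 + θ₁ * θ₂ + θ₂ ^ 2| ≤ 3 * m := by
      have a1 := (prod hθ₁ hθ₁).trans hmm
      have a2 := (prod hθ₁ hθ₂).trans hmm
      have a3 := (prod hθ₂ hθ₂).trans hmm
      rw [abs_le] at *
      constructor <;> nlinarith
    have e3 : |2 * k * (T * (θ₁ + θ₂))| ≤ 2 * (|T| * (m + m)) :=
      prod (by rw [abs_of_nonneg (by positivity)]; linarith)
        (prod le_rfl ((abs_add_le _ _).trans (add_le_add hθ₁ hθ₂)))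
    refine (abs_add_three _ _ _).trans
      ((add_le_add_three e1 (prod le_rfl e2) e3).trans ?_)
    nlinarith [mul_nonneg hm0 (abs_nonneg D), mul_nonneg hm0 (abs_nonneg T)]
  have hsum : m * (|D| + |T|) ≤ m * (2 * (|D| + |E|)) :=
    mul_le_mul_of_nonneg_left (by linarith [abs_nonneg E]) hm0
  have hmDE : 0 ≤ m * (|D| + |E|) := by positivity
  constructor
  · have : (phaseField k (ψ₁, θ₁)).1 - (phaseField k (ψ₂, θ₂)).1 - D
        = D * (θ₁ ^ 2 + 2 * k * θ₁ - (1 - k ^ 2) * ψ₁)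
          + ψ₂ * (T * (θ₁ + θ₂ + 2 * k) - (1 - k ^ 2) * D) := by
      simp only [phaseField, hD, hT]; ring
    rw [this]
    exact hN1.trans (by linarith)
  · have : (phaseField k (ψ₁, θ₁)).2 - (phaseField k (ψ₂, θ₂)).2
          + k / 2 * ((phaseField k (ψ₁, θ₁)).1 - (phaseField k (ψ₂, θ₂)).1) + E
        = (k ^ 2 * (D * θ₁ + ψ₂ * T) + T * (θ₁ ^ 2 + θ₁ * θ₂ + θ₂ ^ 2)
          + 2 * k * (T * (θ₁ + θ₂)))
          + k / 2 * (D * (θ₁ ^ 2 + 2 * k * θ₁ - (1 - k ^ 2) * ψ₁)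
          + ψ₂ * (T * (θ₁ + θ₂ + 2 * k) - (1 - k ^ 2) * D)) := by
      simp only [phaseField, hD, hT, hE]; ring
    rw [this]
    have hk2a : |k / 2| ≤ 1 := by rw [abs_of_nonneg (by positivity)]; linarith
    refine (abs_add_le _ _).trans ((add_le_add hN2 (prod hk2a hN1)).trans ?_)
    linarith

variable {k : ℝ} {ψ θ ψ' θ' : ℝ → ℝ} {b b' : ℝ}

/-- Trajectories of the phase-plane system on `(-∞, b)` that emanate from the origin, normalised
by `ψ ~ -e^s`. -/
structure IsInteriorSolution (k b : ℝ) (ψ θ : ℝ → ℝ) : Prop where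
  sol : phasePlane k (Set.Iio b) ψ θ
  tendsto_ψ : Tendsto ψ atBot (𝓝 0)
  tendsto_θ : Tendsto θ atBot (𝓝 0)
  normalized : Tendsto (fun s => ψ s * Real.exp (-s)) atBot (𝓝 (-1))

lemma hasDerivAt_sub_linear (h : phasePlane k (Set.Iio b) ψ θ)
    (h' : phasePlane k (Set.Iio b') ψ' θ') {s : ℝ} (hs : s < b) (hs' : s < b') :
    HasDerivAt (fun s => ψ s - ψ' s)
      ((phaseField k (ψ s, θ s)).1 - (phaseField k (ψ' s, θ' s)).1) s ∧
    HasDerivAt (fun s => θ s - θ' s + k / 2 * (ψ s - ψ' s))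
      ((phaseField k (ψ s, θ s)).2 - (phaseField k (ψ' s, θ' s)).2
        + k / 2 * ((phaseField k (ψ s, θ s)).1 - (phaseField k (ψ' s, θ' s)).1)) s := by
  obtain ⟨h1, h2⟩ := h s hs
  obtain ⟨h3, h4⟩ := h' s hs'
  exact ⟨h1.sub h3, (h2.sub h4).add ((h1.sub h3).const_mul (k / 2))⟩

lemma phasePlane.eventually_abs_le (hk0 : 0 ≤ k) (hk1 : k ≤ 1)
    (h : phasePlane k (Set.Iio b) ψ θ) (h' : phasePlane k (Set.Iio b') ψ' θ')
    (hψ : Tendsto ψ atBot (𝓝 0)) (hθ : Tendsto θ atBot (𝓝 0))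
    (hψ' : Tendsto ψ' atBot (𝓝 0)) (hθ' : Tendsto θ' atBot (𝓝 0))
    {η : ℝ} (hη0 : 0 < η) (hη1 : η ≤ 1) :
    ∀ᶠ s in atBot, |θ s - θ' s + k / 2 * (ψ s - ψ' s)| ≤ η * |ψ s - ψ' s| := by
  have small : ∀ {f : ℝ → ℝ}, Tendsto f atBot (𝓝 0) → ∀ᶠ s in atBot, |f s| ≤ η ^ 2 / 60 := by
    intro f hf
    have := hf.abs
    rw [abs_zero] at this
    exact this.eventually (ge_mem_nhds (by positivity))
  obtain ⟨c, hc⟩ := eventually_atBot.1 ((small hψ).and ((small hθ).and ((small hψ').and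
    ((small hθ').and ((eventually_lt_atBot b).and (eventually_lt_atBot b'))))))
  have hm1 : η ^ 2 / 60 ≤ 1 := by nlinarith
  have herr : ∀ s < c, _ := fun s hs => by
    obtain ⟨a1, a2, a3, a4, -, -⟩ := hc s hs.le
    exact linearization_error hk0 hk1 hm1 a1 a2 a3 a4
  have hconst : 30 * (η ^ 2 / 60) = η ^ 2 / 2 := by ring
  simp only [hconst] at herr
  have := abs_le_mul_abs_of_saddle hη0.le hη1
    (fun s hs => (hasDerivAt_sub_linear h h' (hc s (le_of_lt hs)).2.2.2.2.1
      (hc s (le_of_lt hs)).2.2.2.2.2).1)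
    (fun s hs => (hasDerivAt_sub_linear h h' (hc s (le_of_lt hs)).2.2.2.2.1
      (hc s (le_of_lt hs)).2.2.2.2.2).2)
    (fun s hs => (herr s hs).1) (fun s hs => (herr s hs).2)
    (by simpa using hψ.sub hψ')
    (by simpa using (hθ.sub hθ').add ((hψ.sub hψ').const_mul (k / 2)))
  filter_upwards [eventually_lt_atBot c] with s hs using this s hs

namespace IsInteriorSolution

lemma eventually_abs_add_le (h : IsInteriorSolution k b ψ θ) (hk0 : 0 ≤ k) (hk1 : k ≤ 1)
    {η : ℝ} (hη0 : 0 < η) (hη1 : η ≤ 1) :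
    ∀ᶠ s in atBot, |θ s + k / 2 * ψ s| ≤ η * |ψ s| := by
  have h0 : phasePlane k (Set.Iio b) (fun _ => 0) (fun _ => 0) := fun s _ =>
    ⟨(hasDerivAt_const s 0).congr_deriv (by ring), (hasDerivAt_const s 0).congr_deriv (by ring)⟩
  simpa using h.sol.eventually_abs_le hk0 hk1 h0 h.tendsto_ψ h.tendsto_θ
    tendsto_const_nhds tendsto_const_nhds hη0 hη1

lemma eventually_abs_le_exp (h : IsInteriorSolution k b ψ θ) (hk0 : 0 ≤ k) (hk1 : k ≤ 1) :
    ∀ᶠ s in atBot, |ψ s| ≤ 4 * Real.exp s ∧ |θ s| ≤ 4 * Real.exp s := by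
  have h1 : ∀ᶠ s in atBot, |ψ s * Real.exp (-s)| ≤ 2 := by
    have := h.normalized.abs
    rw [abs_neg, abs_one] at this
    exact this.eventually (ge_mem_nhds one_lt_two)
  filter_upwards [h1, h.eventually_abs_add_le hk0 hk1 one_pos le_rfl] with s h1 h2
  have hψ : |ψ s| ≤ 2 * Real.exp s := by
    rw [abs_mul, abs_of_pos (Real.exp_pos _), Real.exp_neg] at h1
    rwa [← div_eq_mul_inv, div_le_iff₀ (Real.exp_pos s)] at h1
  refine ⟨hψ.trans (by linarith [Real.exp_pos s]), ?_⟩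
  have h3 : |θ s| ≤ |θ s + k / 2 * ψ s| + |k / 2 * ψ s| := by
    simpa using abs_sub (θ s + k / 2 * ψ s) (k / 2 * ψ s)
  have h4 : |k / 2 * ψ s| ≤ 1 * |ψ s| := by
    rw [abs_mul, abs_of_nonneg (by positivity : (0 : ℝ) ≤ k / 2)]
    exact mul_le_mul_of_nonneg_right (by linarith) (abs_nonneg _)
  linarith

/-- Two normalised trajectories emanating from the origin agree near `-∞`. -/
lemma eventually_eq (h : IsInteriorSolution k b ψ θ) (h' : IsInteriorSolution k b' ψ' θ')
    (hk0 : 0 ≤ k) (hk1 : k ≤ 1) : ∀ᶠ s in atBot, ψ s = ψ' s ∧ θ s = θ' s := by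
  have hexp : ∀ᶠ s in atBot, 4 * Real.exp s ≤ 1 := by
    have := Real.tendsto_exp_atBot.const_mul 4
    rw [mul_zero] at this
    exact this.eventually (ge_mem_nhds one_pos)
  obtain ⟨c, hc⟩ := eventually_atBot.1 ((h.eventually_abs_le_exp hk0 hk1).and
    ((h'.eventually_abs_le_exp hk0 hk1).and (hexp.and
    ((h.sol.eventually_abs_le hk0 hk1 h'.sol h.tendsto_ψ h.tendsto_θ h'.tendsto_ψ h'.tendsto_θ
      one_pos le_rfl).and ((eventually_lt_atBot b).and (eventually_lt_atBot b'))))))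
  have hU : ∀ s < c, HasDerivAt
      (fun s => ((ψ s - ψ' s) * Real.exp (-s)) ^ 2 * Real.exp (-(480 * Real.exp s)))
      (2 * Real.exp (-s) ^ 2 * Real.exp (-(480 * Real.exp s)) *
        ((ψ s - ψ' s) * ((phaseField k (ψ s, θ s)).1 - (phaseField k (ψ' s, θ' s)).1 - (ψ s - ψ' s))
          - 240 * Real.exp s * (ψ s - ψ' s) ^ 2)) s := by
    intro s hs
    obtain ⟨-, -, -, -, hb, hb'⟩ := hc s hs.le
    have hD := (hasDerivAt_sub_linear h.sol h'.sol hb hb').1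
    have h2 := ((hD.mul (hasDerivAt_neg s).exp).pow 2).mul
      ((Real.hasDerivAt_exp s).const_mul 480).neg.exp
    refine h2.congr_deriv ?_
    simp only [Pi.mul_apply, Pi.pow_apply, Pi.neg_apply, Nat.cast_ofNat, Nat.add_one_sub_one,
      pow_one]
    ring
  have hU' : ∀ s < c, 2 * Real.exp (-s) ^ 2 * Real.exp (-(480 * Real.exp s)) *
        ((ψ s - ψ' s) * ((phaseField k (ψ s, θ s)).1 - (phaseField k (ψ' s, θ' s)).1 - (ψ s - ψ' s))
          - 240 * Real.exp s * (ψ s - ψ' s) ^ 2) ≤ 0 := by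
    intro s hs
    obtain ⟨⟨a1, a2⟩, ⟨a3, a4⟩, a5, a6, -, -⟩ := hc s hs.le
    have herr := (linearization_error hk0 hk1 a5 a1 a2 a3 a4).1
    refine mul_nonpos_of_nonneg_of_nonpos (by positivity) (sub_nonpos.2 ?_)
    refine (le_abs_self _).trans ?_
    rw [abs_mul]
    refine (mul_le_mul_of_nonneg_left herr (abs_nonneg _)).trans ?_
    rw [one_mul] at a6
    rw [← sq_abs (ψ s - ψ' s)]
    have he := Real.exp_pos s
    have h0 := mul_nonneg he.le (abs_nonneg (ψ s - ψ' s))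
    nlinarith [mul_le_mul_of_nonneg_left a6 h0]
  have hanti := antitoneOn_of_forall_hasDerivAt_nonpos (convex_Iio c) hU hU'
  have h0 : Tendsto (fun s => ((ψ s - ψ' s) * Real.exp (-s)) ^ 2 * Real.exp (-(480 * Real.exp s)))
      atBot (𝓝 0) := by
    have h1 : Tendsto (fun s => (ψ s - ψ' s) * Real.exp (-s)) atBot (𝓝 0) := by
      simpa [sub_mul] using h.normalized.sub h'.normalized
    have h2 := (Real.tendsto_exp_atBot.const_mul 480).neg.rexp
    simpa using (h1.pow 2).mul h2
  filter_upwards [eventually_lt_atBot c] with s hs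
  have hle := hanti.nonpos_of_tendsto_atBot h0 hs
  have hD : ψ s - ψ' s = 0 := by
    by_contra hne
    have : 0 < ((ψ s - ψ' s) * Real.exp (-s)) ^ 2 * Real.exp (-(480 * Real.exp s)) := by
      have := Real.exp_pos (-s)
      positivity
    exact absurd hle (not_le.2 this)
  have hE := (hc s hs.le).2.2.2.1
  rw [hD] at hE
  simp only [mul_zero, add_zero, abs_zero, abs_nonpos_iff] at hE
  exact ⟨sub_eq_zero.1 hD, sub_eq_zero.1 hE⟩

/-- Two normalised trajectories emanating from the origin agree on their common domain. -/
lemma unique (h : IsInteriorSolution k b ψ θ) (h' : IsInteriorSolution k b' ψ' θ')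
    (hk0 : 0 ≤ k) (hk1 : k ≤ 1) {s : ℝ} (hs : s < b) (hs' : s < b') :
    ψ s = ψ' s ∧ θ s = θ' s := by
  obtain ⟨t, ⟨ht1, ht2⟩, hts⟩ := ((h.eventually_eq h' hk0 hk1).and (eventually_lt_atBot s)).exists
  have hsub : ∀ {c d : ℝ}, d ≤ c → Set.Ioo (t - 1) d ⊆ Set.Iio c := fun hd u hu =>
    hu.2.trans_le hd
  exact (h.sol.mono (hsub (min_le_left b b'))).eqOn_Ioo (h'.sol.mono (hsub (min_le_right b b')))
    ⟨sub_one_lt t, lt_min (hts.trans hs) (hts.trans hs')⟩ ht1 ht2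
    ⟨(sub_one_lt t).trans hts, lt_min hs hs'⟩

end IsInteriorSolution

end UnstableManifold

section LocalExistence

/-- Existence of the normalised trajectory near `-∞`, with its leading-order behaviour. -/
lemma exists_isInteriorSolution (k : ℝ) :
    ∃ (b : ℝ) (ψ θ : ℝ → ℝ), IsInteriorSolution k b ψ θ ∧
      (fun s => ψ s + Real.exp s) =O[atBot] (fun s => Real.exp (2 * s)) ∧
      (fun s => θ s - k / 2 * Real.exp s) =O[atBot] (fun s => Real.exp (2 * s)) := by
  set q : ℝ × ℝ × ℝ → ℝ := fun x => k / 2 * (1 + x.2.1) + x.2.2 with hq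
  set G : ℝ × ℝ × ℝ → ℝ := fun x =>
    x.1 * q x ^ 2 + 2 * k * q x + (1 - k ^ 2) * (1 + x.2.1) with hG
  obtain ⟨δ, hδ, C, p, r, h⟩ := exists_solution_singular_of_contDiff
    (H₁ := fun x => (1 + x.2.1) * G x)
    (H₂ := fun x => -k ^ 2 * (1 + x.2.1) * q x + x.1 * q x ^ 3 + 2 * k * q x ^ 2
      - k / 2 * ((1 + x.2.1) * G x))
    (by simp only [hG, hq]; fun_prop) (by simp only [hG, hq]; fun_prop)
  have hmem : ∀ {s}, s < Real.log δ → Real.exp s ∈ Set.Ioo 0 δ := fun hs =>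
    ⟨Real.exp_pos _, (Real.lt_log_iff_exp_lt hδ).1 hs⟩
  have hev := eventually_lt_atBot (Real.log δ)
  have exp_two : ∀ s : ℝ, Real.exp (2 * s) = Real.exp s * Real.exp s := fun s => by
    rw [← Real.exp_add]; ring_nf
  have hO : ∀ {f : ℝ → ℝ}, (∀ z ∈ Set.Ioo 0 δ, |f z| ≤ C * z) →
      (fun s => Real.exp s * f (Real.exp s)) =O[atBot] (fun s => Real.exp (2 * s)) := by
    intro f hf
    refine IsBigO.of_bound C ?_
    filter_upwards [hev] with s hs
    have he := Real.exp_pos s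
    rw [exp_two, Real.norm_eq_abs, Real.norm_eq_abs, abs_mul, abs_of_pos he,
      abs_of_pos (mul_pos he he)]
    have := mul_le_mul_of_nonneg_left (hf _ (hmem hs)) he.le
    linarith
  have hlim : ∀ {f : ℝ → ℝ}, (∀ z ∈ Set.Ioo 0 δ, |f z| ≤ C * z) →
      Tendsto (fun s => f (Real.exp s)) atBot (𝓝 0) := by
    intro f hf
    refine squeeze_zero_norm' (a := fun s => C * Real.exp s) ?_ ?_
    · filter_upwards [hev] with s hs using hf _ (hmem hs)
    · simpa using Real.tendsto_exp_atBot.const_mul C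
  have hp : ∀ z ∈ Set.Ioo 0 δ, |p z| ≤ C * z := fun z hz => (h z hz).1
  have hr : ∀ z ∈ Set.Ioo 0 δ, |r z| ≤ C * z := fun z hz => (h z hz).2.1
  have hψ0 : Tendsto (fun s => -(Real.exp s * (1 + p (Real.exp s)))) atBot (𝓝 0) := by
    simpa using (Real.tendsto_exp_atBot.mul ((hlim hp).const_add 1)).neg
  have hθ0 : Tendsto (fun s => Real.exp s * (k / 2 * (1 + p (Real.exp s)) + r (Real.exp s)))
      atBot (𝓝 0) := by
    simpa using Real.tendsto_exp_atBot.mul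
      ((((hlim hp).const_add 1).const_mul (k / 2)).add (hlim hr))
  refine ⟨Real.log δ, fun s => -(Real.exp s * (1 + p (Real.exp s))),
    fun s => Real.exp s * (k / 2 * (1 + p (Real.exp s)) + r (Real.exp s)),
    ⟨?_, hψ0, hθ0, ?_⟩, ?_, ?_⟩
  · intro s hs
    obtain ⟨-, -, hdp, hdr⟩ := h _ (hmem hs)
    have he := Real.hasDerivAt_exp s
    have hz : Real.exp s ≠ 0 := (Real.exp_pos s).ne'
    have hp' := hdp.comp s he
    have hr' := hdr.comp s he
    constructor
    · refine (he.mul (hp'.const_add 1)).neg.congr_deriv ?_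
      simp only [hG, hq, Function.comp_apply]
      ring
    · refine (he.mul (((hp'.const_add 1).const_mul (k / 2)).add hr')).congr_deriv ?_
      simp only [hG, hq, Function.comp_apply, Pi.add_apply]
      field_simp
      ring
  · have : Tendsto (fun s => -(1 + p (Real.exp s))) atBot (𝓝 (-1)) := by
      simpa using ((hlim hp).const_add 1).neg
    refine this.congr fun s => ?_
    rw [Real.exp_neg]
    field_simp
  · refine (hO hp).neg_left.congr_left fun s => ?_
    ring
  · refine (((hO hp).const_mul_left (k / 2)).add (hO hr)).congr_left fun s => ?_
    ring

end LocalExistence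

section Barrier

variable {k b : ℝ} {ψ θ : ℝ → ℝ}

/-- The barrier function whose positivity keeps `θ` away from `1 / k`. -/
def barrier (k x y : ℝ) : ℝ := -k * x * (1 - k * y) - 2 * y * (1 + k * y)

/-- The derivative of the barrier function along the phase-plane system. -/
def barrierDeriv (k x y : ℝ) : ℝ :=
  -k * (phaseField k (x, y)).1 * (1 - k * y) + k ^ 2 * x * (phaseField k (x, y)).2
    - 2 * (1 + 2 * k * y) * (phaseField k (x, y)).2

/-- The rate in the linear part of the evolution of the barrier function. -/
def barrierRate (k x y : ℝ) : ℝ := y ^ 2 - 2 * k * y - 1 - (1 - 2 * k ^ 2) * x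

lemma mul_barrierDeriv (k x y : ℝ) :
    k * (1 - k * y) * barrierDeriv k x y =
      barrier k x y * (k * (1 - k * y) * barrierRate k x y
        + y * (2 - 3 * k ^ 2 + (2 * k - 6 * k ^ 3) * y - k ^ 2 * y ^ 2))
      + 4 * y ^ 2 * (1 - 3 * k ^ 2) * (1 + 2 * k * y) := by
  simp only [barrier, barrierDeriv, barrierRate, phaseField]
  ring

lemma one_sub_pos_of_barrier_nonneg {k x y : ℝ} (hk : 0 < k) (hx : x < 0) (hy : 0 < y)
    (h : 0 ≤ barrier k x y) : 0 < 1 - k * y := by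
  have h1 : 0 < 2 * y * (1 + k * y) := by positivity
  have h2 : 0 < (-k * x) * (1 - k * y) := by
    unfold barrier at h
    linarith
  exact (mul_pos_iff_of_pos_left (by nlinarith)).1 h2

lemma barrierRate_mul_le_barrierDeriv {k x y : ℝ} (hk : 0 < k) (hk2 : k ^ 2 < 1 / 3)
    (hy : 0 ≤ y) (hky : 0 < 1 - k * y) (h : 0 ≤ barrier k x y) :
    barrierRate k x y * barrier k x y ≤ barrierDeriv k x y := by
  have hcoef : 0 ≤ 2 - 3 * k ^ 2 + (2 * k - 6 * k ^ 3) * y - k ^ 2 * y ^ 2 := by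
    have h1 : 0 ≤ k * y := by positivity
    have h2 : 0 ≤ (1 - 3 * k ^ 2) * (k * y) := mul_nonneg (by linarith) h1
    nlinarith
  have h3 : 0 ≤ 4 * y ^ 2 * (1 - 3 * k ^ 2) * (1 + 2 * k * y) :=
    mul_nonneg (mul_nonneg (by positivity) (by linarith)) (by positivity)
  have h4 := mul_nonneg h (mul_nonneg hy hcoef)
  have hpos : 0 < k * (1 - k * y) := mul_pos hk hky
  refine le_of_mul_le_mul_left ?_ hpos
  rw [mul_barrierDeriv]
  linarith

lemma phasePlane.hasDerivAt_barrier (h : phasePlane k (Set.Iio b) ψ θ) {s : ℝ} (hs : s < b) :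
    HasDerivAt (fun s => barrier k (ψ s) (θ s)) (barrierDeriv k (ψ s) (θ s)) s := by
  obtain ⟨h1, h2⟩ := h s hs
  refine (((h1.const_mul (-k)).mul ((h2.const_mul k).const_sub 1)).sub
    ((h2.const_mul 2).mul ((h2.const_mul k).const_add 1))).congr_deriv ?_
  simp only [barrierDeriv, phaseField]
  ring

namespace IsInteriorSolution

lemma continuousOn (h : IsInteriorSolution k b ψ θ) :
    ContinuousOn ψ (Set.Iio b) ∧ ContinuousOn θ (Set.Iio b) :=
  ⟨fun s hs => (h.sol s hs).1.continuousAt.continuousWithinAt,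
    fun s hs => (h.sol s hs).2.continuousAt.continuousWithinAt⟩

lemma eventually_neg (h : IsInteriorSolution k b ψ θ) : ∀ᶠ s in atBot, ψ s < 0 := by
  filter_upwards [h.normalized.eventually (gt_mem_nhds (show (-1 : ℝ) < 0 by norm_num))] with s hs
  exact neg_of_mul_neg_left hs (Real.exp_pos _).le

lemma ψ_neg (h : IsInteriorSolution k b ψ θ) : ∀ s < b, ψ s < 0 := by
  obtain ⟨t, ht, htb⟩ := (h.eventually_neg.and (eventually_lt_atBot b)).exists
  obtain ⟨hψ, hθ⟩ := h.continuousOn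
  exact neg_of_hasDerivAt_mul_self (fun s hs => (h.sol s hs).1) (by fun_prop) htb ht

lemma θ_pos (h : IsInteriorSolution k b ψ θ) (hk : 0 < k) (hk1 : k ≤ 1) :
    ∀ s < b, 0 < θ s := by
  refine pos_of_barrier (fun s hs => (h.sol s hs).2) h.tendsto_θ ?_ ?_
  · filter_upwards [h.eventually_neg, h.eventually_abs_add_le hk.le hk1
      (show 0 < k / 4 by positivity) (by linarith)] with s h1 h2 h3
    rw [abs_of_neg h1, abs_le] at h2
    nlinarith [mul_neg_of_pos_of_neg hk h1]
  · intro s hs h0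
    rw [h0]
    nlinarith [mul_neg_of_pos_of_neg hk (h.ψ_neg s hs)]

lemma barrier_pos (h : IsInteriorSolution k b ψ θ) (hk : 0 < k) (hk1 : k ≤ 1)
    (hk2 : k ^ 2 < 1 / 3) : ∀ s < b, 0 < barrier k (ψ s) (θ s) := by
  have hS : ∀ s < b, 0 < 4 * θ s ^ 2 * (1 - 3 * k ^ 2) * (1 + 2 * k * θ s) := by
    intro s hs
    have := h.θ_pos hk hk1 s hs
    exact mul_pos (mul_pos (by positivity) (by linarith)) (by positivity)
  have lim : ∀ {F : ℝ × ℝ → ℝ}, Continuous F →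
      Tendsto (fun s => F (ψ s, θ s)) atBot (𝓝 (F (0, 0))) := fun hF =>
    (hF.tendsto _).comp (h.tendsto_ψ.prodMk_nhds h.tendsto_θ)
  refine pos_of_barrier (fun s hs => h.sol.hasDerivAt_barrier hs) ?_ ?_ ?_
  · have := lim (F := fun x => barrier k x.1 x.2) (by unfold barrier; fun_prop)
    simpa [barrier] using this
  · have h1 := lim (F := fun x => k * (1 - k * x.2) * barrierRate k x.1 x.2
        + x.2 * (2 - 3 * k ^ 2 + (2 * k - 6 * k ^ 3) * x.2 - k ^ 2 * x.2 ^ 2))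
      (by unfold barrierRate; fun_prop)
    have h2 := lim (F := fun x => 1 - k * x.2) (by fun_prop)
    filter_upwards [eventually_lt_atBot b,
      h1.eventually_lt_const (u := 0) (by simpa [barrierRate] using hk),
      h2.eventually_const_lt (u := 0) (by simp)] with s hs h3 h4 h5
    refine (mul_pos_iff_of_pos_left (mul_pos hk h4)).1 ?_
    rw [mul_barrierDeriv]
    have := mul_nonneg_of_nonpos_of_nonpos h5 h3.le
    linarith [hS s hs]
  · intro s hs h0
    have h4 := one_sub_pos_of_barrier_nonneg hk (h.ψ_neg s hs) (h.θ_pos hk hk1 s hs) h0.ge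
    refine (mul_pos_iff_of_pos_left (mul_pos hk h4)).1 ?_
    rw [mul_barrierDeriv, h0]
    linarith [hS s hs]

lemma one_sub_pos (h : IsInteriorSolution k b ψ θ) (hk : 0 < k) (hk1 : k ≤ 1)
    (hk2 : k ^ 2 < 1 / 3) {s : ℝ} (hs : s < b) : 0 < 1 - k * θ s :=
  one_sub_pos_of_barrier_nonneg hk (h.ψ_neg s hs) (h.θ_pos hk hk1 s hs)
    (h.barrier_pos hk hk1 hk2 s hs).le

lemma antitoneOn (h : IsInteriorSolution k b ψ θ) (hk2 : k ^ 2 ≤ 1) :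
    AntitoneOn ψ (Set.Iio b) := by
  refine antitoneOn_of_forall_hasDerivAt_nonpos (convex_Iio b) (fun s hs => (h.sol s hs).1) ?_
  intro s hs
  have := h.ψ_neg s hs
  exact mul_nonpos_of_nonpos_of_nonneg this.le
    (add_nonneg (sq_nonneg _) (mul_nonneg (by linarith) (by linarith)))

lemma hasDerivAt_neg_inv (h : IsInteriorSolution k b ψ θ) {s : ℝ} (hs : s < b) :
    HasDerivAt (fun s => -(ψ s)⁻¹)
      (-(1 - k ^ 2) + (ψ s)⁻¹ * ((θ s + k) ^ 2 + (1 - k ^ 2))) s := by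
  have h0 := (h.ψ_neg s hs).ne
  refine ((h.sol s hs).1.inv h0).neg.congr_deriv ?_
  field_simp
  ring

/-- Interior solutions blow up in finite time. -/
lemma le_add_inv (h : IsInteriorSolution k b ψ θ) (hk2 : k ^ 2 < 1) {s : ℝ} (hs : s < b) :
    b ≤ s + (1 - k ^ 2)⁻¹ * (-(ψ s)⁻¹) := by
  have hc : 0 < 1 - k ^ 2 := by linarith
  have hanti : AntitoneOn (fun s => -(ψ s)⁻¹ + (1 - k ^ 2) * s) (Set.Iio b) := by
    refine antitoneOn_of_forall_hasDerivAt_nonpos (convex_Iio b)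
      (fun s hs => (h.hasDerivAt_neg_inv hs).add ((hasDerivAt_id s).const_mul (1 - k ^ 2))) ?_
    intro s hs
    have := mul_nonpos_of_nonpos_of_nonneg (inv_lt_zero.2 (h.ψ_neg s hs)).le
      (add_nonneg (sq_nonneg (θ s + k)) hc.le)
    linarith
  refine le_of_forall_lt fun t ht => ?_
  rcases le_or_gt t s with hts | hts
  · have := mul_pos (inv_pos.2 hc) (neg_pos.2 (inv_lt_zero.2 (h.ψ_neg s hs)))
    linarith
  · have h1 := hanti hs ht hts.le
    simp only at h1
    have h2 := inv_lt_zero.2 (h.ψ_neg t ht)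
    have h3 : t - s < (1 - k ^ 2)⁻¹ * (-(ψ s)⁻¹) := by
      rw [lt_inv_mul_iff₀ hc]
      linarith
    linarith

end IsInteriorSolution

end Barrier

section MaximalSolution

variable {k b : ℝ} {ψ θ : ℝ → ℝ}

namespace IsInteriorSolution

lemma θ_lt (h : IsInteriorSolution k b ψ θ) (hk : 0 < k) (hk1 : k ≤ 1)
    (hk2 : k ^ 2 < 1 / 3) {s : ℝ} (hs : s < b) : θ s < 1 / k := by
  rw [lt_div_iff₀ hk]
  linarith [h.one_sub_pos hk hk1 hk2 hs]

lemma exists_bound (h : IsInteriorSolution k b ψ θ) (hk : 0 < k) (hk1 : k ≤ 1)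
    (hk2 : k ^ 2 < 1 / 3) {s₀ : ℝ} (hs₀ : s₀ < b) :
    ∃ M, ∀ s ≤ s₀, |ψ s| ≤ M ∧ |θ s| ≤ M := by
  refine ⟨max (-ψ s₀) (1 / k), fun s hs => ⟨?_, ?_⟩⟩
  · rw [abs_of_neg (h.ψ_neg s (hs.trans_lt hs₀))]
    exact le_max_of_le_left
      (neg_le_neg (h.antitoneOn (by linarith) (hs.trans_lt hs₀) hs₀ hs))
  · rw [abs_of_pos (h.θ_pos hk hk1 s (hs.trans_lt hs₀))]
    exact le_max_of_le_right (h.θ_lt hk hk1 hk2 (hs.trans_lt hs₀)).le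

lemma contDiffOn (h : IsInteriorSolution k b ψ θ) :
    ContDiffOn ℝ (⊤ : ℕ∞) ψ (Set.Iio b) ∧ ContDiffOn ℝ (⊤ : ℕ∞) θ (Set.Iio b) := by
  suffices H : ∀ n : ℕ, ContDiffOn ℝ n ψ (Set.Iio b) ∧ ContDiffOn ℝ n θ (Set.Iio b) from
    ⟨contDiffOn_infty.2 fun n => (H n).1, contDiffOn_infty.2 fun n => (H n).2⟩
  intro n
  induction n with
  | zero => exact ⟨contDiffOn_zero.2 h.continuousOn.1, contDiffOn_zero.2 h.continuousOn.2⟩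
  | succ n ih =>
    obtain ⟨hψ, hθ⟩ := ih
    push_cast
    constructor
    · refine (contDiffOn_succ_iff_deriv_of_isOpen isOpen_Iio).2
        ⟨fun s hs => (h.sol s hs).1.differentiableAt.differentiableWithinAt, by simp, ?_⟩
      exact ContDiffOn.congr (by fun_prop) fun s hs => (h.sol s hs).1.deriv
    · refine (contDiffOn_succ_iff_deriv_of_isOpen isOpen_Iio).2
        ⟨fun s hs => (h.sol s hs).2.differentiableAt.differentiableWithinAt, by simp, ?_⟩
      exact ContDiffOn.congr (by fun_prop) fun s hs => (h.sol s hs).2.deriv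

/-- An interior solution whose first component is bounded below extends beyond its endpoint. -/
lemma exists_extension (h : IsInteriorSolution k b ψ θ) (hk : 0 < k) (hk1 : k ≤ 1)
    (hk2 : k ^ 2 < 1 / 3) {M : ℝ} (hM : ∀ s < b, -M ≤ ψ s) :
    ∃ b' > b, ∃ ψ' θ' : ℝ → ℝ, IsInteriorSolution k b' ψ' θ' := by
  have hmem : ∀ᶠ s in 𝓝[<] b, (ψ s, θ s) ∈ Set.Icc ((-M, 0) : ℝ × ℝ) (0, 1 / k) := by
    filter_upwards [self_mem_nhdsWithin] with s hs
    exact ⟨⟨hM s hs, (h.θ_pos hk hk1 s hs).le⟩,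
      ⟨(h.ψ_neg s hs).le, (h.θ_lt hk hk1 hk2 hs).le⟩⟩
  obtain ⟨x₀, -, hx₀⟩ := isCompact_Icc.exists_mapClusterPt (tendsto_principal.2 hmem)
  obtain ⟨r, hr, ε, hε, H⟩ := (contDiff_phaseField k).contDiffAt (x := x₀)
    |>.exists_forall_mem_closedBall_exists_eq_forall_mem_Ioo_hasDerivAt 0
  obtain ⟨t, htball, ht⟩ := ((hx₀.frequently (Metric.closedBall_mem_nhds x₀ hr)).and_eventually
    (Ioo_mem_nhdsLT (sub_lt_self b hε))).exists
  obtain ⟨α, hα0, hα⟩ := H _ htball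
  have hβ : phasePlane k (Set.Ioo (t - ε) (t + ε)) (fun s => (α (s - t)).1)
      (fun s => (α (s - t)).2) := by
    intro s hs
    have h1 := (hα (s - t) ⟨by linarith [hs.1], by linarith [hs.2]⟩).comp_sub_const s t
    exact ⟨h1.fst, h1.snd⟩
  have hbt : b < t + ε := by linarith [ht.1]
  have heq : ∀ s ∈ Set.Ioo (t - ε) b, ψ s = (α (s - t)).1 ∧ θ s = (α (s - t)).2 := by
    intro s hs
    refine (h.sol.mono fun u hu => hu.2).eqOn_Ioo
      (hβ.mono (Set.Ioo_subset_Ioo_right hbt.le)) ⟨by linarith, ht.2⟩ ?_ ?_ hs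
    · simp [hα0]
    · simp [hα0]
  classical
  have hψlt : Set.EqOn (fun s => if s < b then ψ s else (α (s - t)).1) ψ (Set.Iio b) :=
    fun s hs => if_pos hs
  have hθlt : Set.EqOn (fun s => if s < b then θ s else (α (s - t)).2) θ (Set.Iio b) :=
    fun s hs => if_pos hs
  have h1 := h.sol.congr isOpen_Iio hψlt hθlt
  have h2 : phasePlane k (Set.Ioo (t - ε) (t + ε))
      (fun s => if s < b then ψ s else (α (s - t)).1)
      (fun s => if s < b then θ s else (α (s - t)).2) := by
    refine hβ.congr isOpen_Ioo ?_ ?_ <;> intro s hs <;> dsimp only <;> split_ifs with hsb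
    · exact (heq s ⟨hs.1, hsb⟩).1
    · rfl
    · exact (heq s ⟨hs.1, hsb⟩).2
    · rfl
  have hψev := hψlt.eventuallyEq_of_mem (Iio_mem_atBot b)
  refine ⟨t + ε, hbt, _, _, ⟨fun s hs => ?_, h.tendsto_ψ.congr' hψev.symm,
    h.tendsto_θ.congr' (hθlt.eventuallyEq_of_mem (Iio_mem_atBot b)).symm,
    h.normalized.congr' ?_⟩⟩
  · rcases lt_or_ge s b with hsb | hsb
    · exact h1 s hsb
    · exact h2 s ⟨by linarith [ht.2], hs⟩
  · filter_upwards [hψev] with s hs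
    rw [hs]

end IsInteriorSolution

/-- The maximal interior solution; its first component tends to `-∞` at the right endpoint. -/
lemma exists_maximal_isInteriorSolution (hk : 0 < k) (hk1 : k ≤ 1) (hk2 : k ^ 2 < 1 / 3) :
    ∃ (b : ℝ) (ψ θ : ℝ → ℝ), IsInteriorSolution k b ψ θ ∧ Tendsto ψ (𝓝[<] b) atBot := by
  obtain ⟨b₀, ψ₀, θ₀, h₀, -⟩ := exists_isInteriorSolution k
  set B : Set ℝ := {b | ∃ ψ θ : ℝ → ℝ, IsInteriorSolution k b ψ θ} with hB
  have hne : B.Nonempty := ⟨b₀, ψ₀, θ₀, h₀⟩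
  have hlt : b₀ - 1 < b₀ := sub_one_lt b₀
  have hbdd : BddAbove B := by
    refine ⟨b₀ - 1 + (1 - k ^ 2)⁻¹ * (-(ψ₀ (b₀ - 1))⁻¹), ?_⟩
    rintro b ⟨ψ, θ, h⟩
    rcases le_or_gt b (b₀ - 1) with hb | hb
    · have hc : 0 < 1 - k ^ 2 := by linarith
      have := mul_pos (inv_pos.2 hc) (neg_pos.2 (inv_lt_zero.2 (h₀.ψ_neg _ hlt)))
      linarith
    · rw [← (h.unique h₀ hk.le hk1 hb hlt).1]
      exact h.le_add_inv (by linarith) hb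
  have hq : ∀ s, ∃ q : ℝ × ℝ, s < sSup B → ∃ (b : ℝ) (ψ θ : ℝ → ℝ),
      IsInteriorSolution k b ψ θ ∧ s < b ∧ (ψ s, θ s) = q := by
    intro s
    by_cases hs : s < sSup B
    · obtain ⟨b, ⟨ψ, θ, h⟩, hsb⟩ := exists_lt_of_lt_csSup hne hs
      exact ⟨(ψ s, θ s), fun _ => ⟨b, ψ, θ, h, hsb, rfl⟩⟩
    · exact ⟨0, fun h => absurd h hs⟩
  choose q hq using hq
  have heq : ∀ {b : ℝ} {ψ θ : ℝ → ℝ}, IsInteriorSolution k b ψ θ →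
      Set.EqOn (fun s => (q s).1) ψ (Set.Iio b) ∧ Set.EqOn (fun s => (q s).2) θ (Set.Iio b) := by
    intro b ψ θ h
    have : ∀ s < b, (q s).1 = ψ s ∧ (q s).2 = θ s := by
      intro s hs
      obtain ⟨b', ψ', θ', h', hsb', hq'⟩ := hq s (hs.trans_le (le_csSup hbdd ⟨ψ, θ, h⟩))
      rw [← hq']
      exact h'.unique h hk.le hk1 hsb' hs
    exact ⟨fun s hs => (this s hs).1, fun s hs => (this s hs).2⟩
  have hsol : IsInteriorSolution k (sSup B) (fun s => (q s).1) (fun s => (q s).2) := by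
    have hψev := (heq h₀).1.eventuallyEq_of_mem (Iio_mem_atBot b₀)
    refine ⟨fun s hs => ?_, h₀.tendsto_ψ.congr' hψev.symm,
      h₀.tendsto_θ.congr' ((heq h₀).2.eventuallyEq_of_mem (Iio_mem_atBot b₀)).symm,
      h₀.normalized.congr' ?_⟩
    · obtain ⟨b, ⟨ψ, θ, h⟩, hsb⟩ := exists_lt_of_lt_csSup hne hs
      exact h.sol.congr isOpen_Iio (heq h).1 (heq h).2 s hsb
    · filter_upwards [hψev] with s hs
      rw [hs]
  refine ⟨sSup B, _, _, hsol, tendsto_atBot.2 fun M => ?_⟩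
  obtain ⟨s, hs, hsM⟩ : ∃ s < sSup B, (q s).1 < M := by
    by_contra! hcon
    obtain ⟨b', hb', hext⟩ := hsol.exists_extension hk hk1 hk2 (M := -M) (by simpa using hcon)
    exact absurd (le_csSup hbdd hext) (not_le.2 hb')
  filter_upwards [Ioo_mem_nhdsLT hs] with t ht
  exact (hsol.antitoneOn (by linarith) hs ht.2 ht.1.le).trans hsM.le

end MaximalSolution

section Endpoint

lemma hasDerivAt_sub_rpow {b s ρ : ℝ} (hs : s < b) :
    HasDerivAt (fun s => (b - s) ^ ρ) (-ρ * (b - s) ^ (ρ - 1)) s := by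
  refine (((hasDerivAt_id s).const_sub b).rpow_const
    (Or.inl (sub_pos.2 hs).ne')).congr_deriv ?_
  simp only [id]
  ring

lemma tendsto_sub_nhdsLT (b : ℝ) : Tendsto (fun s => b - s) (𝓝[<] b) (𝓝 0) := by
  have : Tendsto (fun s => b - s) (𝓝 b) (𝓝 (b - b)) := tendsto_id.const_sub b
  rw [sub_self] at this
  exact this.mono_left nhdsWithin_le_nhds

lemma tendsto_sub_rpow {b ρ : ℝ} (hρ : 0 < ρ) :
    Tendsto (fun s => (b - s) ^ ρ) (𝓝[<] b) (𝓝 0) := by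
  simpa [Real.zero_rpow hρ.ne'] using (tendsto_sub_nhdsLT b).rpow_const (p := ρ) (Or.inr hρ.le)

/-- A function whose derivative has an integrable power singularity at the right endpoint has a
limit there, with the corresponding rate of convergence. -/
lemma exists_tendsto_of_abs_deriv_le_rpow {f f' : ℝ → ℝ} {a b E ρ : ℝ} (hab : a < b) (hρ : 0 < ρ)
    (hE : 0 ≤ E) (hd : ∀ s ∈ Set.Ioo a b, HasDerivAt f (f' s) s)
    (hf' : ∀ s ∈ Set.Ioo a b, |f' s| ≤ E * ρ * (b - s) ^ (ρ - 1)) :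
    ∃ L, Tendsto f (𝓝[<] b) (𝓝 L) ∧ ∀ s ∈ Set.Ioo a b, |f s - L| ≤ E * (b - s) ^ ρ := by
  have hu : AntitoneOn (fun s => f s + E * (b - s) ^ ρ) (Set.Ioo a b) := by
    refine antitoneOn_of_forall_hasDerivAt_nonpos (convex_Ioo a b)
      (fun s hs => (hd s hs).add ((hasDerivAt_sub_rpow hs.2).const_mul E)) fun s hs => ?_
    linarith [(abs_le.1 (hf' s hs)).2]
  have hv : MonotoneOn (fun s => f s - E * (b - s) ^ ρ) (Set.Ioo a b) := by
    refine monotoneOn_of_forall_hasDerivAt_nonneg (convex_Ioo a b)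
      (fun s hs => (hd s hs).sub ((hasDerivAt_sub_rpow hs.2).const_mul E)) fun s hs => ?_
    linarith [(abs_le.1 (hf' s hs)).1]
  have hvu : ∀ s ∈ Set.Ioo a b, f s - E * (b - s) ^ ρ ≤ f s + E * (b - s) ^ ρ := by
    intro s hs
    have := mul_nonneg hE (Real.rpow_nonneg (sub_pos.2 hs.2).le ρ)
    linarith
  obtain ⟨t, ht⟩ := exists_between hab
  have hbdd : BddAbove ((fun s => f s - E * (b - s) ^ ρ) '' Set.Ioo a b) := by
    refine ⟨f t + E * (b - t) ^ ρ, ?_⟩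
    rintro _ ⟨s, hs, rfl⟩
    rcases le_total s t with hst | hst
    · exact (hv hs ht hst).trans (hvu t ht)
    · exact (hvu s hs).trans (hu ht hs hst)
  have hlimv := hv.tendsto_nhdsWithin_Ioo_left ⟨t, ht⟩ hbdd
  set L := sSup ((fun s => f s - E * (b - s) ^ ρ) '' Set.Ioo a b)
  have hτ : Tendsto (fun s => E * (b - s) ^ ρ) (𝓝[<] b) (𝓝 0) := by
    simpa using (tendsto_sub_rpow (b := b) hρ).const_mul E
  have hlim : Tendsto f (𝓝[<] b) (𝓝 L) := by
    simpa using hlimv.add hτ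
  refine ⟨L, hlim, fun s hs => abs_le.2 ⟨?_, ?_⟩⟩
  · have h1 : AntitoneOn (fun s => f s + E * (b - s) ^ ρ - L) (Set.Ioo a b) :=
      fun x hx y hy hxy => sub_le_sub_right (hu hx hy hxy) L
    have := h1.nonneg_of_tendsto_nhdsLT (by simpa using (hlim.add hτ).sub_const L) hs
    linarith
  · have h1 : MonotoneOn (fun s => f s - E * (b - s) ^ ρ - L) (Set.Ioo a b) :=
      fun x hx y hy hxy => sub_le_sub_right (hv hx hy hxy) L
    have := h1.nonpos_of_tendsto_nhdsLT (by simpa using (hlim.sub hτ).sub_const L) hs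
    linarith

variable {k b : ℝ} {ψ θ : ℝ → ℝ}

namespace IsInteriorSolution

lemma neg_inv_pos (h : IsInteriorSolution k b ψ θ) {s : ℝ} (hs : s < b) : 0 < -(ψ s)⁻¹ :=
  neg_pos.2 (inv_lt_zero.2 (h.ψ_neg s hs))

lemma mul_sub_le_neg_inv (h : IsInteriorSolution k b ψ θ) (hk2 : k ^ 2 < 1) {s : ℝ}
    (hs : s < b) : (1 - k ^ 2) * (b - s) ≤ -(ψ s)⁻¹ := by
  have h1 := h.le_add_inv hk2 hs
  have hc : 0 < 1 - k ^ 2 := by linarith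
  rw [← le_inv_mul_iff₀ hc]
  linarith

lemma sq_add_le (h : IsInteriorSolution k b ψ θ) (hk : 0 < k) (hk1 : k ≤ 1)
    (hk2 : k ^ 2 < 1 / 3) {s : ℝ} (hs : s < b) : (θ s + k) ^ 2 ≤ (1 / k + k) ^ 2 := by
  have h1 := h.θ_pos hk hk1 s hs
  have h2 := h.θ_lt hk hk1 hk2 hs
  exact pow_le_pow_left₀ (by linarith) (by linarith) 2

/-- The expansion of `1 / ψ` at the blow-up time. -/
lemma exists_neg_inv_sub_le (h : IsInteriorSolution k b ψ θ) (hk : 0 < k) (hk1 : k ≤ 1)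
    (hk2 : k ^ 2 < 1 / 3) (hbl : Tendsto ψ (𝓝[<] b) atBot) :
    ∃ C, 0 ≤ C ∧ ∀ s ∈ Set.Ioo (b - 1) b,
      -(ψ s)⁻¹ - (1 - k ^ 2) * (b - s) ≤ C * (b - s) ^ 2 := by
  have hc : 0 < 1 - k ^ 2 := by linarith
  set K := (1 / k + k) ^ 2 + (1 - k ^ 2) with hK
  have hK0 : 0 ≤ K := by positivity
  have hy0 : Tendsto (fun s => -(ψ s)⁻¹) (𝓝[<] b) (𝓝 0) := by
    simpa using hbl.inv_tendsto_atBot.neg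
  have hderiv : ∀ s ∈ Set.Ioo (b - 1) b, ∀ Y, -(ψ s)⁻¹ ≤ Y →
      -(1 - k ^ 2) - Y * K ≤
        -(1 - k ^ 2) + (ψ s)⁻¹ * ((θ s + k) ^ 2 + (1 - k ^ 2)) := by
    intro s hs Y hY
    have h1 := h.sq_add_le hk hk1 hk2 hs.2
    have h2 := h.neg_inv_pos hs.2
    have h3 : -(ψ s)⁻¹ * ((θ s + k) ^ 2 + (1 - k ^ 2)) ≤ Y * K :=
      mul_le_mul hY (by linarith) (by positivity) (h2.le.trans hY)
    linarith
  have hb1 : b - 1 < b := sub_one_lt b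
  set Y := -(ψ (b - 1))⁻¹ with hY
  have hY0 : 0 < Y := h.neg_inv_pos hb1
  have hanti : ∀ s ∈ Set.Ioo (b - 1) b, -(ψ s)⁻¹ ≤ Y := by
    intro s hs
    have h1 := h.antitoneOn (by linarith) hb1 hs.2 hs.1.le
    exact neg_le_neg ((inv_le_inv_of_neg (h.ψ_neg _ hb1) (h.ψ_neg _ hs.2)).2 h1)
  set C₁ := 1 - k ^ 2 + Y * K with hC₁
  have hC₁0 : 0 ≤ C₁ := by positivity
  have hlin : ∀ s ∈ Set.Ioo (b - 1) b, -(ψ s)⁻¹ ≤ C₁ * (b - s) := by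
    intro s hs
    have hmono : MonotoneOn (fun s => -(ψ s)⁻¹ - C₁ * (b - s)) (Set.Ioo (b - 1) b) := by
      refine monotoneOn_of_forall_hasDerivAt_nonneg (convex_Ioo _ _)
        (fun s hs => (h.hasDerivAt_neg_inv hs.2).sub
          (((hasDerivAt_id s).const_sub b).const_mul C₁)) fun s hs => ?_
      linarith [hderiv s hs Y (hanti s hs)]
    have := hmono.nonpos_of_tendsto_nhdsLT
      (by simpa using hy0.sub ((tendsto_sub_nhdsLT b).const_mul C₁)) hs
    linarith
  refine ⟨C₁ * K / 2, by positivity, fun s hs => ?_⟩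
  have hmono : MonotoneOn
      (fun s => -(ψ s)⁻¹ - (1 - k ^ 2) * (b - s) - C₁ * K / 2 * (b - s) ^ 2)
      (Set.Ioo (b - 1) b) := by
    refine monotoneOn_of_forall_hasDerivAt_nonneg (convex_Ioo _ _)
      (fun s hs => ((h.hasDerivAt_neg_inv hs.2).sub
        (((hasDerivAt_id s).const_sub b).const_mul (1 - k ^ 2))).sub
          ((((hasDerivAt_id s).const_sub b).pow 2).const_mul (C₁ * K / 2))) fun s hs => ?_
    have := hderiv s hs _ (hlin s hs)
    simp only [id, Nat.cast_ofNat, Nat.add_one_sub_one, pow_one]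
    linarith
  have hlim := (hy0.sub ((tendsto_sub_nhdsLT b).const_mul (1 - k ^ 2))).sub
    (((tendsto_sub_nhdsLT b).pow 2).const_mul (C₁ * K / 2))
  have := hmono.nonpos_of_tendsto_nhdsLT (by simpa using hlim) hs
  linarith

lemma hasDerivAt_profile (h : IsInteriorSolution k b ψ θ) {β : ℝ}
    (hβ : β * (1 - k ^ 2) = k ^ 2) {s : ℝ} (hs : s < b) :
    HasDerivAt (fun s => (1 - k * θ s) * (-(ψ s)⁻¹) ^ (-β))
      ((-(k * θ s) * ((θ s + k) ^ 2 - (1 + k ^ 2))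
        + (1 - k * θ s) * β * ((θ s + k) ^ 2 + (1 - k ^ 2))) * (-(ψ s)⁻¹) ^ (-β)) s := by
  have hy := h.neg_inv_pos hs
  refine ((((h.sol s hs).2.const_mul k).const_sub 1).mul
    ((h.hasDerivAt_neg_inv hs).rpow_const (Or.inl hy.ne'))).congr_deriv ?_
  rw [Real.rpow_sub_one hy.ne']
  have hψ : (ψ s)⁻¹ * ψ s = 1 := inv_mul_cancel₀ (h.ψ_neg s hs).ne
  rw [div_eq_mul_inv, inv_neg, inv_inv]
  linear_combination (-(1 - k * θ s) * (-(ψ s)⁻¹) ^ (-β) * ψ s) * hβ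
    + (1 - k * θ s) * β * ((θ s + k) ^ 2 + (1 - k ^ 2)) * (-(ψ s)⁻¹) ^ (-β) * hψ

/-- The profile `(1 - kθ) (-1/ψ)^(-β)` has a limit at the blow-up time. -/
lemma exists_tendsto_profile (h : IsInteriorSolution k b ψ θ) (hk : 0 < k) (hk1 : k ≤ 1)
    (hk2 : k ^ 2 < 1 / 3) {β : ℝ} (hβ : β * (1 - k ^ 2) = k ^ 2) (hβ0 : 0 < β) (hβ1 : β < 1) :
    ∃ E L, 0 ≤ E ∧
      Tendsto (fun s => (1 - k * θ s) * (-(ψ s)⁻¹) ^ (-β)) (𝓝[<] b) (𝓝 L) ∧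
      ∀ s ∈ Set.Ioo (b - 1) b,
        |(1 - k * θ s) * (-(ψ s)⁻¹) ^ (-β) - L| ≤ E * (b - s) ^ (1 - β) := by
  have hc : 0 < 1 - k ^ 2 := by linarith
  set K := (1 / k + k) ^ 2 + 2 with hK
  have hK0 : 0 ≤ K := by positivity
  have hρ : 0 < 1 - β := by linarith
  set E := 2 * K * (1 - k ^ 2) ^ (-β) / (1 - β) with hE
  have hEρ : E * (1 - β) = 2 * K * (1 - k ^ 2) ^ (-β) := div_mul_cancel₀ _ hρ.ne'
  have hE0 : 0 ≤ E := div_nonneg (by positivity) hρ.le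
  suffices H : _ by
    obtain ⟨L, h1, h2⟩ := exists_tendsto_of_abs_deriv_le_rpow (sub_one_lt b) hρ hE0
      (fun s hs => h.hasDerivAt_profile hβ hs.2) H
    exact ⟨E, L, hE0, h1, h2⟩
  intro s hs
  have hy := h.neg_inv_pos hs.2
  have hτ : 0 < b - s := sub_pos.2 hs.2
  have hw := h.one_sub_pos hk hk1 hk2 hs.2
  have hθ := mul_pos hk (h.θ_pos hk hk1 s hs.2)
  have hA := h.sq_add_le hk hk1 hk2 hs.2
  have hA0 := sq_nonneg (θ s + k)
  have hkk := sq_nonneg k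
  rw [hEρ, abs_mul, abs_of_pos (Real.rpow_pos_of_pos hy _), mul_assoc (2 * K)]
  have e1 : |-(k * θ s) * ((θ s + k) ^ 2 - (1 + k ^ 2))| ≤ 1 * K := by
    rw [abs_mul, abs_neg, abs_of_pos hθ]
    exact mul_le_mul (by linarith) (abs_le.2 ⟨by linarith, by linarith⟩) (abs_nonneg _) zero_le_one
  have e2 : |(1 - k * θ s) * β * ((θ s + k) ^ 2 + (1 - k ^ 2))| ≤ 1 * 1 * K := by
    rw [abs_mul, abs_mul, abs_of_pos hw, abs_of_pos hβ0]
    exact mul_le_mul (mul_le_mul (by linarith) hβ1.le hβ0.le zero_le_one)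
      (abs_le.2 ⟨by linarith, by linarith⟩) (abs_nonneg _) (by norm_num)
  refine mul_le_mul ((abs_add_le _ _).trans (by linarith)) ?_ (Real.rpow_nonneg hy.le _)
    (by positivity)
  rw [show 1 - β - 1 = -β by ring, ← Real.mul_rpow hc.le hτ.le]
  exact Real.rpow_le_rpow_of_nonpos (mul_pos hc hτ)
    (h.mul_sub_le_neg_inv (by linarith) hs.2) (by linarith)

lemma exists_pos_le_profile (h : IsInteriorSolution k b ψ θ) (hk : 0 < k) (hk1 : k ≤ 1)
    (hk2 : k ^ 2 < 1 / 3) {β : ℝ} (hβ : β * (1 - k ^ 2) = k ^ 2) (hβ0 : 0 < β) (hβ1 : β < 1) :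
    ∃ c > 0, ∀ s ∈ Set.Ioo (b - 1) b, c ≤ (1 - k * θ s) * (-(ψ s)⁻¹) ^ (-β) := by
  have hc : 0 < 1 - k ^ 2 := by linarith
  set K := (1 / k + k) ^ 2 + (1 - k ^ 2) + 3 with hK
  have hK0 : 0 ≤ K := by positivity
  set B : ℝ → ℝ := fun s => barrier k (ψ s) (θ s) * (-(ψ s)⁻¹) ^ (1 - β) with hB
  have hBpos : ∀ s < b, 0 < B s := fun s hs =>
    mul_pos (h.barrier_pos hk hk1 hk2 s hs) (Real.rpow_pos_of_pos (h.neg_inv_pos hs) _)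
  have hmono : MonotoneOn (fun s => B s * Real.exp (K * s)) (Set.Iio b) := by
    refine monotoneOn_of_forall_hasDerivAt_nonneg (convex_Iio b)
      (fun s hs => ((h.sol.hasDerivAt_barrier hs).mul ((h.hasDerivAt_neg_inv hs).rpow_const
        (Or.inl (h.neg_inv_pos hs).ne'))).mul ((hasDerivAt_id s).const_mul K).exp) fun s hs => ?_
    have hs' : s < b := hs
    have hy := h.neg_inv_pos hs'
    have hP := h.barrier_pos hk hk1 hk2 s hs'
    have hw := h.one_sub_pos hk hk1 hk2 hs'
    have hθ := h.θ_pos hk hk1 s hs'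
    have hP' := barrierRate_mul_le_barrierDeriv hk hk2 hθ.le hw hP.le
    have hA := h.sq_add_le hk hk1 hk2 hs'
    have hA0 := sq_nonneg (θ s + k)
    have hψ : (ψ s)⁻¹ * ψ s = 1 := inv_mul_cancel₀ (h.ψ_neg s hs).ne
    set Y := (-(ψ s)⁻¹) ^ (1 - β) with hYdef
    have hY : 0 < Y := Real.rpow_pos_of_pos hy _
    have hrate : 0 ≤ barrierRate k (ψ s) (θ s) + K
        - (1 - β) * (-(1 - k ^ 2) + (ψ s)⁻¹ * ((θ s + k) ^ 2 + (1 - k ^ 2))) * ψ s := by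
      have e : barrierRate k (ψ s) (θ s) + K
          - (1 - β) * (-(1 - k ^ 2) + (ψ s)⁻¹ * ((θ s + k) ^ 2 + (1 - k ^ 2))) * ψ s
          = θ s ^ 2 + 2 * (1 - k * θ s) + ((1 / k + k) ^ 2 - (θ s + k) ^ 2)
            + β * ((θ s + k) ^ 2 + (1 - k ^ 2)) := by
        simp only [barrierRate, hK]
        linear_combination (-ψ s) * hβ - (1 - β) * ((θ s + k) ^ 2 + (1 - k ^ 2)) * hψ
      rw [e]
      have := mul_nonneg hβ0.le (add_nonneg hA0 hc.le)
      nlinarith [sq_nonneg (θ s)]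
    have hexp := Real.exp_pos (K * s)
    rw [Real.rpow_sub_one hy.ne', ← hYdef, div_eq_mul_inv, inv_neg, inv_inv]
    have h3 := mul_nonneg (mul_nonneg (mul_nonneg hP.le hY.le) hexp.le) hrate
    have h4 := mul_nonneg (mul_nonneg (sub_nonneg.2 hP') hY.le) hexp.le
    simp only [Pi.mul_apply, id, mul_one]
    linarith
  have hb1 : b - 1 < b := sub_one_lt b
  refine ⟨B (b - 1) * Real.exp (-K) / k, div_pos (mul_pos (hBpos _ hb1) (Real.exp_pos _)) hk, ?_⟩
  intro s hs
  have hy := h.neg_inv_pos hs.2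
  have h1 : B (b - 1) * Real.exp (K * (b - 1)) ≤ B s * Real.exp (K * s) :=
    hmono hb1 hs.2 hs.1.le
  have h2 : B (b - 1) * Real.exp (-K) ≤ B s := by
    have h3 : B s * Real.exp (K * s) ≤ B s * Real.exp (K * b) :=
      mul_le_mul_of_nonneg_left
        (Real.exp_le_exp.2 (mul_le_mul_of_nonneg_left hs.2.le hK0)) (hBpos s hs.2).le
    have h4 := mul_le_mul_of_nonneg_right (h1.trans h3) (Real.exp_pos (-(K * b))).le
    rwa [mul_assoc, mul_assoc (B s), ← Real.exp_add, ← Real.exp_add, add_neg_cancel, Real.exp_zero,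
      mul_one, show K * (b - 1) + -(K * b) = -K by ring] at h4
  rw [div_le_iff₀ hk]
  refine h2.trans ?_
  have hθ := h.θ_pos hk hk1 s hs.2
  have h5 : barrier k (ψ s) (θ s) ≤ -k * ψ s * (1 - k * θ s) := by
    have : 0 ≤ 2 * θ s * (1 + k * θ s) := by positivity
    unfold barrier
    linarith
  have h6 := mul_le_mul_of_nonneg_right h5 (Real.rpow_nonneg hy.le (1 - β))
  refine h6.trans_eq ?_
  rw [show 1 - β = -β + 1 by ring, Real.rpow_add_one hy.ne']
  have hψ : (ψ s)⁻¹ * ψ s = 1 := inv_mul_cancel₀ (h.ψ_neg s hs.2).ne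
  linear_combination k * (1 - k * θ s) * (-(ψ s)⁻¹) ^ (-β) * hψ

/-- The behaviour of `θ` at the blow-up time. -/
lemma exists_expansion (h : IsInteriorSolution k b ψ θ) (hk : 0 < k) (hk1 : k ≤ 1)
    (hk2 : k ^ 2 < 1 / 3) (hbl : Tendsto ψ (𝓝[<] b) atBot) :
    Tendsto θ (𝓝[<] b) (𝓝 (1 / k)) ∧ ∃ L > 0,
      (fun s => 1 - k * θ s - L * ((1 - k ^ 2) * (b - s)) ^ (k ^ 2 / (1 - k ^ 2)))
        =O[𝓝[<] b] (fun s => (b - s) ^ (2 * (k ^ 2 / (1 - k ^ 2)))) := by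
  have hc : 0 < 1 - k ^ 2 := by linarith
  set β := k ^ 2 / (1 - k ^ 2) with hβdef
  have hβ : β * (1 - k ^ 2) = k ^ 2 := div_mul_cancel₀ _ hc.ne'
  have hβ0 : 0 < β := by positivity
  have hβ2 : 2 * β < 1 := by
    rw [hβdef, ← mul_div_assoc, div_lt_one hc]
    linarith
  have hβ1 : β < 1 := by linarith
  obtain ⟨C, hC0, hC⟩ := h.exists_neg_inv_sub_le hk hk1 hk2 hbl
  obtain ⟨E, L, hE0, hL, hE⟩ := h.exists_tendsto_profile hk hk1 hk2 hβ hβ0 hβ1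
  obtain ⟨c, hc0, hcL⟩ := h.exists_pos_le_profile hk hk1 hk2 hβ hβ0 hβ1
  have hnear : Set.Ioo (b - 1) b ∈ 𝓝[<] b := Ioo_mem_nhdsLT (sub_one_lt b)
  have hLpos : 0 < L := hc0.trans_le (ge_of_tendsto hL (by filter_upwards [hnear] using hcL))
  have hw : ∀ s < b, 1 - k * θ s = (1 - k * θ s) * (-(ψ s)⁻¹) ^ (-β) * (-(ψ s)⁻¹) ^ β := by
    intro s hs
    rw [mul_assoc, ← Real.rpow_add (h.neg_inv_pos hs), neg_add_cancel, Real.rpow_zero, mul_one]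
  refine ⟨?_, L, hLpos, ?_⟩
  · have hy0 : Tendsto (fun s => -(ψ s)⁻¹) (𝓝[<] b) (𝓝 0) := by
      simpa using hbl.inv_tendsto_atBot.neg
    have h1 : Tendsto (fun s => 1 - k * θ s) (𝓝[<] b) (𝓝 0) := by
      have := hL.mul (hy0.rpow_const (p := β) (Or.inr hβ0.le))
      rw [Real.zero_rpow hβ0.ne', mul_zero] at this
      refine this.congr' ?_
      filter_upwards [self_mem_nhdsWithin] with s hs using (hw s hs).symm
    have h2 := (h1.const_sub 1).div_const k
    rw [sub_zero] at h2
    refine h2.congr fun s => ?_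
    field_simp
    ring
  · refine IsBigO.of_bound (E * (1 - k ^ 2 + C) ^ β + L * C ^ β) ?_
    filter_upwards [hnear] with s hs
    have hτ : 0 < b - s := sub_pos.2 hs.2
    have hτ1 : b - s ≤ 1 := by linarith [hs.1]
    have hy := h.neg_inv_pos hs.2
    have hm : 0 < (1 - k ^ 2) * (b - s) := mul_pos hc hτ
    have hmy := h.mul_sub_le_neg_inv (by linarith) hs.2
    have hyC : -(ψ s)⁻¹ ≤ (1 - k ^ 2 + C) * (b - s) := by
      have h1 := hC s hs
      have h2 : C * (b - s) ^ 2 ≤ C * (b - s) := by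
        rw [sq]
        exact mul_le_mul_of_nonneg_left (mul_le_of_le_one_left hτ.le hτ1) hC0
      linarith
    have e1 : (-(ψ s)⁻¹) ^ β ≤ (1 - k ^ 2 + C) ^ β * (b - s) ^ β := by
      rw [← Real.mul_rpow (by positivity) hτ.le]
      exact Real.rpow_le_rpow hy.le hyC hβ0.le
    have e2 : (-(ψ s)⁻¹) ^ β - ((1 - k ^ 2) * (b - s)) ^ β ≤ C ^ β * (b - s) ^ (2 * β) := by
      have h1 := Real.rpow_add_le_add_rpow (sub_nonneg.2 hmy) hm.le hβ0.le hβ1.le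
      rw [sub_add_cancel] at h1
      have h2 := Real.rpow_le_rpow (sub_nonneg.2 hmy) (hC s hs) hβ0.le
      rw [Real.mul_rpow hC0 (by positivity), ← Real.rpow_natCast_mul hτ.le] at h2
      push_cast at h2
      linarith
    have e3 : ((1 - k ^ 2) * (b - s)) ^ β ≤ (-(ψ s)⁻¹) ^ β :=
      Real.rpow_le_rpow hm.le hmy hβ0.le
    have e4 : (b - s) ^ (1 - β) * (b - s) ^ β ≤ (b - s) ^ (2 * β) := by
      rw [← Real.rpow_add hτ]
      exact Real.rpow_le_rpow_of_exponent_ge hτ hτ1 (by linarith)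
    rw [Real.norm_eq_abs, Real.norm_eq_abs, abs_of_pos (Real.rpow_pos_of_pos hτ _)]
    have e5 : 1 - k * θ s - L * ((1 - k ^ 2) * (b - s)) ^ β
        = ((1 - k * θ s) * (-(ψ s)⁻¹) ^ (-β) - L) * (-(ψ s)⁻¹) ^ β
          + L * ((-(ψ s)⁻¹) ^ β - ((1 - k ^ 2) * (b - s)) ^ β) := by
      linear_combination hw s hs.2
    rw [e5]
    refine (abs_add_le _ _).trans ?_
    rw [add_mul]
    refine add_le_add ?_ ?_
    · rw [abs_mul, abs_of_pos (Real.rpow_pos_of_pos hy _)]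
      refine (mul_le_mul (hE s hs) e1 (Real.rpow_nonneg hy.le _)
        (mul_nonneg hE0 (Real.rpow_nonneg hτ.le _))).trans ?_
      have := mul_le_mul_of_nonneg_left e4
        (mul_nonneg hE0 (Real.rpow_nonneg (by positivity : 0 ≤ 1 - k ^ 2 + C) β))
      linarith
    · rw [abs_of_nonneg (mul_nonneg hLpos.le (sub_nonneg.2 e3)), mul_assoc]
      exact mul_le_mul_of_nonneg_left e2 hLpos.le

end IsInteriorSolution

end Endpoint

/-- **Interior phase-plane solution** (Proposition A.3).  For `k > 0` with
`k² ∈ (0,1/3)` there exist `s* ∈ ℝ` and a solution `(ψ,θ)` of the Christodoulou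
phase-plane system on `(−∞,s*)` with: `ψ < 0 < θ`; `ψ → −∞` and `θ → 1/k` as
`s → s*⁻`; `ψ,θ` smooth and bounded on every `(−∞,s₀]` with `s₀ < s*`;
`ψ(s) = −e^s + O(e^{2s})`, `θ(s) = (k/2)e^s + O(e^{2s})` as `s → −∞`; expansions
(A.20)–(A.21) as `s → s*⁻` with `a₁ ≠ 0`; and the solution is the unique one with
`(ψ,θ) → (0,0)` and `ψe^{−s} → −1` as `s → −∞`. -/
theorem interior_phase_plane_solution
    (k : ℝ) (hk : 0 < k) (hk2 : k ^ 2 < 1 / 3) :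
    ∃ (sStar : ℝ) (ψ θ : ℝ → ℝ),
      phasePlane k (Set.Iio sStar) ψ θ ∧
      (∀ s < sStar, ψ s < 0 ∧ 0 < θ s) ∧
      Tendsto ψ (𝓝[<] sStar) atBot ∧
      Tendsto θ (𝓝[<] sStar) (𝓝 (1 / k)) ∧
      (∀ s₀ < sStar, ContDiffOn ℝ (⊤ : ℕ∞) ψ (Set.Iic s₀) ∧ ContDiffOn ℝ (⊤ : ℕ∞) θ (Set.Iic s₀) ∧
        ∃ M, ∀ s ≤ s₀, |ψ s| ≤ M ∧ |θ s| ≤ M) ∧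
      (fun s => ψ s + Real.exp s) =O[atBot] (fun s => Real.exp (2 * s)) ∧
      (fun s => θ s - k / 2 * Real.exp s) =O[atBot] (fun s => Real.exp (2 * s)) ∧
      (∃ c a₁ : ℝ, a₁ ≠ 0 ∧
        (fun s => 1 / ψ s - (1 - k ^ 2) * (s - sStar)) =O[𝓝[<] sStar]
          (fun s => (s - sStar) ^ 2) ∧
        (fun s => θ s - (1 / k + c / ψ s
            + a₁ * (-((1 - k ^ 2) * (s - sStar))) ^ (k ^ 2 / (1 - k ^ 2))))
          =O[𝓝[<] sStar] (fun s => (sStar - s) ^ (2 * k ^ 2 / (1 - k ^ 2)))) ∧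
      (∀ (ψ' θ' : ℝ → ℝ) (b : ℝ), phasePlane k (Set.Iio b) ψ' θ' →
        Tendsto ψ' atBot (𝓝 0) → Tendsto θ' atBot (𝓝 0) →
        Tendsto (fun s => ψ' s * Real.exp (-s)) atBot (𝓝 (-1)) →
        ∀ s < min b sStar, ψ' s = ψ s ∧ θ' s = θ s) := by
  have hk1 : k ≤ 1 := by nlinarith
  obtain ⟨b, ψ, θ, h, hbl⟩ := exists_maximal_isInteriorSolution hk hk1 hk2
  obtain ⟨hθlim, L, hL, hexp⟩ := h.exists_expansion hk hk1 hk2 hbl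
  obtain ⟨C, -, hC⟩ := h.exists_neg_inv_sub_le hk hk1 hk2 hbl
  obtain ⟨b₀, ψ₀, θ₀, h₀, hψ₀, hθ₀⟩ := exists_isInteriorSolution k
  have hev := h₀.eventually_eq h hk.le hk1
  refine ⟨b, ψ, θ, h.sol, fun s hs => ⟨h.ψ_neg s hs, h.θ_pos hk hk1 s hs⟩, hbl, hθlim,
    fun s₀ hs₀ => ⟨h.contDiffOn.1.mono (Set.Iic_subset_Iio.2 hs₀),
      h.contDiffOn.2.mono (Set.Iic_subset_Iio.2 hs₀), h.exists_bound hk hk1 hk2 hs₀⟩,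
    hψ₀.congr' ?_ EventuallyEq.rfl, hθ₀.congr' ?_ EventuallyEq.rfl,
    ⟨0, -(L / k), neg_ne_zero.2 (div_pos hL hk).ne', ?_, ?_⟩, ?_⟩
  · filter_upwards [hev] with s hs
    rw [hs.1]
  · filter_upwards [hev] with s hs
    rw [hs.2]
  · refine IsBigO.of_bound C ?_
    filter_upwards [Ioo_mem_nhdsLT (sub_one_lt b)] with s hs
    rw [Real.norm_eq_abs, Real.norm_eq_abs, abs_of_nonneg (sq_nonneg (s - b)), one_div, abs_le]
    have h1 := hC s hs
    have h2 := h.mul_sub_le_neg_inv (by linarith) hs.2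
    have h3 : (s - b) ^ 2 = (b - s) ^ 2 := by ring
    rw [h3]
    exact ⟨by linarith, by linarith⟩
  · simp only [mul_div_assoc, show ∀ s, -((1 - k ^ 2) * (s - b)) = (1 - k ^ 2) * (b - s) from
      fun s => by ring]
    refine (hexp.const_mul_left (-(1 / k))).congr_left fun s => ?_
    field_simp
    ring
  · intro ψ' θ' b' hsol hψ' hθ' hnorm s hs
    exact IsInteriorSolution.unique ⟨hsol, hψ', hθ', hnorm⟩ h hk.le hk1
      (hs.trans_le (min_le_left _ _)) (hs.trans_le (min_le_right _ _))
end

section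
/- Coordinate change from parameter s to self-similar coordinate z (Lemma A.4): Let k² ∈ (0,1/3) and let (ψ,θ) : (−∞,s*) → ℝ² be a solution of the Christodoulou phase-plane system with ψ < 0 on (−∞,s*), ψ smooth and bounded on every (−∞,s₀] with s₀ < s*, and 1/ψ(s) = (1−k²)(s−s*) + O((s−s*)²) as s → s*⁻. Fix s₀ < s* and z₀ ∈ (−1,0), and let z : (−∞,s*) → ℝ solve z′(s) = z(s)·ψ(s) with z(s₀) = z₀. Then z is smooth and strictly increasing, z(s) < 0 for all s < s*, lim_{s→s*⁻} z(s) = 0, and there is a constant c₁ > 0 such that |s − s*| = (c₁ + o(1))·|z(s)|^{1−k²} as s → s*⁻. -/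
open Filter Topology Asymptotics

/-- On a lower ray, a solution of a scalar linear homogeneous equation `z' = z ψ` is the
exponential of a primitive of `ψ`. -/
lemma exists_primitive_eq_mul_exp {b s₀ : ℝ} {ψ z : ℝ → ℝ} (hψ : ContinuousOn ψ (Set.Iio b))
    (hs₀ : s₀ < b) (hz : ∀ s < b, HasDerivAt z (z s * ψ s) s) :
    ∃ F : ℝ → ℝ, (∀ s < b, HasDerivAt F (ψ s) s) ∧ ∀ s < b, z s = z s₀ * Real.exp (F s) := by
  have hF : ∀ s < b, HasDerivAt (fun u => ∫ x in s₀..u, ψ x) (ψ s) s := by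
    intro s hs
    refine intervalIntegral.integral_hasDerivAt_right ?_ ?_ ?_
    · refine (hψ.mono fun x hx => ?_).intervalIntegrable
      exact hx.2.trans_lt (max_lt hs₀ hs)
    · exact hψ.stronglyMeasurableAtFilter isOpen_Iio s hs
    · exact hψ.continuousAt (Iio_mem_nhds hs)
  refine ⟨_, hF, fun s hs => ?_⟩
  have hG : ∀ s < b,
      HasDerivAt (fun u => z u * Real.exp (-∫ x in s₀..u, ψ x)) 0 s := fun s hs =>
    ((hz s hs).mul (hF s hs).neg.exp).congr_deriv (by ring)
  have h := isOpen_Iio.is_const_of_deriv_eq_zero isPreconnected_Iio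
    (fun x hx => (hG x hx).differentiableAt.differentiableWithinAt)
    (fun x hx => (hG x hx).deriv) (Set.mem_Iio.2 hs) (Set.mem_Iio.2 hs₀)
  simp only [intervalIntegral.integral_same, neg_zero, Real.exp_zero, mul_one] at h
  rw [← h, mul_assoc, ← Real.exp_add, neg_add_cancel, Real.exp_zero, mul_one]

/-- A function with bounded derivative to the left of `b` has a limit at `b` from the left. -/
lemma exists_tendsto_nhdsLT_of_abs_deriv_le {b C : ℝ} {w w' : ℝ → ℝ}
    (hw : ∀ᶠ s in 𝓝[<] b, HasDerivAt w (w' s) s) (hC : ∀ᶠ s in 𝓝[<] b, |w' s| ≤ C) :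
    ∃ L, Tendsto w (𝓝[<] b) (𝓝 L) := by
  obtain ⟨l, hl, hlb⟩ := (mem_nhdsLT_iff_exists_Ioo_subset).1 (hw.and hC)
  have hlip : LipschitzOnWith C.toNNReal w (Set.Ioo l b) :=
    (convex_Ioo l b).lipschitzOnWith_of_nnnorm_hasDerivWithin_le
      (fun s hs => (hlb hs).1.hasDerivWithinAt)
      (fun s hs => by
        rw [← NNReal.coe_le_coe, coe_nnnorm, Real.norm_eq_abs]
        exact (hlb hs).2.trans (Real.le_coe_toNNReal C))
  obtain ⟨g, hg, heq⟩ := hlip.extend_real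
  refine ⟨g b, (hg.continuous.continuousAt.tendsto.mono_left nhdsWithin_le_nhds).congr' ?_⟩
  filter_upwards [Ioo_mem_nhdsLT hl] with s hs using (heq hs).symm

/-- If `1 / ψ = a (s - b) + O((s - b)²)` as `s → b⁻` then `1 / (s - b) - a ψ` is bounded there. -/
lemma exists_abs_inv_sub_mul_le {a b : ℝ} {ψ : ℝ → ℝ} (ha : 0 < a)
    (hasymp : (fun s => 1 / ψ s - a * (s - b)) =O[𝓝[<] b] (fun s => (s - b) ^ 2))
    (hψ : ∀ s < b, ψ s ≠ 0) :
    ∃ C, ∀ᶠ s in 𝓝[<] b, |1 / (s - b) - a * ψ s| ≤ C := by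
  obtain ⟨C, hC, hbound⟩ := hasymp.exists_pos
  refine ⟨2 * C / a, ?_⟩
  have hl : b - a / (2 * C) < b := sub_lt_self _ (by positivity)
  filter_upwards [hbound.bound, Ioo_mem_nhdsLT hl] with s hs hsI
  obtain ⟨hs1, hs2⟩ := hsI
  have hψs := hψ s hs2
  rw [Real.norm_eq_abs, Real.norm_eq_abs, abs_pow, sq_abs] at hs
  set t := b - s with ht
  have ht0 : 0 < t := sub_pos.2 hs2
  have htC : C * t ≤ a / 2 := by
    have : t < a / (2 * C) := by linarith
    rw [lt_div_iff₀ (by positivity)] at this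
    linarith
  have hsb : s - b = -t := by ring
  rw [hsb] at hs ⊢
  set e := 1 / ψ s - a * -t with he
  have hinv : 1 / ψ s = e - a * t := by rw [he]; ring
  have het : |e| ≤ a / 2 * t := by nlinarith
  have hneg : a / 2 * t ≤ a * t - e := by linarith [le_abs_self e]
  have hpos : 0 < a * t - e := lt_of_lt_of_le (by positivity) hneg
  have hψe : ψ s = -(1 / (a * t - e)) := by
    rw [← one_div_one_div (ψ s), hinv, ← neg_sub, one_div_neg_eq_neg_one_div]
  have hkey : 1 / -t - a * ψ s = e / (t * (a * t - e)) := by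
    rw [hψe, mul_neg, sub_neg_eq_add, div_neg, mul_one_div, neg_add_eq_sub,
      div_sub_div _ _ hpos.ne' ht0.ne', mul_comm (a * t - e) t]
    congr 1
    ring
  rw [hkey, abs_div, abs_of_pos (mul_pos ht0 hpos), div_le_div_iff₀ (by positivity) ha]
  have h1 : t * (a / 2 * t) ≤ t * (a * t - e) := by gcongr
  nlinarith

/-- **Coordinate change from the parameter `s` to the self-similar coordinate `z`**
(Lemma A.4).  Let `k² ∈ (0,1/3)` and let `(ψ,θ)` solve the phase-plane system on
`(−∞,s*)` with `ψ < 0`, `ψ` smooth and bounded on every `(−∞,s₀]` (`s₀ < s*`), and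
`1/ψ(s) = (1−k²)(s−s*) + O((s−s*)²)` as `s → s*⁻`.  If `z` solves `z′ = zψ` with
`z(s₀) = z₀ ∈ (−1,0)` then `z` is smooth, strictly increasing, negative on `(−∞,s*)`,
`z → 0` as `s → s*⁻`, and `|s−s*| = (c₁ + o(1))·|z|^{1−k²}` for some `c₁ > 0`. -/
theorem coordinate_change_s_to_z
    (k : ℝ) (hk2 : 0 < k ^ 2) (hk2' : k ^ 2 < 1 / 3)
    (sStar : ℝ) (ψ θ : ℝ → ℝ)
    (hsys : phasePlane k (Set.Iio sStar) ψ θ)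
    (hψneg : ∀ s < sStar, ψ s < 0)
    (hψreg : ∀ s₀ < sStar, ContDiffOn ℝ (⊤ : ℕ∞) ψ (Set.Iic s₀) ∧ ∃ M, ∀ s ≤ s₀, |ψ s| ≤ M)
    (hasymp : (fun s => 1 / ψ s - (1 - k ^ 2) * (s - sStar)) =O[𝓝[<] sStar]
      (fun s => (s - sStar) ^ 2))
    (s₀ z₀ : ℝ) (hs₀ : s₀ < sStar) (hz₀ : z₀ ∈ Set.Ioo (-1 : ℝ) 0)
    (z : ℝ → ℝ)
    (hz : ∀ s < sStar, HasDerivAt z (z s * ψ s) s)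
    (hzs₀ : z s₀ = z₀) :
    ContDiffOn ℝ (⊤ : ℕ∞) z (Set.Iio sStar) ∧
    StrictMonoOn z (Set.Iio sStar) ∧
    (∀ s < sStar, z s < 0) ∧
    Tendsto z (𝓝[<] sStar) (𝓝 0) ∧
    ∃ c₁ : ℝ, 0 < c₁ ∧
      Tendsto (fun s => (sStar - s) / (-z s) ^ (1 - k ^ 2)) (𝓝[<] sStar) (𝓝 c₁) := by
  have ha : 0 < 1 - k ^ 2 := by linarith
  have hψsmooth : ContDiffOn ℝ (⊤ : ℕ∞) ψ (Set.Iio sStar) := by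
    intro s hs
    obtain ⟨m, hsm, hm⟩ := exists_between (Set.mem_Iio.1 hs)
    exact ((hψreg m hm).1.contDiffAt (Iic_mem_nhds hsm)).contDiffWithinAt
  obtain ⟨F, hF, hzF⟩ := exists_primitive_eq_mul_exp hψsmooth.continuousOn hs₀ hz
  have hneg : ∀ s < sStar, z s < 0 := fun s hs => by
    rw [hzF s hs, hzs₀]
    exact mul_neg_of_neg_of_pos hz₀.2 (Real.exp_pos _)
  have hFsmooth : ContDiffOn ℝ (⊤ : ℕ∞) F (Set.Iio sStar) := by
    rw [contDiffOn_infty_iff_deriv_of_isOpen isOpen_Iio]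
    exact ⟨fun s hs => (hF s hs).differentiableAt.differentiableWithinAt,
      hψsmooth.congr fun s hs => (hF s hs).deriv⟩
  have hlt : ∀ᶠ s in 𝓝[<] sStar, s < sStar := self_mem_nhdsWithin
  obtain ⟨C, hC⟩ := exists_abs_inv_sub_mul_le ha hasymp fun s hs => (hψneg s hs).ne
  have hw : ∀ᶠ s in 𝓝[<] sStar,
      HasDerivAt (fun u => Real.log (sStar - u) - (1 - k ^ 2) * Real.log (-z u))
        (1 / (s - sStar) - (1 - k ^ 2) * ψ s) s := by
    filter_upwards [hlt] with s hs
    have hs' := (sub_pos.2 hs).ne'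
    have hs'' := (sub_neg.2 hs).ne
    have hzs := (hneg s hs).ne
    refine ((((hasDerivAt_id s).const_sub sStar).log hs').sub
      (((hz s hs).neg.log (neg_ne_zero.2 hzs)).const_mul (1 - k ^ 2))).congr_deriv ?_
    have h1 : -(z s * ψ s) / -z s = ψ s := by field_simp
    have h2 : -1 / (sStar - s) = 1 / (s - sStar) := by
      rw [← neg_sub s sStar, neg_div_neg_eq]
    simp only [id, Pi.neg_apply, h1, h2]
  obtain ⟨L, hL⟩ := exists_tendsto_nhdsLT_of_abs_deriv_le hw hC
  have hratio : Tendsto (fun s => (sStar - s) / (-z s) ^ (1 - k ^ 2)) (𝓝[<] sStar)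
      (𝓝 (Real.exp L)) := by
    refine ((Real.continuous_exp.tendsto L).comp hL).congr' ?_
    filter_upwards [hlt] with s hs
    rw [Function.comp_apply, Real.exp_sub, Real.exp_log (sub_pos.2 hs),
      Real.rpow_def_of_pos (neg_pos.2 (hneg s hs)), mul_comm (Real.log _)]
  refine ⟨?_, ?_, hneg, ?_, Real.exp L, Real.exp_pos L, hratio⟩
  · exact (contDiffOn_const.mul hFsmooth.exp).congr hzF
  · refine strictMonoOn_of_deriv_pos (convex_Iio sStar)
      (fun s hs => (hz s hs).continuousAt.continuousWithinAt) fun s hs => ?_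
    rw [interior_Iio] at hs
    rw [(hz s hs).deriv]
    exact mul_pos_of_neg_of_neg (hneg s hs) (hψneg s hs)
  · have hsub : Tendsto (fun s => sStar - s) (𝓝[<] sStar) (𝓝 0) := by
      have : Tendsto (fun s => sStar - s) (𝓝 sStar) (𝓝 (sStar - sStar)) :=
        (continuous_const.sub continuous_id).tendsto sStar
      rw [sub_self] at this
      exact this.mono_left nhdsWithin_le_nhds
    have hpow := (hsub.div hratio (Real.exp_pos L).ne').rpow_const
      (p := (1 - k ^ 2)⁻¹) (Or.inr (inv_pos.2 ha).le)
    rw [zero_div, Real.zero_rpow (inv_pos.2 ha).ne'] at hpow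
    have hlim := hpow.neg
    rw [neg_zero] at hlim
    refine hlim.congr' ?_
    filter_upwards [hlt] with s hs
    have hzs := neg_pos.2 (hneg s hs)
    rw [Pi.div_apply, div_div_cancel₀ (sub_pos.2 hs).ne', Real.rpow_rpow_inv hzs.le ha.ne', neg_neg]
end

section
/- Blowup rates near the past lightcone (Lemma A.5): Let k > 0 with k² ∈ (0,1/3) and z₀ ∈ (−1,0). Let ψ, θ be continuous on [z₀,0) with ψ < 0 and, as z → 0⁻, 1/ψ(z) = −(c₁ + o(1))·|z|^{1−k²} and θ(z) = 1/k − (c₂ + o(1))·|z|^{k²} for constants c₁ > 0 and c₂ ≠ 0. Let r̊ ∈ C¹([z₀,0)) satisfy r̊(z₀) > 0 and r̊′/r̊ = 1/(zψ), and set λ̊ := r̊′ = r̊/(zψ), ν̊ := zλ̊ − r̊, φ̊′ := θ/(zψ), Ω̊² := 4·(−ν̊λ̊ + r̊² z (φ̊′)² + 2k z λ̊ r̊ φ̊′ + r̊ λ̊ k²), μ̊ := 1 + 4ν̊λ̊/Ω̊². Then, as z → 0⁻: r̊(z) converges to a finite positive limit r̊(0); λ̊(z) ≍ |z|^{−k²};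 ν̊(z) → −r̊(0); |φ̊′(z)| ≍ |z|^{−k²}; Ω̊²(z) ≍ |z|^{−k²}; and μ̊(z) → k²/(1+k²). -/
open Filter Topology

/-- A nonnegative logarithmic derivative preserves positivity of the initial value. -/
theorem pos_of_logDeriv_nonneg {a b : ℝ} (hab : a < b) {r g : ℝ → ℝ}
    (hg : ∀ z ∈ Set.Ico a b, 0 ≤ g z) (hr₀ : 0 < r a)
    (hr : ∀ z ∈ Set.Ico a b, HasDerivWithinAt r (r z * g z) (Set.Ico a b) z) :
    ∀ z ∈ Set.Ico a b, 0 < r z := by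
  have hcont : ContinuousOn r (Set.Ico a b) := fun z hz => (hr z hz).continuousWithinAt
  have hderiv : ∀ z ∈ Set.Ioo a b, HasDerivAt (fun x => r x ^ 2) (2 * r z * (r z * g z)) z := by
    intro z hz
    have h := (hr z ⟨hz.1.le, hz.2⟩).hasDerivAt (Ico_mem_nhds hz.1 hz.2)
    exact (h.fun_pow 2).congr_deriv (by norm_num)
  have hmono : MonotoneOn (fun x => r x ^ 2) (Set.Ico a b) := by
    refine monotoneOn_of_deriv_nonneg (convex_Ico a b) (hcont.pow 2) ?_ ?_
    · rw [interior_Ico]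
      exact fun z hz => (hderiv z hz).differentiableAt.differentiableWithinAt
    · rw [interior_Ico]
      intro z hz
      rw [(hderiv z hz).deriv]
      have := mul_nonneg (sq_nonneg (r z)) (hg z ⟨hz.1.le, hz.2⟩)
      nlinarith
  intro z hz
  by_contra! hneg
  have hsub : Set.Icc a z ⊆ Set.Ico a b := fun x hx => ⟨hx.1, hx.2.trans_lt hz.2⟩
  obtain ⟨x, hx, hx0⟩ := intermediate_value_Icc' hz.1 (hcont.mono hsub) ⟨hneg, hr₀.le⟩
  have h := hmono ⟨le_rfl, hab⟩ (hsub hx) hx.1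
  simp only [hx0] at h
  nlinarith

/-- A positive solution of `r' = r g`, with `0 ≤ g` and `g ≤ C |z| ^ (-a)` near `0`, `a < 1`,
has a positive limit at `0` from the left. -/
theorem tendsto_pos_of_logDeriv_le_rpow {z₀ a C : ℝ} (hz₀ : z₀ < 0) (ha : a < 1)
    {r g : ℝ → ℝ} (hg : ∀ z ∈ Set.Ico z₀ 0, 0 ≤ g z) (hr₀ : 0 < r z₀)
    (hr : ∀ z ∈ Set.Ico z₀ 0, HasDerivWithinAt r (r z * g z) (Set.Ico z₀ 0) z)
    (hgC : ∀ᶠ z in 𝓝[<] (0 : ℝ), g z ≤ C * |z| ^ (-a)) :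
    ∃ L : ℝ, 0 < L ∧ Tendsto r (𝓝[<] 0) (𝓝 L) := by
  have hpos := pos_of_logDeriv_nonneg hz₀ hg hr₀ hr
  have hC : 0 ≤ C := by
    have hI : ∀ᶠ z in 𝓝[<] (0 : ℝ), z ∈ Set.Ico z₀ 0 := Ico_mem_nhdsLT hz₀
    obtain ⟨z, h1, h2⟩ := (hgC.and hI).exists
    have := (hg z h2).trans h1
    exact nonneg_of_mul_nonneg_left this (Real.rpow_pos_of_pos (abs_pos.2 h2.2.ne) _)
  obtain ⟨d, hd, hdC⟩ := mem_nhdsLT_iff_exists_Ioo_subset.1 hgC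
  obtain ⟨δ, hδm, hδ0⟩ := exists_between (max_lt hz₀ hd)
  have hz₀δ : z₀ < δ := (le_max_left _ _).trans_lt hδm
  have hdδ : d < δ := (le_max_right _ _).trans_lt hδm
  have hsub : Set.Ioo δ 0 ⊆ Set.Ico z₀ 0 := fun z hz => ⟨(hz₀δ.trans hz.1).le, hz.2⟩
  have hder : ∀ z ∈ Set.Ico δ 0, HasDerivAt r (r z * g z) z := fun z hz =>
    (hr z ⟨hz₀δ.le.trans hz.1, hz.2⟩).hasDerivAt (Ico_mem_nhds (hz₀δ.trans_le hz.1) hz.2)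
  have hmono : MonotoneOn r (Set.Ico δ 0) := by
    refine monotoneOn_of_deriv_nonneg (convex_Ico δ 0)
      (fun z hz => (hder z hz).continuousAt.continuousWithinAt) ?_ ?_
    · rw [interior_Ico]
      exact fun z hz =>
        (hder z (Set.Ioo_subset_Ico_self hz)).differentiableAt.differentiableWithinAt
    · rw [interior_Ico]
      intro z hz
      rw [(hder z (Set.Ioo_subset_Ico_self hz)).deriv]
      exact mul_nonneg (hpos z (hsub hz)).le (hg z (hsub hz))
  have hder2 : ∀ z ∈ Set.Ico δ 0,
      HasDerivAt (fun x => Real.log (r x) + C / (1 - a) * (-x) ^ (1 - a))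
        (g z - C * |z| ^ (-a)) z := by
    intro z hz
    have hrz : 0 < r z := hpos z ⟨hz₀δ.le.trans hz.1, hz.2⟩
    have h1 := (hder z hz).log hrz.ne'
    have h2 := ((hasDerivAt_id z).neg.rpow_const (p := 1 - a)
      (Or.inl (by simpa using hz.2.ne))).const_mul (C / (1 - a))
    refine (h1.add h2).congr_deriv ?_
    have h1a : 1 - a ≠ 0 := by linarith
    rw [abs_of_neg hz.2]
    simp only [Pi.neg_apply, id, show 1 - a - 1 = -a by ring]
    field_simp
    ring
  have hanti : AntitoneOn (fun x => Real.log (r x) + C / (1 - a) * (-x) ^ (1 - a))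
      (Set.Ico δ 0) := by
    refine antitoneOn_of_deriv_nonpos (convex_Ico δ 0)
      (fun z hz => (hder2 z hz).continuousAt.continuousWithinAt) ?_ ?_
    · rw [interior_Ico]
      exact fun z hz =>
        (hder2 z (Set.Ioo_subset_Ico_self hz)).differentiableAt.differentiableWithinAt
    · rw [interior_Ico]
      intro z hz
      rw [(hder2 z (Set.Ioo_subset_Ico_self hz)).deriv]
      exact sub_nonpos.2 (hdC ⟨hdδ.trans hz.1, hz.2⟩)
  have hbdd : BddAbove (r '' Set.Ioo δ 0) := by
    refine ⟨Real.exp (Real.log (r δ) + C / (1 - a) * (-δ) ^ (1 - a)), ?_⟩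
    rintro _ ⟨z, hz, rfl⟩
    rw [← Real.log_le_iff_le_exp (hpos z (hsub hz))]
    have h := hanti ⟨le_rfl, hδ0⟩ (Set.Ioo_subset_Ico_self hz) hz.1.le
    have h2 : 0 ≤ C / (1 - a) * (-z) ^ (1 - a) :=
      mul_nonneg (div_nonneg hC (by linarith)) (Real.rpow_nonneg (by linarith [hz.2]) _)
    dsimp only at h
    linarith
  have hlim := (hmono.mono Set.Ioo_subset_Ico_self).tendsto_nhdsWithin_Ioo_left
    (Set.nonempty_Ioo.2 hδ0) hbdd
  refine ⟨_, ?_, hlim⟩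
  obtain ⟨z, hz⟩ := Set.nonempty_Ioo.2 hδ0
  exact (hpos z (hsub hz)).trans_le (le_csSup hbdd ⟨z, hz, rfl⟩)

/-- A function whose quotient by an eventually positive `w` has a positive limit is comparable
to `w`. -/
theorem exists_bounds_of_tendsto_div {α : Type*} {l : Filter α} {f w : α → ℝ} {L : ℝ}
    (hL : 0 < L) (hw : ∀ᶠ z in l, 0 < w z) (h : Tendsto (fun z => f z / w z) l (𝓝 L)) :
    ∃ C c : ℝ, 0 < c ∧ 0 < C ∧ ∀ᶠ z in l, c * w z ≤ f z ∧ f z ≤ C * w z := by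
  refine ⟨2 * L, L / 2, by positivity, by positivity, ?_⟩
  filter_upwards [hw, h.eventually_const_le (half_lt_self hL),
    h.eventually_le_const (show L < 2 * L by linarith)] with z hz h1 h2
  exact ⟨(le_div_iff₀ hz).1 h1, (div_le_iff₀ hz).1 h2⟩

/-- **Blowup rates near the past lightcone** (Lemma A.5).  Let `k > 0` with
`k² ∈ (0,1/3)`, `z₀ ∈ (−1,0)`, and let `ψ, θ` be continuous on `[z₀,0)` with `ψ < 0`
and the asymptotics `1/ψ(z) = −(c₁+o(1))|z|^{1−k²}`, `θ(z) = 1/k − (c₂+o(1))|z|^{k²}`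
as `z → 0⁻` (`c₁ > 0`, `c₂ ≠ 0`).  Let `r̊ ∈ C¹([z₀,0))` with `r̊(z₀) > 0` and
`r̊′/r̊ = 1/(zψ)`, and define `λ̊ = r̊/(zψ)`, `ν̊ = zλ̊ − r̊`, `φ̊′ = θ/(zψ)`,
`Ω̊² = 4(−ν̊λ̊ + r̊²z(φ̊′)² + 2kzλ̊r̊φ̊′ + r̊λ̊k²)`, `μ̊ = 1 + 4ν̊λ̊/Ω̊²`.  Then as
`z → 0⁻`: `r̊` has a finite positive limit `r̊(0)`; `λ̊ ≍ |z|^{−k²}`; `ν̊ → −r̊(0)`;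
`|φ̊′| ≍ |z|^{−k²}`; `Ω̊² ≍ |z|^{−k²}`; and `μ̊ → k²/(1+k²)`. -/
theorem blowup_rates_past_lightcone
    (k : ℝ) (hk : 0 < k) (hk2 : k ^ 2 < 1 / 3)
    (z₀ : ℝ) (hz₀ : z₀ ∈ Set.Ioo (-1 : ℝ) 0)
    (ψ θ : ℝ → ℝ)
    (hψc : ContinuousOn ψ (Set.Ico z₀ 0)) (hθc : ContinuousOn θ (Set.Ico z₀ 0))
    (hψneg : ∀ z ∈ Set.Ico z₀ 0, ψ z < 0)
    (c₁ c₂ : ℝ) (hc₁ : 0 < c₁) (hc₂ : c₂ ≠ 0)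
    (hψa : Tendsto (fun z => (ψ z)⁻¹ / |z| ^ (1 - k ^ 2)) (𝓝[<] 0) (𝓝 (-c₁)))
    (hθa : Tendsto (fun z => (θ z - 1 / k) / |z| ^ (k ^ 2)) (𝓝[<] 0) (𝓝 (-c₂)))
    (rP : ℝ → ℝ) (hr : ContDiffOn ℝ 1 rP (Set.Ico z₀ 0)) (hr₀ : 0 < rP z₀)
    (hrode : ∀ z ∈ Set.Ico z₀ 0,
      HasDerivWithinAt rP (rP z / (z * ψ z)) (Set.Ico z₀ 0) z)
    (lamP nuP dφP Ω2P μP : ℝ → ℝ)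
    (hlam : lamP = fun z => rP z / (z * ψ z))
    (hnu : nuP = fun z => z * lamP z - rP z)
    (hdφ : dφP = fun z => θ z / (z * ψ z))
    (hΩ2 : Ω2P = fun z => 4 * (-(nuP z) * lamP z + rP z ^ 2 * z * dφP z ^ 2
      + 2 * k * z * lamP z * rP z * dφP z + rP z * lamP z * k ^ 2))
    (hμ : μP = fun z => 1 + 4 * nuP z * lamP z / Ω2P z) :
    ∃ r0 : ℝ, 0 < r0 ∧
      Tendsto rP (𝓝[<] 0) (𝓝 r0) ∧
      (∃ C c : ℝ, 0 < c ∧ 0 < C ∧ ∀ᶠ z in 𝓝[<] (0:ℝ),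
        c * |z| ^ (-(k ^ 2)) ≤ lamP z ∧ lamP z ≤ C * |z| ^ (-(k ^ 2))) ∧
      Tendsto nuP (𝓝[<] 0) (𝓝 (-r0)) ∧
      (∃ C c : ℝ, 0 < c ∧ 0 < C ∧ ∀ᶠ z in 𝓝[<] (0:ℝ),
        c * |z| ^ (-(k ^ 2)) ≤ |dφP z| ∧ |dφP z| ≤ C * |z| ^ (-(k ^ 2))) ∧
      (∃ C c : ℝ, 0 < c ∧ 0 < C ∧ ∀ᶠ z in 𝓝[<] (0:ℝ),
        c * |z| ^ (-(k ^ 2)) ≤ Ω2P z ∧ Ω2P z ≤ C * |z| ^ (-(k ^ 2))) ∧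
      Tendsto μP (𝓝[<] 0) (𝓝 (k ^ 2 / (1 + k ^ 2))) := by
  have ha : k ^ 2 < 1 := by linarith
  have hIco : ∀ᶠ z in 𝓝[<] (0 : ℝ), z ∈ Set.Ico z₀ 0 := Ico_mem_nhdsLT hz₀.2
  have hwpos : ∀ᶠ z in 𝓝[<] (0 : ℝ), 0 < |z| ^ (-(k ^ 2)) := by
    filter_upwards [hIco] with z hz
    exact Real.rpow_pos_of_pos (abs_pos.2 hz.2.ne) _
  have habs : Tendsto (fun z : ℝ => |z|) (𝓝[<] 0) (𝓝 0) :=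
    (by simpa using (continuous_abs.tendsto (0 : ℝ)) :
      Tendsto (fun z : ℝ => |z|) (𝓝 0) (𝓝 0)).mono_left nhdsWithin_le_nhds
  have hrpow : ∀ p : ℝ, 0 < p → Tendsto (fun z : ℝ => |z| ^ p) (𝓝[<] 0) (𝓝 0) := by
    intro p hp
    simpa [Real.zero_rpow hp.ne'] using habs.rpow_const (Or.inr hp.le)
  set g : ℝ → ℝ := fun z => (z * ψ z)⁻¹ with hgdef
  have hgpos : ∀ z ∈ Set.Ico z₀ 0, 0 < g z := fun z hz =>
    inv_pos.2 (mul_pos_of_neg_of_neg hz.2 (hψneg z hz))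
  have hgw : Tendsto (fun z => g z / |z| ^ (-(k ^ 2))) (𝓝[<] 0) (𝓝 c₁) := by
    refine (by simpa using hψa.neg : Tendsto _ _ (𝓝 c₁)).congr' ?_
    filter_upwards [hIco] with z hz
    have hz0 : 0 < |z| := abs_pos.2 hz.2.ne
    have hw := Real.rpow_pos_of_pos hz0 (-(k ^ 2))
    have hψ := (hψneg z hz).ne
    have hz' := hz.2.ne
    rw [sub_eq_add_neg, Real.rpow_add hz0, Real.rpow_one]
    generalize |z| ^ (-(k ^ 2)) = w at hw
    rw [hgdef, abs_of_neg hz.2]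
    field_simp
  have hzg : Tendsto (fun z => z * g z) (𝓝[<] 0) (𝓝 0) := by
    have h := (hgw.mul (hrpow (1 - k ^ 2) (by linarith))).neg
    simp only [mul_zero, neg_zero] at h
    refine h.congr' ?_
    filter_upwards [hIco] with z hz
    have hz0 : 0 < |z| := abs_pos.2 hz.2.ne
    have hw := Real.rpow_pos_of_pos hz0 (-(k ^ 2))
    rw [sub_eq_add_neg, Real.rpow_add hz0, Real.rpow_one]
    generalize |z| ^ (-(k ^ 2)) = w at hw
    rw [abs_of_neg hz.2]
    field_simp
  have hθ : Tendsto θ (𝓝[<] 0) (𝓝 (1 / k)) := by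
    have h := (hθa.mul (hrpow (k ^ 2) (by positivity))).add_const (1 / k)
    simp only [mul_zero, zero_add] at h
    refine h.congr' ?_
    filter_upwards [hIco] with z hz
    have hw := Real.rpow_pos_of_pos (abs_pos.2 hz.2.ne) (k ^ 2)
    rw [div_mul_cancel₀ _ hw.ne', sub_add_cancel]
  obtain ⟨r0, hr0, hrlim⟩ : ∃ L : ℝ, 0 < L ∧ Tendsto rP (𝓝[<] 0) (𝓝 L) := by
    obtain ⟨C, c, -, -, h⟩ := exists_bounds_of_tendsto_div hc₁ hwpos hgw
    exact tendsto_pos_of_logDeriv_le_rpow hz₀.2 ha (fun z hz => (hgpos z hz).le) hr₀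
      (fun z hz => by simpa [hgdef, div_eq_mul_inv] using hrode z hz) (h.mono fun z hz => hz.2)
  have hlam' : ∀ z, lamP z = rP z * g z := fun z => by simp only [hlam, hgdef, div_eq_mul_inv]
  have hdφ' : ∀ z, dφP z = θ z * g z := fun z => by simp only [hdφ, hgdef, div_eq_mul_inv]
  have hnu' : ∀ z, nuP z = rP z * (z * g z) - rP z := fun z => by
    simp only [hnu, hlam']
    ring
  have hnulim : Tendsto nuP (𝓝[<] 0) (𝓝 (-r0)) := by
    rw [funext hnu']
    simpa using (hrlim.mul hzg).sub hrlim
  set q : ℝ → ℝ := fun z =>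
    4 * rP z ^ 2 * (1 + k ^ 2 + z * g z * (θ z ^ 2 + 2 * k * θ z - 1)) with hqdef
  have hΩ' : ∀ z, Ω2P z = q z * g z := fun z => by
    simp only [hΩ2, hqdef, hdφ', hlam', hnu']
    ring
  have hq : Tendsto q (𝓝[<] 0) (𝓝 (4 * r0 ^ 2 * (1 + k ^ 2))) := by
    have h := ((hrlim.pow 2).const_mul 4).mul ((hzg.mul
      (((hθ.pow 2).add (hθ.const_mul (2 * k))).sub_const 1)).const_add (1 + k ^ 2))
    simpa only [zero_mul, add_zero] using h
  have hqpos : 0 < 4 * r0 ^ 2 * (1 + k ^ 2) := by positivity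
  refine ⟨r0, hr0, hrlim, ?_, hnulim, ?_, ?_, ?_⟩
  · refine exists_bounds_of_tendsto_div (mul_pos hr0 hc₁) hwpos ?_
    simpa only [hlam', mul_div_assoc] using hrlim.mul hgw
  · refine exists_bounds_of_tendsto_div (L := |1 / k * c₁|) (by positivity) hwpos ?_
    refine (hθ.mul hgw).abs.congr' ?_
    filter_upwards [hwpos] with z hz
    rw [hdφ', ← mul_div_assoc, abs_div, abs_of_pos hz]
  · refine exists_bounds_of_tendsto_div (mul_pos hqpos hc₁) hwpos ?_
    simpa only [hΩ', mul_div_assoc] using hq.mul hgw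
  · have h := (((hnulim.const_mul 4).mul hrlim).div hq hqpos.ne').const_add 1
    have hval : 1 + 4 * -r0 * r0 / (4 * r0 ^ 2 * (1 + k ^ 2)) = k ^ 2 / (1 + k ^ 2) := by
      field_simp
      ring
    rw [hval] at h
    refine h.congr' ?_
    filter_upwards [hIco] with z hz
    rw [hμ]
    simp only [Pi.div_apply, hΩ', hlam']
    rw [← mul_assoc, mul_div_mul_right _ _ (hgpos z hz).ne']
end
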